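/- Let q be an even prime power with q ≥ 2048, and let K be a complete k-cap in PG(4, q) with k ≥ q³ − 2q² + 3q√q + 8q − 9√q − 6. Then there do not exist a point N not in K and planes π₁, π₂ of PG(4, q) with π₁ ∩ π₂ = {N} such that, for i = 1, 2, the set πᵢ ∩ K is a (q+1)-arc of the plane πᵢ having nucleus N. -/

import Mathlib

open Module

/-- Points of the projective space `PG(n, q)` over the field `F` (with `q = |F|`). -/
abbrev PGPoint (F : Type*) [Field F] (n : ℕ) := Projectivization F (Fin (n + 1) → F)

/-- The set of projective points lying in the projective subspace determined by
a linear subspace `W`. -/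
def ptsIn {F : Type*} [Field F] {n : ℕ} (W : Submodule F (Fin (n + 1) → F)) :
    Set (PGPoint F n) := {P | P.submodule ≤ W}

/-- Three points of `PG(n, q)` are collinear if they lie on a common line. -/
def Coll3 {F : Type*} [Field F] {n : ℕ} (P₁ P₂ P₃ : PGPoint F n) : Prop :=
  Module.finrank F ↥(P₁.submodule ⊔ P₂.submodule ⊔ P₃.submodule) ≤ 2

/-- A cap (a plane arc when `n = 2`): a set of points no three of which are collinear. -/
def IsCap {F : Type*} [Field F] {n : ℕ} (K : Set (PGPoint F n)) : Prop :=
  ∀ P₁ ∈ K, ∀ P₂ ∈ K, ∀ P₃ ∈ K, P₁ ≠ P₂ → P₁ ≠ P₃ → P₂ ≠ P₃ → ¬ Coll3 P₁ P₂ P₃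

/-- A complete cap: a cap that is not contained in a cap with one more point. -/
def IsCompleteCap {F : Type*} [Field F] {n : ℕ} (K : Set (PGPoint F n)) : Prop :=
  IsCap K ∧ ∀ P ∉ K, ¬ IsCap (insert P K)

/-- A tangent line of `K`: a line (2-dimensional linear subspace) meeting `K`
in exactly one point. -/
def IsTangent {F : Type*} [Field F] {n : ℕ} (K : Set (PGPoint F n))
    (W : Submodule F (Fin (n + 1) → F)) : Prop :=
  Module.finrank F W = 2 ∧ (ptsIn W ∩ K).ncard = 1

/-- `N` is a nucleus of the arc `A` of the plane `W`: every tangent line of `A`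
lying in the plane `W` passes through `N`. -/
def IsNucleus {F : Type*} [Field F] {n : ℕ} (W : Submodule F (Fin (n + 1) → F))
    (A : Set (PGPoint F n)) (N : PGPoint F n) : Prop :=
  ∀ ℓ : Submodule F (Fin (n + 1) → F), Module.finrank F ℓ = 2 → ℓ ≤ W →
    (ptsIn ℓ ∩ A).ncard = 1 → N.submodule ≤ ℓ

section Helpers
set_option linter.all false
set_option linter.unusedSectionVars false
set_option linter.style.haveILetI false
open scoped Classical

variable {F : Type*} [Field F] [Finite F] {V : Type*} [AddCommGroup V] [Module F V] [Finite V]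

noncomputable def rk {F : Type*} [Field F] {V : Type*} [AddCommGroup V] [Module F V]
  (W : Submodule F V) : ℕ := finrank F W

noncomputable instance subFintype {F : Type*} [Field F] {V : Type*} [AddCommGroup V] [Module F V] [Finite V] :
  Fintype (Submodule F V) := Fintype.ofFinite _

theorem rk_mono {A B : Submodule F V} (h : A ≤ B) : rk A ≤ rk B :=
  Submodule.finrank_mono h

theorem rk_lt {A B : Submodule F V} (h : A < B) : rk A < rk B :=
  Submodule.finrank_lt_finrank_of_lt h

theorem eq_of_rk {A B : Submodule F V} (h : A ≤ B) (h2 : rk B ≤ rk A) : A = B :=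
  Submodule.eq_of_le_of_finrank_le h h2

theorem rk_sup_inf (A B : Submodule F V) : rk (A ⊔ B) + rk (A ⊓ B) = rk A + rk B :=
  Submodule.finrank_sup_add_finrank_inf_eq A B

theorem rk_bot : rk (⊥ : Submodule F V) = 0 := finrank_bot F V

theorem rk_eq_zero {A : Submodule F V} (h : rk A = 0) : A = ⊥ := Submodule.finrank_eq_zero.mp h

/-- a point is not below `A` iff it meets `A` trivially -/
theorem pt_inf {P A : Submodule F V} (hP : rk P = 1) (h : ¬ P ≤ A) : A ⊓ P = ⊥ := by
  apply rk_eq_zero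
  by_contra h0
  have h1 : rk (A ⊓ P) ≤ rk P := rk_mono inf_le_right
  have := eq_of_rk (inf_le_right : A ⊓ P ≤ P) (by omega)
  exact h (this ▸ inf_le_left)

theorem rk_sup_pt {P A : Submodule F V} (hP : rk P = 1) (h : ¬ P ≤ A) : rk (A ⊔ P) = rk A + 1 := by
  have := rk_sup_inf A P
  rw [pt_inf hP h, rk_bot] at this
  omega

theorem rk_sup_pt_le {P A : Submodule F V} (hP : rk P = 1) : rk (A ⊔ P) ≤ rk A + 1 := by
  have := rk_sup_inf A P
  omega

theorem pt_le_pt {P Q : Submodule F V} (hP : rk P = 1) (hQ : rk Q = 1) (h : P ≤ Q) : P = Q :=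
  eq_of_rk h (by omega)

theorem rk_line {P Q : Submodule F V} (hP : rk P = 1) (hQ : rk Q = 1) (h : P ≠ Q) :
    rk (P ⊔ Q) = 2 := by
  have := rk_sup_pt hQ (A := P) (fun h' => h (pt_le_pt hQ hP h').symm)
  omega

theorem eq_sup_pt {A L P : Submodule F V} (hP : rk P = 1) (hA : A ≤ L) (hPL : P ≤ L)
    (h : ¬ P ≤ A) (hL : rk L = rk A + 1) : L = A ⊔ P := by
  symm
  exact eq_of_rk (sup_le hA hPL) (by rw [rk_sup_pt hP h]; omega)

theorem eq_line {P Q L : Submodule F V} (hP : rk P = 1) (hQ : rk Q = 1) (h : P ≠ Q)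
    (hPL : P ≤ L) (hQL : Q ≤ L) (hL : rk L = 2) : L = P ⊔ Q := by
  symm
  exact eq_of_rk (sup_le hPL hQL) (by rw [rk_line hP hQ h]; omega)

/-- exchange -/
theorem exch {P X Q : Submodule F V} (hP : rk P = 1) (hQ : rk Q = 1) (hX : rk X = 1)
    (h : X ≤ P ⊔ Q) (hXP : X ≠ P) : P ⊔ Q = P ⊔ X := by
  by_cases hPQ : P = Q
  · subst hPQ
    rw [sup_idem] at h
    exact absurd (pt_le_pt hX hP h) hXP
  · exact eq_line hP hX hXP.symm le_sup_left h (rk_line hP hQ hPQ)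

theorem pt_ne_bot {P : Submodule F V} (hP : rk P = 1) : ∃ v ∈ P, v ≠ 0 := by
  by_contra! h
  have : P = ⊥ := by
    rw [Submodule.eq_bot_iff]; exact h
  rw [this, rk_bot] at hP
  omega

theorem rk_span {v : V} (h : v ≠ 0) : rk (Submodule.span F {v}) = 1 := finrank_span_singleton h

theorem pt_eq_span {P : Submodule F V} (hP : rk P = 1) : ∃ v, v ≠ 0 ∧ P = Submodule.span F {v} := by
  obtain ⟨v, hv, h0⟩ := pt_ne_bot hP
  refine ⟨v, h0, ?_⟩
  symm
  apply pt_le_pt (rk_span h0) hP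
  simpa using hv

noncomputable def up (A W : Submodule F V) : Finset (Submodule F V) :=
  Finset.univ.filter (fun L => A ≤ L ∧ L ≤ W ∧ rk L = rk A + 1)

theorem mem_up {A W L : Submodule F V} : L ∈ up A W ↔ A ≤ L ∧ L ≤ W ∧ rk L = rk A + 1 := by
  simp [up]

theorem sup_mem_up {A W P : Submodule F V} (hP : rk P = 1) (hAW : A ≤ W) (hPW : P ≤ W)
    (h : ¬ P ≤ A) : A ⊔ P ∈ up A W := by
  rw [mem_up]
  exact ⟨le_sup_left, sup_le hAW hPW, rk_sup_pt hP h⟩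

theorem natCard_sub (W : Submodule F V) : Nat.card W = Nat.card F ^ rk W := 
  Module.natCard_eq_pow_finrank

noncomputable def vecs {F : Type*} [Field F] {V : Type*} [AddCommGroup V] [Module F V] [Finite V]
  (W A : Submodule F V) : Finset V := 
  letI := Fintype.ofFinite V
  Finset.univ.filter (fun v => v ∈ W ∧ v ∉ A)

theorem mem_vecs {W A : Submodule F V} {v : V} : v ∈ vecs W A ↔ v ∈ W ∧ v ∉ A := by
  simp [vecs]

theorem card_vecs {W A : Submodule F V} (h : A ≤ W) :
    ((vecs W A).card : ℤ) = (Nat.card F : ℤ) ^ rk W - (Nat.card F : ℤ) ^ rk A := by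
  letI := Fintype.ofFinite V
  have e : ∀ B : Submodule F V, (Finset.univ.filter (fun v : V => v ∈ B)).card = Nat.card F ^ rk B := by
    intro B
    rw [← natCard_sub, Nat.card_eq_fintype_card, Fintype.card_subtype]
  have : vecs W A = (Finset.univ.filter (fun v : V => v ∈ W)) \ (Finset.univ.filter (fun v : V => v ∈ A)) := by
    ext v; simp [mem_vecs]
  rw [this, Finset.card_sdiff_of_subset, Nat.cast_sub, e, e]
  · push_cast; ring
  · apply Finset.card_le_card
    intro v; simp; exact fun hv => h hv
  · intro v; simp; exact fun hv => h hv

theorem card_up_mul {A W : Submodule F V} {r : ℕ} (h : A ≤ W) (hr : rk W = rk A + r) :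
    ((up A W).card : ℤ) * ((Nat.card F : ℤ) - 1) = (Nat.card F : ℤ) ^ r - 1 := by
  have hmap : ∀ v ∈ vecs W A, A ⊔ Submodule.span F {v} ∈ up A W := by
    intro v hv
    rw [mem_vecs] at hv
    have hv0 : v ≠ 0 := by rintro rfl; exact hv.2 (zero_mem _)
    apply sup_mem_up (rk_span hv0) h
    · simpa using hv.1
    · simpa using hv.2
  have h1 := Finset.card_eq_sum_card_fiberwise hmap
  have h2 : ∀ L ∈ up A W, ((vecs W A).filter (fun v => A ⊔ Submodule.span F {v} = L)) = vecs L A := by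
    intro L hL
    rw [mem_up] at hL
    ext v
    simp only [Finset.mem_filter, mem_vecs]
    constructor
    · rintro ⟨⟨hW, hA⟩, rfl⟩
      refine ⟨?_, hA⟩
      have : Submodule.span F {v} ≤ A ⊔ Submodule.span F {v} := le_sup_right
      exact this (Submodule.mem_span_singleton_self v)
    · rintro ⟨hvL, hA⟩
      refine ⟨⟨hL.2.1 hvL, hA⟩, ?_⟩
      have hv0 : v ≠ 0 := by rintro rfl; exact hA (zero_mem _)
      symm
      apply eq_sup_pt (rk_span hv0) hL.1 (by simpa using hvL) (by simpa using hA) hL.2.2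
  rw [Finset.sum_congr rfl (fun L hL => by rw [h2 L hL])] at h1
  have h3 := card_vecs h
  rw [h1] at h3
  push_cast at h3
  rw [Finset.sum_congr rfl (fun L hL => by
    rw [card_vecs (mem_up.1 hL).1, (mem_up.1 hL).2.2])] at h3
  simp only [Finset.sum_const, nsmul_eq_mul] at h3
  have hq : (0 : ℤ) < Nat.card F := by
    have : 0 < Nat.card F := Nat.card_pos
    exact_mod_cast this
  have hqa : (0 : ℤ) < (Nat.card F : ℤ) ^ rk A := by positivity
  rw [hr] at h3
  have : (Nat.card F : ℤ) ^ rk A * (((up A W).card : ℤ) * ((Nat.card F : ℤ) - 1)) = (Nat.card F : ℤ) ^ rk A * ((Nat.card F : ℤ) ^ r - 1) := by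
    ring_nf at h3 ⊢
    linarith
  exact mul_left_cancel₀ hqa.ne' this

theorem one_lt_q : (1 : ℤ) < Nat.card F := by
  have : 1 < Nat.card F := Finite.one_lt_card
  exact_mod_cast this

theorem card_up2 {A W : Submodule F V} (h : A ≤ W) (hr : rk W = rk A + 2) :
    ((up A W).card : ℤ) = Nat.card F + 1 := by
  have h1 := card_up_mul h hr
  have h2 := one_lt_q (F := F)
  have h3 : (Nat.card F : ℤ) - 1 ≠ 0 := by linarith
  apply mul_right_cancel₀ h3
  rw [h1]; ring

theorem card_up3 {A W : Submodule F V} (h : A ≤ W) (hr : rk W = rk A + 3) :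
    ((up A W).card : ℤ) = (Nat.card F : ℤ)^2 + Nat.card F + 1 := by
  have h1 := card_up_mul h hr
  have h2 := one_lt_q (F := F)
  have h3 : (Nat.card F : ℤ) - 1 ≠ 0 := by linarith
  apply mul_right_cancel₀ h3
  rw [h1]; ring

theorem card_up4 {A W : Submodule F V} (h : A ≤ W) (hr : rk W = rk A + 4) :
    ((up A W).card : ℤ) = (Nat.card F : ℤ)^3 + (Nat.card F : ℤ)^2 + Nat.card F + 1 := by
  have h1 := card_up_mul h hr
  have h2 := one_lt_q (F := F)
  have h3 : (Nat.card F : ℤ) - 1 ≠ 0 := by linarith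
  apply mul_right_cancel₀ h3
  rw [h1]; ring

noncomputable def nn (D : Finset (Submodule F V)) (W : Submodule F V) : ℕ := (D.filter (· ≤ W)).card

theorem sum_off {A W : Submodule F V} (D : Finset (Submodule F V)) (hD : ∀ P ∈ D, rk P = 1) (h : A ≤ W) :
    ∑ L ∈ up A W, (D.filter (fun P => P ≤ L ∧ ¬ P ≤ A)).card = (D.filter (fun P => P ≤ W ∧ ¬ P ≤ A)).card := by
  have hmap : ∀ P ∈ D.filter (fun P => P ≤ W ∧ ¬ P ≤ A), A ⊔ P ∈ up A W := by
    intro P hP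
    rw [Finset.mem_filter] at hP
    exact sup_mem_up (hD P hP.1) h hP.2.1 hP.2.2
  rw [Finset.card_eq_sum_card_fiberwise hmap]
  apply Finset.sum_congr rfl
  intro L hL
  rw [mem_up] at hL
  congr 1
  ext P
  simp only [Finset.mem_filter]
  constructor
  · rintro ⟨hPD, hPL, hPA⟩
    exact ⟨⟨hPD, hPL.trans hL.2.1, hPA⟩, (eq_sup_pt (hD P hPD) hL.1 hPL hPA hL.2.2).symm⟩
  · rintro ⟨⟨hPD, hPW, hPA⟩, rfl⟩
    exact ⟨hPD, le_sup_right, hPA⟩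

theorem card_off {A L : Submodule F V} (D : Finset (Submodule F V)) (h : A ≤ L) :
    ((D.filter (fun P => P ≤ L ∧ ¬ P ≤ A)).card : ℤ) = nn D L - nn D A := by
  have : nn D L = (D.filter (fun P => P ≤ L ∧ ¬ P ≤ A)).card + nn D A := by
    unfold nn
    rw [← Finset.card_filter_add_card_filter_not (s := D.filter (· ≤ L)) (fun P => ¬ P ≤ A), Finset.filter_filter,
      Finset.filter_filter]
    congr 2
    ext P
    simp only [Finset.mem_filter, not_not]
    exact ⟨fun x => ⟨x.1, x.2.2⟩, fun x => ⟨x.1, x.2.trans h, x.2⟩⟩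
  rw [this]; push_cast; ring

theorem sum_up {A W : Submodule F V} (D : Finset (Submodule F V)) (hD : ∀ P ∈ D, rk P = 1) (h : A ≤ W) :
    ∑ L ∈ up A W, ((nn D L : ℤ) - nn D A) = nn D W - nn D A := by
  rw [← card_off D h, ← sum_off D hD h]
  push_cast
  apply Finset.sum_congr rfl
  intro L hL
  rw [card_off D (mem_up.1 hL).1]

theorem nn_mono {D : Finset (Submodule F V)} {A B : Submodule F V} (h : A ≤ B) : nn D A ≤ nn D B := by
  apply Finset.card_le_card
  intro P; simp only [Finset.mem_filter]; exact fun x => ⟨x.1, x.2.trans h⟩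

theorem nn_sub {D E : Finset (Submodule F V)} {A : Submodule F V} (h : D ⊆ E) : nn D A ≤ nn E A := 
  Finset.card_le_card (Finset.filter_subset_filter _ h)

structure Cap (K : Finset (Submodule F V)) : Prop where
  pt : ∀ P ∈ K, rk P = 1
  cap : ∀ P ∈ K, ∀ Q ∈ K, ∀ R ∈ K, P ≠ Q → P ≠ R → Q ≠ R → ¬ R ≤ P ⊔ Q

theorem Cap.mono {K D : Finset (Submodule F V)} (hK : Cap K) (h : D ⊆ K) : Cap D :=
  ⟨fun P hP => hK.pt P (h hP), fun P hP Q hQ R hR => hK.cap P (h hP) Q (h hQ) R (h hR)⟩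

theorem Cap.filter {K : Finset (Submodule F V)} (hK : Cap K) (p : Submodule F V → Prop) : Cap (K.filter p) :=
  hK.mono (Finset.filter_subset _ _)

theorem Cap.nn_line {K : Finset (Submodule F V)} (hK : Cap K) {P Q : Submodule F V} (hP : P ∈ K) (hQ : Q ∈ K)
    (h : P ≠ Q) : K.filter (· ≤ P ⊔ Q) = {P, Q} := by
  ext R
  simp only [Finset.mem_filter, Finset.mem_insert, Finset.mem_singleton]
  constructor
  · rintro ⟨hR, hle⟩
    by_contra! hne
    exact hK.cap P hP Q hQ R hR h hne.1.symm hne.2.symm hle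
  · rintro (rfl | rfl)
    · exact ⟨hP, le_sup_left⟩
    · exact ⟨hQ, le_sup_right⟩

theorem Cap.nn_bis {K : Finset (Submodule F V)} (hK : Cap K) {P Q : Submodule F V} (hP : P ∈ K) (hQ : Q ∈ K)
    (h : P ≠ Q) : nn K (P ⊔ Q) = 2 := by
  unfold nn
  rw [hK.nn_line hP hQ h, Finset.card_pair h]

theorem Cap.nn_le {K : Finset (Submodule F V)} (hK : Cap K) {L : Submodule F V} (hL : rk L = 2) : nn K L ≤ 2 := by
  by_contra! h
  obtain ⟨P, hP, Q, hQ, hPQ⟩ := Finset.one_lt_card.1 (show 1 < nn K L by omega)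
  rw [Finset.mem_filter] at hP hQ
  have := eq_line (hK.pt P hP.1) (hK.pt Q hQ.1) hPQ hP.2 hQ.2 hL
  rw [this, hK.nn_bis hP.1 hQ.1 hPQ] at h
  omega

theorem nn_pt {K : Finset (Submodule F V)} (hK : ∀ P ∈ K, rk P = 1) {P : Submodule F V} (hP : P ∈ K) : nn K P = 1 := by
  unfold nn
  rw [Finset.card_eq_one]
  refine ⟨P, ?_⟩
  ext Q
  simp only [Finset.mem_filter, Finset.mem_singleton]
  constructor
  · rintro ⟨h1, h2⟩; exact pt_le_pt (hK Q h1) (hK P hP) h2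
  · rintro rfl; exact ⟨hP, le_rfl⟩

theorem nn_pt0 {K : Finset (Submodule F V)} (hK : ∀ P ∈ K, rk P = 1) {P : Submodule F V} (h1 : rk P = 1) (hP : P ∉ K) : nn K P = 0 := by
  unfold nn
  rw [Finset.card_eq_zero]
  ext Q
  simp only [Finset.mem_filter, Finset.notMem_empty, iff_false]
  rintro ⟨h2, h3⟩
  have := pt_le_pt (hK Q h2) h1 h3
  subst this
  exact hP h2

/-- tangency points from `X` -/
noncomputable def tau (D : Finset (Submodule F V)) (X : Submodule F V) : Finset (Submodule F V) :=
  D.filter (fun P => ∀ Q ∈ D, Q ≠ P → ¬ X ≤ P ⊔ Q)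

theorem mem_tau {D : Finset (Submodule F V)} {X P : Submodule F V} :
    P ∈ tau D X ↔ P ∈ D ∧ ∀ Q ∈ D, Q ≠ P → ¬ X ≤ P ⊔ Q := by simp [tau]

end Helpers

section Helpers
set_option linter.all false
set_option linter.unusedSectionVars false
set_option linter.style.haveILetI false
open scoped Classical

def dd {F : Type*} [Field F] (x y z : Fin 3 → F) : F :=
  x 0 * y 1 * z 2 + x 0 * y 2 * z 1 + x 1 * y 0 * z 2 + x 1 * y 2 * z 0 + x 2 * y 0 * z 1 + x 2 * y 1 * z 0

theorem dd_12 {F : Type*} [Field F] (x y z : Fin 3 → F) : dd x y z = dd y x z := by simp only [dd]; ring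
theorem dd_23 {F : Type*} [Field F] (x y z : Fin 3 → F) : dd x y z = dd x z y := by simp only [dd]; ring
theorem dd_self {F : Type*} [Field F] [CharP F 2] (x y : Fin 3 → F) : dd x y y = 0 := by
  have h2 : (2 : F) = 0 := CharTwo.two_eq_zero
  simp only [dd]; grind
theorem dd_self1 {F : Type*} [Field F] [CharP F 2] (x y : Fin 3 → F) : dd y x y = 0 := by
  rw [dd_12, dd_self]
theorem dd_self2 {F : Type*} [Field F] [CharP F 2] (x y : Fin 3 → F) : dd y y x = 0 := by
  rw [dd_23, dd_self1]

theorem dd_plu {F : Type*} [Field F] [CharP F 2] (v a b c e : Fin 3 → F) :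
    dd v a b * dd v c e = dd v a c * dd v b e + dd v a e * dd v b c := by
  have h2 : (2 : F) = 0 := CharTwo.two_eq_zero
  simp only [dd]
  grind

open Polynomial in
theorem interp {F : Type*} [Field F] [CharP F 2] {ι : Type*} (S : Finset ι) (w : ι → Fin 3 → F)
    (v y : Fin 3 → F) (Z : Finset (Fin 3 → F)) (hZ : Z.card = S.card + 1)
    (h1 : ∀ z ∈ Z, dd v y z ≠ 0) (h2 : ∀ z ∈ Z, ∀ z' ∈ Z, z ≠ z' → dd v z z' ≠ 0) :
    ∏ i ∈ S, dd v (w i) y = ∑ z ∈ Z, (∏ i ∈ S, dd v (w i) z) * ∏ z' ∈ Z.erase z, (dd v y z' / dd v z z') := by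
  obtain ⟨z0, hz0⟩ : Z.Nonempty := by rw [← Finset.card_pos]; omega
  set x : (Fin 3 → F) → F := fun z => dd v z z0 / (dd v y z * dd v y z0) with hx
  have hc0 := h1 z0 hz0
  have hsub : ∀ a b : F, a - b = a + b := fun a b => CharTwo.sub_eq_add a b
  have hd : ∀ z ∈ Z, ∀ z' ∈ Z, x z - x z' = dd v z z' / (dd v y z * dd v y z') := by
    intro z hz z' hz'
    have e1 := h1 z hz
    have e2 := h1 z' hz'
    simp only [hx]
    rw [hsub]
    field_simp
    have := dd_plu v y z0 z z'
    rw [dd_23 v z z0, dd_23 v z' z0]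
    linear_combination -this
  have hinj : Set.InjOn x Z := by
    intro z hz z' hz' e
    by_contra hne
    have := hd z hz z' hz'
    rw [e, sub_self] at this
    have e3 := h2 z hz z' hz' hne
    have e1 := h1 z hz
    have e2 := h1 z' hz'
    field_simp at this
    exact e3 (by simpa using this.symm)
  set P : F[X] := ∏ i ∈ S, (C (dd v (w i) y) * X + C (dd v (w i) z0 / dd v y z0)) with hP
  have hdeg : P.natDegree ≤ S.card := by
    refine (natDegree_prod_le _ _).trans ?_
    refine (Finset.sum_le_card_nsmul _ _ 1 ?_).trans (by simp)
    intro i _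
    exact natDegree_linear_le
  have hdeg' : P.degree < Z.card := by
    rw [hZ]
    refine (degree_le_natDegree).trans_lt ?_
    exact_mod_cast Nat.lt_succ_of_le hdeg
  have hco := Lagrange.coeff_eq_sum hinj hdeg'
  have hl : P.coeff (Z.card - 1) = ∏ i ∈ S, dd v (w i) y := by
    have : Z.card - 1 = S.card * 1 := by omega
    rw [this, hP, coeff_prod_of_natDegree_le]
    · apply Finset.prod_congr rfl
      intro i _
      simp
    · intro i _; exact natDegree_linear_le
  rw [hl] at hco
  rw [hco]
  apply Finset.sum_congr rfl
  intro z hz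
  have hcz := h1 z hz
  have e1 : P.eval (x z) = (∏ i ∈ S, dd v (w i) z) / (dd v y z) ^ S.card := by
    rw [hP, eval_prod, ← Finset.prod_const, ← Finset.prod_div_distrib]
    apply Finset.prod_congr rfl
    intro i _
    simp only [eval_add, eval_mul, eval_C, eval_X, hx]
    field_simp
    have := dd_plu v (w i) y z z0
    linear_combination this + dd v (w i) z0 * dd v y z * (CharTwo.two_eq_zero : (2 : F) = 0)
  have e2 : ∏ j ∈ Z.erase z, (x z - x j) = ∏ j ∈ Z.erase z, (dd v z j / (dd v y z * dd v y j)) := by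
    apply Finset.prod_congr rfl
    intro j hj
    exact hd z hz j (Finset.mem_of_mem_erase hj)
  rw [e1, e2, div_div, div_eq_mul_inv]
  congr 1
  have e3 : (dd v y z) ^ S.card = ∏ j ∈ Z.erase z, dd v y z := by
    rw [Finset.prod_const, Finset.card_erase_of_mem hz, hZ]; simp
  rw [e3, ← Finset.prod_mul_distrib, ← Finset.prod_inv_distrib]
  apply Finset.prod_congr rfl
  intro j hj
  have e4 := h1 j (Finset.mem_of_mem_erase hj)
  have e5 := h2 z hz j (Finset.mem_of_mem_erase hj) (Finset.ne_of_mem_erase hj).symm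
  field_simp

theorem prod_nonzero {F : Type*} [Field F] [Fintype F] [CharP F 2] :
    ∏ x ∈ (Finset.univ : Finset F).erase 0, x = 1 := by
  have h := FiniteField.prod_univ_units_id_eq_neg_one (K := F)
  have h1 : ((∏ x : Fˣ, x : Fˣ) : F) = 1 := by rw [h]; simp [CharTwo.neg_eq]
  rw [← h1, Units.coe_prod]
  symm
  refine Finset.prod_bij (fun u _ => (u : F)) ?_ ?_ ?_ ?_
  · intro u _; simp
  · intro u _ u' _ e; exact Units.ext e
  · intro x hx
    simp at hx
    exact ⟨Units.mk0 x hx, by simp, by simp⟩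
  · intro u _; rfl

theorem prod_shift {F : Type*} [Field F] [Fintype F] [CharP F 2] (c : F) :
    ∏ x ∈ (Finset.univ : Finset F).erase c, (c + x) = 1 := by
  rw [← prod_nonzero (F := F)]
  refine Finset.prod_bij (fun x _ => c + x) ?_ ?_ ?_ ?_
  · intro x hx
    simp only [Finset.mem_erase, Finset.mem_univ, and_true] at hx ⊢
    intro h
    rw [← CharTwo.sub_eq_add] at h
    exact hx (sub_eq_zero.1 h).symm
  · intro x _ y _ e; exact add_left_cancel e
  · intro y hy
    simp only [Finset.mem_erase, Finset.mem_univ, and_true] at hy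
    refine ⟨c + y, by simpa using hy, ?_⟩
    rw [← add_assoc, CharTwo.add_self_eq_zero, zero_add]
  · intro x _; rfl

/-- tangent function at a point -/
theorem exists_tan {F : Type*} [Field F] [Fintype F] [CharP F 2] (D : Finset (Fin 3 → F))
    (i e1 e2 : Fin 3 → F) (hi : i ∈ D) (he : dd i e1 e2 ≠ 0)
    (hD : ∀ j ∈ D, ∀ k ∈ D, j ≠ i → k ≠ i → j ≠ k → dd i j k ≠ 0)
    (hD0 : ∀ j ∈ D, j ≠ i → ∃ u, dd i u j ≠ 0) :
    ∃ (S : Finset (Option F)) (w : Option F → Fin 3 → F) (c : F),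
      S.card + D.card = Fintype.card F + 2 ∧ c ≠ 0 ∧
      (∀ j ∈ D, j ≠ i → (∏ s ∈ S, dd i (w s) j) * (∏ r ∈ (D.erase i).erase j, dd i r j) = c) ∧
      (∀ y, (∃ u, dd i u y ≠ 0) → (∀ j ∈ D, j ≠ i → dd i j y ≠ 0) → ∏ s ∈ S, dd i (w s) y = 0) ∧
      (∀ y, (∃ u, dd i u y ≠ 0) → (∃ j ∈ D, j ≠ i ∧ dd i j y = 0) → ∏ s ∈ S, dd i (w s) y ≠ 0) := by
  have two : (2 : F) = 0 := CharTwo.two_eq_zero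
  set δ := dd i e1 e2 with hδ
  set a : (Fin 3 → F) → F := fun y => dd i e2 y with ha
  set b : (Fin 3 → F) → F := fun y => dd i e1 y with hb
  have plu : ∀ r y, δ * dd i r y = a r * b y + b r * a y := by
    intro r y
    have := dd_plu i e1 e2 r y
    simp only [ha, hb]
    linear_combination this
  set w : Option F → Fin 3 → F := fun s => s.elim e2 (fun l => e1 + l • e2) with hw
  have wn : ∀ y, dd i (w none) y = a y := fun y => rfl
  have ws : ∀ l y, dd i (w (some l)) y = b y + l * a y := by
    intro l y
    simp only [hw, ha, hb, dd, Option.elim, Pi.add_apply, Pi.smul_apply, smul_eq_mul]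
    ring
  set dir : (Fin 3 → F) → Option F := fun y => if a y = 0 then none else some (b y / a y) with hdir
  set mu : (Fin 3 → F) → F := fun y => if a y = 0 then b y else a y with hmu
  have np : ∀ y, (∃ u, dd i u y ≠ 0) → a y = 0 → b y ≠ 0 := by
    rintro y ⟨u, hu⟩ h1 h2
    have := plu u y
    rw [h1, h2] at this
    simp only [mul_zero, add_zero, mul_eq_zero] at this
    exact this.elim he hu
  have mune : ∀ y, (∃ u, dd i u y ≠ 0) → mu y ≠ 0 := by
    intro y hy
    simp only [hmu]
    split_ifs with h
    · exact np y hy h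
    · exact h
  have fac : ∀ r y, δ * dd i r y = mu r * dd i (w (dir r)) y := by
    intro r y
    rw [plu]
    simp only [hmu, hdir]
    split_ifs with h
    · rw [wn, h]; ring
    · rw [ws]; field_simp
  have dir0 : ∀ y, dd i (w (dir y)) y = 0 := by
    intro y
    simp only [hdir]
    split_ifs with h
    · rw [wn, h]
    · rw [ws]; field_simp; linear_combination b y * two
  have dir1 : ∀ s y, (∃ u, dd i u y ≠ 0) → dd i (w s) y = 0 → s = dir y := by
    intro s y hy hs
    simp only [hdir]
    cases s with
    | none => rw [wn] at hs; rw [if_pos hs]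
    | some l =>
      rw [ws] at hs
      have : a y ≠ 0 := by
        intro h
        rw [h] at hs
        exact np y hy h (by simpa using hs)
      rw [if_neg this]
      congr 1
      field_simp
      linear_combination hs - b y * two
  have prodall : ∀ y, (∃ u, dd i u y ≠ 0) → ∏ s ∈ Finset.univ.erase (dir y), dd i (w s) y = mu y := by
    intro y hy
    simp only [hdir, hmu]
    split_ifs with h
    · have : (Finset.univ : Finset (Option F)).erase none = Finset.univ.map Function.Embedding.some := by
        ext s; cases s <;> simp
      rw [this, Finset.prod_map]
      simp only [Function.Embedding.some_apply, ws, h, mul_zero, add_zero]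
      rw [Finset.prod_const, Finset.card_univ, FiniteField.pow_card]
    · have : (Finset.univ : Finset (Option F)).erase (some (b y / a y)) =
          insert none (((Finset.univ : Finset F).erase (b y / a y)).map Function.Embedding.some) := by
        ext s; cases s <;> simp
      rw [this, Finset.prod_insert (by simp), Finset.prod_map, wn]
      have e : ∀ x ∈ (Finset.univ : Finset F).erase (b y / a y), dd i (w (Function.Embedding.some x)) y
          = a y * (b y / a y + x) := by
        intro x _
        simp only [Function.Embedding.some_apply, ws]
        field_simp
      rw [Finset.prod_congr rfl e, Finset.prod_mul_distrib, prod_shift, Finset.prod_const,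
        Finset.card_erase_of_mem (Finset.mem_univ _), Finset.card_univ, FiniteField.pow_card_sub_one_eq_one _ h]
      ring
  have inj : Set.InjOn dir (D.erase i) := by
    intro j hj k hk e
    simp only [Finset.coe_erase, Set.mem_diff, Finset.mem_coe, Set.mem_singleton_iff] at hj hk
    by_contra hne
    have h1 := hD j hj.1 k hk.1 hj.2 hk.2 hne
    have h2 := fac j k
    rw [e, dir0, mul_zero] at h2
    exact h1 ((mul_eq_zero.1 h2).resolve_left he)
  set S : Finset (Option F) := Finset.univ \ (D.erase i).image dir with hS
  refine ⟨S, w, δ * ∏ r ∈ D.erase i, (mu r / δ), ?_, ?_, ?_, ?_, ?_⟩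
  · have h1 : S.card = Fintype.card F + 1 - (D.card - 1) := by
      rw [hS, Finset.card_sdiff_of_subset (Finset.subset_univ _), Finset.card_univ, Fintype.card_option,
        Finset.card_image_of_injOn inj, Finset.card_erase_of_mem hi]
    have h2 : D.card - 1 ≤ Fintype.card F + 1 := by
      have := Finset.card_le_univ ((D.erase i).image dir)
      rw [Fintype.card_option, Finset.card_image_of_injOn inj, Finset.card_erase_of_mem hi] at this
      exact this
    have h3 : 0 < D.card := Finset.card_pos.2 ⟨i, hi⟩
    omega
  · refine mul_ne_zero he (Finset.prod_ne_zero_iff.2 ?_)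
    intro r hr
    rw [Finset.mem_erase] at hr
    exact div_ne_zero (mune r (hD0 r hr.2 hr.1)) he
  · intro j hj hji
    have h1 : ∏ r ∈ (D.erase i).erase j, dd i r j = (∏ r ∈ (D.erase i).erase j, (mu r / δ)) *
        ∏ r ∈ (D.erase i).erase j, dd i (w (dir r)) j := by
      rw [← Finset.prod_mul_distrib]
      apply Finset.prod_congr rfl
      intro r _
      have := fac r j
      field_simp
      linear_combination this
    have h2 : ∏ r ∈ (D.erase i).erase j, dd i (w (dir r)) j = ∏ s ∈ ((D.erase i).erase j).image dir, dd i (w s) j := by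
      rw [Finset.prod_image]
      intro x hx y hy e
      exact inj (Finset.mem_of_mem_erase hx) (Finset.mem_of_mem_erase hy) e
    have hjm : j ∈ D.erase i := Finset.mem_erase.2 ⟨hji, hj⟩
    have h3 : (∏ s ∈ S, dd i (w s) j) * ∏ s ∈ ((D.erase i).erase j).image dir, dd i (w s) j = mu j := by
      rw [← prodall j (hD0 j hj hji), ← Finset.prod_union]
      · congr 1
        ext s
        simp only [hS, Finset.mem_union, Finset.mem_sdiff, Finset.mem_univ, true_and, Finset.mem_image, 
          Finset.mem_erase, and_true]
        constructor
        · rintro (h | ⟨r, hr, rfl⟩)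
          · rintro rfl; exact h ⟨j, ⟨hji, hj⟩, rfl⟩
          · intro e
            exact hr.1 (inj (by simpa using ⟨hr.2.2, hr.2.1⟩) (by simpa using ⟨hj, hji⟩) e)
        · intro h
          by_cases h' : ∃ r, (r ≠ i ∧ r ∈ D) ∧ dir r = s
          · right
            obtain ⟨r, hr, rfl⟩ := h'
            exact ⟨r, ⟨by rintro rfl; exact h rfl, hr⟩, rfl⟩
          · left; exact h'
      · rw [Finset.disjoint_left]
        intro s hs hs'
        simp only [hS, Finset.mem_sdiff] at hs
        exact hs.2 (Finset.image_subset_image (Finset.erase_subset _ _) hs')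
    rw [h1, h2, ← Finset.mul_prod_erase _ _ hjm]
    field_simp
    linear_combination (∏ r ∈ (D.erase i).erase j, (mu r / δ)) * h3
  · intro y hy h
    apply Finset.prod_eq_zero (i := dir y) _ (dir0 y)
    simp only [hS, Finset.mem_sdiff, Finset.mem_univ, true_and, Finset.mem_image, not_exists, not_and]
    intro j hj e
    rw [Finset.mem_erase] at hj
    have := fac j y
    rw [e, dir0, mul_zero] at this
    exact h j hj.2 hj.1 ((mul_eq_zero.1 this).resolve_left he)
  · rintro y hy ⟨j, hj, hji, h⟩
    rw [Finset.prod_ne_zero_iff]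
    intro s hs h0
    have e := dir1 s y hy h0
    have h1 := fac j y
    rw [h, mul_zero] at h1
    have e2 := dir1 (dir j) y hy ((mul_eq_zero.1 h1.symm).resolve_left (mune j (hD0 j hj hji)))
    simp only [hS, Finset.mem_sdiff, Finset.mem_univ, true_and, Finset.mem_image, not_exists, not_and] at hs
    exact hs j (Finset.mem_erase.2 ⟨hji, hj⟩) (e2.trans e.symm)

theorem TLvec {F : Type*} [Field F] [Fintype F] [CharP F 2] (D : Finset (Fin 3 → F))
    (hD : ∀ i ∈ D, ∀ j ∈ D, ∀ k ∈ D, i ≠ j → i ≠ k → j ≠ k → dd i j k ≠ 0)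
    (X B B' : Fin 3 → F) (hB : B ∈ D) (hB' : B' ∈ D) (hBB : B ≠ B') (hX : dd B B' X = 0)
    (J : Finset (Fin 3 → F)) (hJ : ∀ i ∈ J, i ∈ D ∧ ∀ r ∈ D, r ≠ i → dd i r X ≠ 0) :
    J.card + D.card ≤ Fintype.card F + 2 := by
  by_contra! hlt
  have two : (2 : F) = 0 := CharTwo.two_eq_zero
  have hBJ : B ∉ J := fun h => (hJ B h).2 B' hB' hBB.symm hX
  have hB'J : B' ∉ J := fun h => (hJ B' h).2 B hB hBB (by rw [dd_12]; exact hX)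
  have hXJ : X ∉ J := by
    intro h
    have := (hJ X h).2 B hB (by rintro rfl; exact hBJ h)
    exact this (dd_self1 _ _)
  have hJn : J.Nonempty := by
    rw [Finset.nonempty_iff_ne_empty]
    rintro rfl
    simp only [Finset.card_empty, zero_add] at hlt
    obtain ⟨C, hC, hCB⟩ : ∃ C ∈ D, C ≠ B ∧ C ≠ B' := by
      by_contra! hno
      have : D ⊆ {B, B'} := by
        intro C hC
        simp only [Finset.mem_insert, Finset.mem_singleton]
        by_contra! h
        exact h.2 (hno C hC h.1)
      have h2 := Finset.card_le_card this
      have h3 := Finset.card_le_two (a := B) (b := B')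
      omega
    obtain ⟨S, w, c, h1, -⟩ := exists_tan D B B' C hB (hD B hB B' hB' C hC hBB hCB.1.symm hCB.2.symm)
      (fun j hj k hk h1 h2 h3 => hD B hB j hj k hk h1.symm h2.symm h3)
      (fun j hj hjB => by
        by_cases h : j = B'
        · subst h; exact ⟨C, by rw [dd_23]; exact hD B hB j hj C hC hBB hCB.1.symm hCB.2.symm⟩
        · exact ⟨B', hD B hB B' hB' j hj hBB hjB.symm (Ne.symm h)⟩)
    omega
  obtain ⟨Q0, hQ0⟩ := hJn
  have hQ0D := (hJ Q0 hQ0).1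
  have hQ0B : Q0 ≠ B := by rintro rfl; exact hBJ hQ0
  have hQ0B' : Q0 ≠ B' := by rintro rfl; exact hB'J hQ0
  have third : ∀ i j, i ∈ D → j ∈ D → i ≠ j → ∃ u, u ∈ D ∧ dd i u j ≠ 0 := by
    intro i j hi hj hij
    obtain ⟨u, hu, h1, h2⟩ : ∃ u ∈ D, u ≠ i ∧ u ≠ j := by
      by_contra! hno
      have a1 := hno B hB
      have a2 := hno B' hB'
      have a3 := hno Q0 hQ0D
      by_cases b1 : B = i
      · have b2 : B' = j := a2 (fun e => hBB (b1.trans e.symm))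
        have b3 : Q0 = j := a3 (fun e => hQ0B (e.trans b1.symm))
        exact hQ0B' (b3.trans b2.symm)
      · have b1' := a1 b1
        by_cases b2 : B' = i
        · have b3 : Q0 = j := a3 (fun e => hQ0B' (e.trans b2.symm))
          exact hQ0B (b3.trans b1'.symm)
        · exact hBB (b1'.trans (a2 b2).symm)
    exact ⟨u, hu, hD i hi u hu j hj h1.symm hij h2⟩
  have tanEx : ∀ i ∈ D, ∃ (S : Finset (Option F)) (w : Option F → Fin 3 → F) (c : F),
      S.card + D.card = Fintype.card F + 2 ∧ c ≠ 0 ∧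
      (∀ j ∈ D, j ≠ i → (∏ s ∈ S, dd i (w s) j) * (∏ r ∈ (D.erase i).erase j, dd i r j) = c) ∧
      (∀ y, (∃ u, dd i u y ≠ 0) → (∀ j ∈ D, j ≠ i → dd i j y ≠ 0) → ∏ s ∈ S, dd i (w s) y = 0) ∧
      (∀ y, (∃ u, dd i u y ≠ 0) → (∃ j ∈ D, j ≠ i ∧ dd i j y = 0) → ∏ s ∈ S, dd i (w s) y ≠ 0) := by
    intro i hi
    obtain ⟨j, hj, hij⟩ : ∃ j ∈ D, i ≠ j := by
      by_cases h : i = B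
      · exact ⟨B', hB', h ▸ hBB⟩
      · exact ⟨B, hB, h⟩
    obtain ⟨u, hu, h⟩ := third i j hi hj hij
    exact exists_tan D i u j hi h
      (fun j hj k hk h1 h2 h3 => hD i hi j hj k hk h1.symm h2.symm h3)
      (fun j hj hji => let ⟨u, _, h⟩ := third i j hi hj hji.symm; ⟨u, h⟩)
  choose! S w c hS hc hcc htan hbis using tanEx
  set f : (Fin 3 → F) → (Fin 3 → F) → F := fun i y => (∏ s ∈ S i, dd i (w i s) y) / c i with hf
  have hfsymm : ∀ i ∈ D, ∀ j ∈ D, i ≠ j → f i j = f j i := by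
    intro i hi j hj hij
    have h1 := hcc i hi j hj hij.symm
    have h2 := hcc j hj i hi hij
    have e : ∏ r ∈ (D.erase j).erase i, dd j r i = ∏ r ∈ (D.erase i).erase j, dd i r j := by
      rw [Finset.erase_right_comm]
      apply Finset.prod_congr rfl
      intro r _
      rw [dd_23, dd_12, dd_23]
    rw [e] at h2
    have hg : ∏ r ∈ (D.erase i).erase j, dd i r j ≠ 0 := by
      intro h
      rw [h, mul_zero] at h1
      exact hc i hi h1.symm
    simp only [hf]
    rw [div_eq_div_iff (hc i hi) (hc j hj)]
    apply mul_right_cancel₀ hg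
    rw [mul_right_comm, h1, mul_right_comm, h2]; ring
  obtain ⟨J', hJ'J, hJ'c⟩ := Finset.exists_subset_card_eq (show (S B).card + 1 ≤ J.card by
    have := hS B hB; omega)
  have hSc : ∀ i ∈ D, (S i).card = (S B).card := by
    intro i hi
    have := hS B hB
    have := hS i hi
    omega
  have hJD : ∀ i ∈ J', i ∈ D := fun i hi => (hJ i (hJ'J hi)).1
  have hJX : ∀ i ∈ J', ∀ r ∈ D, r ≠ i → dd i r X ≠ 0 := fun i hi => (hJ i (hJ'J hi)).2
  have hBJ' : ∀ i ∈ J', i ≠ B := by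
    rintro i hi rfl
    exact hBJ (hJ'J hi)
  have hXJ' : ∀ i ∈ J', i ≠ X := by
    rintro i hi rfl
    exact hXJ (hJ'J hi)
  have hitp : ∀ i ∈ D, ∀ y, ∀ Z : Finset (Fin 3 → F), Z.card = (S B).card + 1 →
    (∀ z ∈ Z, dd i y z ≠ 0) → (∀ z ∈ Z, ∀ z' ∈ Z, z ≠ z' → dd i z z' ≠ 0) →
      f i y = ∑ z ∈ Z, f i z * ∏ z' ∈ Z.erase z, (dd i y z' / dd i z z') := by
    intro i hi y Z hZ h1 h2
    have := interp (S i) (w i) i y Z (by rw [hZ, hSc i hi]) h1 h2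
    simp only [hf]
    rw [this, Finset.sum_div]
    apply Finset.sum_congr rfl
    intro z _
    ring
  have st1 : f B X = ∑ i ∈ J', f B i * ∏ l ∈ J'.erase i, (dd B X l / dd B i l) := by
    apply hitp B hB X J' hJ'c
    · intro z hz
      have := hJX z hz B hB (hBJ' z hz).symm
      rwa [dd_12 z B X, dd_23 B z X] at this
    · intro z hz z' hz' hne
      exact hD B hB z (hJD z hz) z' (hJD z' hz') (hBJ' z hz).symm (hBJ' z' hz').symm hne
  have st2 : ∀ i ∈ J', f B i = ∑ j ∈ J'.erase i, f i j * ((dd i B X / dd i j X) * ∏ l ∈ (J'.erase i).erase j, (dd i B l / dd i j l)) := by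
    intro i hi
    have hiD := hJD i hi
    have hXn : X ∉ J'.erase i := fun h => hXJ' X (Finset.mem_of_mem_erase h) rfl
    rw [hfsymm B hB i hiD (hBJ' i hi).symm]
    rw [hitp i hiD B (insert X (J'.erase i))]
    · rw [Finset.sum_insert hXn]
      have h0 : f i X = 0 := by
        simp only [hf]
        rw [htan i hiD X ⟨B, hJX i hi B hB (hBJ' i hi).symm⟩ (fun j hj hji => hJX i hi j hj hji), zero_div]
      rw [h0, zero_mul, zero_add]
      apply Finset.sum_congr rfl
      intro j hj
      have hjX : X ≠ j := by rintro rfl; exact hXn hj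
      rw [Finset.erase_insert_of_ne hjX, Finset.prod_insert (fun h => hXn (Finset.mem_of_mem_erase h))]
    · rw [Finset.card_insert_of_notMem hXn, Finset.card_erase_of_mem hi, hJ'c]; simp
    · intro z hz
      rw [Finset.mem_insert] at hz
      rcases hz with rfl | hz
      · exact hJX i hi B hB (hBJ' i hi).symm
      · rw [Finset.mem_erase] at hz
        exact hD i hiD B hB z (hJD z hz.2) (hBJ' i hi) hz.1.symm (hBJ' z hz.2).symm
    · intro z hz z' hz' hne
      rw [Finset.mem_insert, Finset.mem_erase] at hz hz'
      rcases hz with rfl | hz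
      · rcases hz' with rfl | hz'
        · exact absurd rfl hne
        · rw [dd_23]; exact hJX i hi z' (hJD z' hz'.2) hz'.1
      · rcases hz' with rfl | hz'
        · exact hJX i hi z (hJD z hz.2) hz.1
        · exact hD i hiD z (hJD z hz.2) z' (hJD z' hz'.2) hz.1.symm hz'.1.symm hne
  have key : f B X = ∑ p ∈ J'.offDiag, f p.1 p.2 * (dd p.1 B X * dd p.2 B X / (dd p.1 p.2 X * dd B p.1 p.2) *
      ∏ l ∈ (J'.erase p.1).erase p.2, (dd B X l / dd p.1 p.2 l)) := by
    rw [st1]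
    have : ∑ p ∈ J'.offDiag, f p.1 p.2 * (dd p.1 B X * dd p.2 B X / (dd p.1 p.2 X * dd B p.1 p.2) *
      ∏ l ∈ (J'.erase p.1).erase p.2, (dd B X l / dd p.1 p.2 l)) = ∑ i ∈ J', ∑ j ∈ J'.erase i, f i j * (dd i B X * dd j B X / (dd i j X * dd B i j) *
      ∏ l ∈ (J'.erase i).erase j, (dd B X l / dd i j l)) := by
      rw [Finset.sum_sigma']
      refine Finset.sum_bij (fun p _ => ⟨p.1, p.2⟩) ?_ ?_ ?_ ?_
      · intro p hp; simp only [Finset.mem_offDiag] at hp; simp only [Finset.mem_sigma, Finset.mem_erase]; exact ⟨hp.1, hp.2.2.symm, hp.2.1⟩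
      · rintro ⟨a, b⟩ _ ⟨a', b'⟩ _ h; simpa using h
      · rintro ⟨a, b⟩ h
        simp only [Finset.mem_sigma, Finset.mem_erase] at h
        exact ⟨(a, b), by simp only [Finset.mem_offDiag]; exact ⟨h.1, h.2.2, h.2.1.symm⟩, rfl⟩
      · intro p _; rfl
    rw [this]
    apply Finset.sum_congr rfl
    intro i hi
    rw [st2 i hi, Finset.sum_mul]
    apply Finset.sum_congr rfl
    intro j hj
    rw [← Finset.mul_prod_erase _ _ hj, mul_assoc]
    congr 1
    have e1 : (∏ l ∈ (J'.erase i).erase j, (dd i B l / dd i j l)) * (∏ l ∈ (J'.erase i).erase j, (dd B X l / dd B i l)) = ∏ l ∈ (J'.erase i).erase j, (dd B X l / dd i j l) := by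
      rw [← Finset.prod_mul_distrib]
      apply Finset.prod_congr rfl
      intro l hl
      simp only [Finset.mem_erase] at hl
      have : dd B i l ≠ 0 := hD B hB i (hJD i hi) l (hJD l hl.2.2) (hBJ' i hi).symm (hBJ' l hl.2.2).symm hl.2.1.symm
      rw [dd_12 i B l]
      field_simp
    rw [← e1]
    have e2 : dd B X j = dd j B X := by rw [dd_23, dd_12]
    rw [e2]
    ring
  have hz : f B X = 0 := by
    rw [key]
    apply Finset.sum_involution (fun p _ => (p.2, p.1))
    · rintro ⟨i, j⟩ hp
      simp only [Finset.mem_offDiag] at hp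
      have : f j i * (dd j B X * dd i B X / (dd j i X * dd B j i) *
        ∏ l ∈ (J'.erase j).erase i, (dd B X l / dd j i l)) = f i j * (dd i B X * dd j B X / (dd i j X * dd B i j) *
        ∏ l ∈ (J'.erase i).erase j, (dd B X l / dd i j l)) := by
        rw [hfsymm j (hJD j hp.2.1) i (hJD i hp.1) hp.2.2.symm, dd_12 j i X, dd_23 B j i, Finset.erase_right_comm,
          mul_comm (dd j B X)]
        congr 2
        apply Finset.prod_congr rfl
        intro l _
        rw [dd_12 j i l]
      simp only [this]
      exact CharTwo.add_self_eq_zero _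
    · rintro ⟨i, j⟩ hp _ e
      simp only [Finset.mem_offDiag] at hp
      simp only [Prod.mk.injEq] at e
      exact hp.2.2 e.2
    · rintro ⟨i, j⟩ hp
      simp only [Finset.mem_offDiag] at hp ⊢
      exact ⟨hp.2.1, hp.1, hp.2.2.symm⟩
    · rintro ⟨i, j⟩ _; rfl
  have hnz := hbis B hB X ⟨Q0, by rw [dd_12]; exact (hJ Q0 hQ0).2 B hB hQ0B.symm⟩ ⟨B', hB', hBB.symm, hX⟩
  apply hnz
  simp only [hf] at hz
  exact (div_eq_zero_iff.1 hz).resolve_right (hc B hB)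

end Helpers

section Helpers
set_option linter.all false
set_option linter.unusedSectionVars false
set_option linter.style.haveILetI false
open scoped Classical
variable {F : Type*} [Field F] [Finite F] {V : Type*} [AddCommGroup V] [Module F V] [Finite V]

theorem exists_coord [CharP F 2] {p : Submodule F V} (hp : rk p = 3) :
    ∃ φ : Submodule F V → Fin 3 → F,
      (∀ P Q, rk P = 1 → rk Q = 1 → P ≤ p → Q ≤ p → φ P = φ Q → P = Q) ∧
      (∀ P Q R, rk P = 1 → rk Q = 1 → rk R = 1 → P ≤ p → Q ≤ p → R ≤ p → P ≠ Q →
        (dd (φ P) (φ Q) (φ R) = 0 ↔ R ≤ P ⊔ Q)) := by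
  have e : p ≃ₗ[F] (Fin 3 → F) := LinearEquiv.ofFinrankEq _ _ (by
    rw [finrank_fin_fun]; exact hp)
  set g : (Fin 3 → F) →ₗ[F] V := p.subtype ∘ₗ e.symm.toLinearMap with hg
  have hginj : Function.Injective g := by
    intro x y h
    simp only [hg, LinearMap.comp_apply, Submodule.coe_subtype] at h
    exact e.symm.injective (Subtype.ext h)
  have ex : ∀ P : Submodule F V, ∃ x : Fin 3 → F, rk P = 1 → P ≤ p → P = Submodule.span F {g x} := by
    intro P
    by_cases hP : rk P = 1 ∧ P ≤ p
    · obtain ⟨v, hv, h⟩ := pt_eq_span hP.1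
      have hvp : v ∈ p := hP.2 (by rw [h]; exact Submodule.mem_span_singleton_self v)
      refine ⟨e ⟨v, hvp⟩, fun _ _ => ?_⟩
      simp only [hg, LinearMap.comp_apply, LinearEquiv.coe_coe, LinearEquiv.symm_apply_apply,
        Submodule.coe_subtype]
      exact h
    · exact ⟨0, fun h1 h2 => absurd ⟨h1, h2⟩ hP⟩
  choose φ hφ using ex
  have le_iff : ∀ R, rk R = 1 → R ≤ p → ∀ W : Submodule F V, R ≤ W ↔ g (φ R) ∈ W := by
    intro R h1 h2 W
    rw [hφ R h1 h2, Submodule.span_singleton_le_iff_mem, ← hφ R h1 h2]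
  refine ⟨φ, ?_, ?_⟩
  · intro P Q hP hQ hPp hQp h
    rw [hφ P hP hPp, hφ Q hQ hQp, h]
  · intro P Q R hP hQ hR hPp hQp hRp hPQ
    have det : dd (φ P) (φ Q) (φ R) = (Matrix.of ![φ P, φ Q, φ R]).det := by
      rw [Matrix.det_fin_three]
      simp only [dd, CharTwo.sub_eq_add, Matrix.of_apply, Matrix.cons_val_zero, Matrix.cons_val_one, Matrix.cons_val]
    constructor
    · intro h0
      rw [det, ← Matrix.exists_vecMul_eq_zero_iff] at h0
      obtain ⟨c, hc, h⟩ := h0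
      have h' : c 0 • φ P + c 1 • φ Q + c 2 • φ R = 0 := by
        rw [← h]
        ext i
        simp [Matrix.vecMul, dotProduct, Fin.sum_univ_three]
      have h2 : c 0 • g (φ P) + c 1 • g (φ Q) + c 2 • g (φ R) = 0 := by
        rw [← map_smul, ← map_smul, ← map_smul, ← map_add, ← map_add, h', map_zero]
      have mP : g (φ P) ∈ P := (le_iff P hP hPp P).1 le_rfl
      have mQ : g (φ Q) ∈ Q := (le_iff Q hQ hQp Q).1 le_rfl
      have key : ∀ (W : Submodule F V) (a : F) (x : V), a ≠ 0 → a • x ∈ W → x ∈ W := by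
        intro W a x ha hx
        have := W.smul_mem a⁻¹ hx
        rwa [smul_smul, inv_mul_cancel₀ ha, one_smul] at this
      by_cases h3 : c 2 = 0
      · exfalso
        rw [h3, zero_smul, add_zero] at h2
        by_cases h4 : c 1 = 0
        · rw [h4, zero_smul, add_zero] at h2
          by_cases h5 : c 0 = 0
          · apply hc
            ext i
            fin_cases i <;> simp [h3, h4, h5]
          · rcases smul_eq_zero.1 h2 with h6 | h6
            · exact h5 h6
            · have := hφ P hP hPp
              rw [h6] at this
              rw [this] at hP
              simp [rk_bot] at hP
        · have : c 1 • g (φ Q) ∈ P := by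
            rw [eq_neg_of_add_eq_zero_right h2]
            exact P.neg_mem (P.smul_mem _ mP)
          exact hPQ (pt_le_pt hQ hP ((le_iff Q hQ hQp P).2 (key P _ _ h4 this))).symm
      · rw [le_iff R hR hRp]
        apply key _ _ _ h3
        rw [eq_neg_of_add_eq_zero_right h2]
        exact Submodule.neg_mem _ (Submodule.add_mem_sup (P.smul_mem _ mP) (Q.smul_mem _ mQ))
    · intro h
      rw [le_iff R hR hRp, Submodule.mem_sup] at h
      obtain ⟨y, hy, z, hz, hyz⟩ := h
      rw [hφ P hP hPp, Submodule.mem_span_singleton] at hy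
      rw [hφ Q hQ hQp, Submodule.mem_span_singleton] at hz
      obtain ⟨a, rfl⟩ := hy
      obtain ⟨b, rfl⟩ := hz
      rw [← map_smul, ← map_smul, ← map_add] at hyz
      rw [← hginj hyz]
      have h2 : (2 : F) = 0 := CharTwo.two_eq_zero
      simp only [dd, Pi.add_apply, Pi.smul_apply, smul_eq_mul]
      linear_combination (φ P 0 * φ P 1 * φ Q 2 * a + φ P 0 * φ Q 1 * φ P 2 * a + φ Q 0 * φ P 1 * φ P 2 * a +
        φ Q 0 * φ P 1 * φ Q 2 * b + φ P 0 * φ Q 1 * φ Q 2 * b + φ Q 0 * φ Q 1 * φ P 2 * b) * h2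

/-- The tangent lemma. -/
theorem TL [CharP F 2] {p : Submodule F V} (hp : rk p = 3) {D : Finset (Submodule F V)} (hD : Cap D)
    (hDp : ∀ P ∈ D, P ≤ p) {X : Submodule F V} (hX : rk X = 1) (hXp : X ≤ p)
    {B B' : Submodule F V} (hB : B ∈ D) (hB' : B' ∈ D) (hBB : B ≠ B') (hXB : X ≤ B ⊔ B') :
    (tau D X).card + D.card ≤ Nat.card F + 2 := by
  letI := Fintype.ofFinite F
  obtain ⟨φ, h1, h2⟩ := exists_coord hp
  have inj : Set.InjOn φ D := fun P hP Q hQ h =>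
    h1 P Q (hD.pt P hP) (hD.pt Q hQ) (hDp P hP) (hDp Q hQ) h
  have hsub : tau D X ⊆ D := Finset.filter_subset _ _
  have c1 : (D.image φ).card = D.card := Finset.card_image_of_injOn inj
  have c2 : ((tau D X).image φ).card = (tau D X).card := Finset.card_image_of_injOn (inj.mono hsub)
  rw [Nat.card_eq_fintype_card, ← c1, ← c2]
  apply TLvec (D.image φ) _ (φ X) (φ B) (φ B') (Finset.mem_image_of_mem _ hB) (Finset.mem_image_of_mem _ hB')
  · intro h; exact hBB (inj hB hB' h)
  · exact (h2 B B' X (hD.pt B hB) (hD.pt B' hB') hX (hDp B hB) (hDp B' hB') hXp hBB).2 hXB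
  · intro i hi
    rw [Finset.mem_image] at hi
    obtain ⟨P, hP, rfl⟩ := hi
    have hPD := hsub hP
    refine ⟨Finset.mem_image_of_mem _ hPD, ?_⟩
    intro r hr hne
    rw [Finset.mem_image] at hr
    obtain ⟨Q, hQ, rfl⟩ := hr
    have hQP : Q ≠ P := by rintro rfl; exact hne rfl
    rw [Ne, h2 P Q X (hD.pt P hPD) (hD.pt Q hQ) hX (hDp P hPD) (hDp Q hQ) hXp hQP.symm]
    exact (mem_tau.1 hP).2 Q hQ hQP
  · intro i hi j hj k hk hij hik hjk
    rw [Finset.mem_image] at hi hj hk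
    obtain ⟨P, hP, rfl⟩ := hi
    obtain ⟨Q, hQ, rfl⟩ := hj
    obtain ⟨R, hR, rfl⟩ := hk
    have hPQ : P ≠ Q := by rintro rfl; exact hij rfl
    have hPR : P ≠ R := by rintro rfl; exact hik rfl
    have hQR : Q ≠ R := by rintro rfl; exact hjk rfl
    rw [Ne, h2 P Q R (hD.pt P hP) (hD.pt Q hQ) (hD.pt R hR) (hDp P hP) (hDp Q hQ) (hDp R hR) hPQ]
    exact hD.cap P hP Q hQ R hR hPQ hPR hQR

end Helpers

section Helpers
set_option linter.all false
set_option linter.unusedSectionVars false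
set_option linter.style.haveILetI false
open scoped Classical

theorem cover_sum {α β : Type*} (S : Finset α) (Ls : Finset β) (I : α → β → Prop)
    (h2 : ∀ p ∈ S, ∀ p' ∈ S, p ≠ p' → ∃ L ∈ Ls, I p L ∧ I p' L ∧ ∀ L' ∈ Ls, I p L' → I p' L' → L' = L)
    (U : Finset α) (hU : U ⊆ S) (p : α) (hp : p ∈ S) (hpU : p ∉ U) :
    ∑ L ∈ Ls.filter (I p), (U.filter (I · L)).card = U.card := by
  have : ∀ x ∈ U, ∃ L ∈ Ls, I p L ∧ I x L ∧ ∀ L' ∈ Ls, I p L' → I x L' → L' = L := by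
    intro x hx
    exact h2 p hp x (hU hx) (by rintro rfl; exact hpU hx)
  rcases U.eq_empty_or_nonempty with rfl | ⟨x0, hx0⟩
  · simp
  haveI hne : Nonempty β := ⟨(this x0 hx0).choose⟩
  choose! f hf using this
  have hmap : ∀ x ∈ U, f x ∈ Ls.filter (I p) := by
    intro x hx
    rw [Finset.mem_filter]
    exact ⟨(hf x hx).1, (hf x hx).2.1⟩
  rw [Finset.card_eq_sum_card_fiberwise hmap]
  apply Finset.sum_congr rfl
  intro L hL
  rw [Finset.mem_filter] at hL
  congr 1
  ext x
  simp only [Finset.mem_filter]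
  constructor
  · rintro ⟨hx, hI⟩
    exact ⟨hx, ((hf x hx).2.2.2 L hL.1 hL.2 hI).symm⟩
  · rintro ⟨hx, rfl⟩
    exact ⟨hx, (hf x hx).2.2.1⟩

theorem cover_step {α β : Type*} (S : Finset α) (Ls : Finset β) (I : α → β → Prop)
    (h2 : ∀ p ∈ S, ∀ p' ∈ S, p ≠ p' → ∃ L ∈ Ls, I p L ∧ I p' L ∧ ∀ L' ∈ Ls, I p L' → I p' L' → L' = L)
    (N : ℤ) (p : α) (hp : p ∈ S) 
    (hN : N ≤ ∑ L ∈ Ls.filter (I p), (((S.filter (I · L)).card : ℤ) - 1) ^ 2)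
    (S' : Finset α) (hS' : S' ⊆ S) (hpS' : p ∈ S') (r x : ℤ)
    (hr : ∀ L ∈ Ls, I p L → (((S \ S').filter (I · L)).card : ℤ) ≤ r)
    (hx : ∀ L ∈ Ls, I p L → ((S'.filter (I · L)).card : ℤ) ≤ x) :
    N ≤ r * ((S.card : ℤ) - S'.card) + (2 * r + x - 1) * ((S'.card : ℤ) - 1) := by
  have e1 := cover_sum S Ls I h2 (S \ S') Finset.sdiff_subset p hp (by simp [hpS'])
  have e2 := cover_sum S Ls I h2 (S'.erase p) ((Finset.erase_subset _ _).trans hS') p hp (by simp)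
  have c1 : ((S \ S').card : ℤ) = S.card - S'.card := by
    rw [Finset.card_sdiff_of_subset hS', Nat.cast_sub (Finset.card_le_card hS')]
  have c2 : ((S'.erase p).card : ℤ) = S'.card - 1 := by
    rw [Finset.card_erase_of_mem hpS', Nat.cast_sub (Finset.card_pos.2 ⟨p, hpS'⟩)]; rfl
  rw [← c1, ← c2, ← e1, ← e2]
  push_cast
  rw [Finset.mul_sum, Finset.mul_sum, ← Finset.sum_add_distrib]
  refine hN.trans (Finset.sum_le_sum ?_)
  intro L hL
  rw [Finset.mem_filter] at hL
  have a1 := hr L hL.1 hL.2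
  have a2 := hx L hL.1 hL.2
  have a3 : (S.filter (I · L)).card = ((S \ S').filter (I · L)).card + (S'.filter (I · L)).card := by
    rw [← Finset.card_union_of_disjoint]
    · congr 1
      ext y
      simp only [Finset.mem_filter, Finset.mem_union, Finset.mem_sdiff]
      constructor
      · rintro ⟨h, h'⟩
        by_cases hy : y ∈ S'
        · right; exact ⟨hy, h'⟩
        · left; exact ⟨⟨h, hy⟩, h'⟩
      · rintro (h | h)
        · exact ⟨h.1.1, h.2⟩
        · exact ⟨hS' h.1, h.2⟩
    · rw [Finset.disjoint_left]
      intro y hy hy'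
      simp only [Finset.mem_filter, Finset.mem_sdiff] at hy hy'
      exact hy.1.2 hy'.1
  have a4 : (S'.filter (I · L)).card = ((S'.erase p).filter (I · L)).card + 1 := by
    have : (S'.erase p).filter (I · L) = (S'.filter (I · L)).erase p := by
      ext y; simp only [Finset.mem_filter, Finset.mem_erase]; tauto
    rw [this, Finset.card_erase_add_one]
    simp only [Finset.mem_filter]
    exact ⟨hpS', hL.2⟩
  rw [a3, a4]
  rw [a4] at a2
  push_cast at a2 ⊢
  set u : ℤ := (((S \ S').filter (I · L)).card : ℤ)
  set s : ℤ := (((S'.erase p).filter (I · L)).card : ℤ)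
  have hu : 0 ≤ u := by positivity
  have hs : 0 ≤ s := by positivity
  nlinarith [mul_nonneg hu (sub_nonneg.2 a1), mul_nonneg hs (sub_nonneg.2 a1), mul_nonneg hs (sub_nonneg.2 a2)]

theorem cover {α β : Type*} (S : Finset α) (Ls : Finset β) (I : α → β → Prop)
    (h2 : ∀ p ∈ S, ∀ p' ∈ S, p ≠ p' → ∃ L ∈ Ls, I p L ∧ I p' L ∧ ∀ L' ∈ Ls, I p L' → I p' L' → L' = L)
    (hLs : Ls.Nonempty) (q : ℤ) (hq : 2048 ≤ q) (hT : (S.card : ℤ) < 3 * q - 135)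
    (hN : ∀ p ∈ S, q ^ 2 + q + 1 - S.card ≤ ∑ L ∈ Ls.filter (I p), (((S.filter (I · L)).card : ℤ) - 1) ^ 2) :
    ∃ L1 ∈ Ls, ∃ L2 ∈ Ls, ∀ p ∈ S, I p L1 ∨ I p L2 := by
  have inter : ∀ L ∈ Ls, ∀ L' ∈ Ls, L ≠ L' → ∀ A ⊆ S, (∀ y ∈ A, I y L') → ((A.filter (I · L)).card : ℤ) ≤ 1 := by
    intro L hL L' hL' hne A hA hAL
    norm_cast
    rw [Finset.card_le_one]
    intro a ha b hb
    rw [Finset.mem_filter] at ha hb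
    by_contra hab
    obtain ⟨M, hM, _, _, hu⟩ := h2 a (hA ha.1) b (hA hb.1) hab
    exact hne ((hu L hL ha.2 hb.2).trans (hu L' hL' (hAL a ha.1) (hAL b hb.1)).symm)
  obtain ⟨L1, hL1, m1⟩ := Finset.exists_max_image Ls (fun L => (S.filter (I · L)).card) hLs
  set S1 := S.filter (fun y => ¬ I y L1) with hS1
  obtain ⟨L2, hL2, m2⟩ := Finset.exists_max_image Ls (fun L => (S1.filter (I · L)).card) hLs
  set S2 := S1.filter (fun y => ¬ I y L2) with hS2
  refine ⟨L1, hL1, L2, hL2, ?_⟩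
  by_contra hcon
  obtain ⟨p0, hp0, hp01, hp02⟩ : ∃ p ∈ S, ¬ I p L1 ∧ ¬ I p L2 := by
    by_contra h'
    apply hcon
    intro p hp
    by_contra hh
    rw [not_or] at hh
    exact h' ⟨p, hp, hh.1, hh.2⟩
  have hp0S2 : p0 ∈ S2 := by simp only [hS2, hS1, Finset.mem_filter]; exact ⟨⟨hp0, hp01⟩, hp02⟩
  obtain ⟨L3, hL3, m3⟩ := Finset.exists_max_image Ls (fun L => (S2.filter (I · L)).card) hLs
  set S3 := S2.filter (fun y => ¬ I y L3) with hS3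
  have s1 : S1 ⊆ S := Finset.filter_subset _ _
  have s2 : S2 ⊆ S1 := Finset.filter_subset _ _
  have s3 : S3 ⊆ S2 := Finset.filter_subset _ _
  have c1 : (S.filter (I · L1)).card + S1.card = S.card := Finset.card_filter_add_card_filter_not _
  have c2 : (S1.filter (I · L2)).card + S2.card = S1.card := Finset.card_filter_add_card_filter_not _
  have c3 : (S2.filter (I · L3)).card + S3.card = S2.card := Finset.card_filter_add_card_filter_not _
  have mm : ∀ {A B : Finset α} (L : β), A ⊆ B → (A.filter (I · L)).card ≤ (B.filter (I · L)).card :=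
    fun L h => Finset.card_le_card (Finset.filter_subset_filter _ h)
  have k1 := (mm L2 s1).trans (m1 L2 hL2)
  have k2 := (mm L3 s2).trans (m2 L3 hL3)
  have three : ∀ a b c : ℕ, (a : ℤ) ≤ 1 → (b : ℤ) ≤ 1 → (c : ℤ) ≤ 1 → ((a + b + c : ℕ) : ℤ) ≤ 3 := by
    intro a b c _ _ _; push_cast; linarith
  have r12 : ∀ p, ¬ I p L1 → ¬ I p L2 → ∀ L ∈ Ls, I p L → (((S \ S2).filter (I · L)).card : ℤ) ≤ 2 := by
    intro p n1 n2 L hL hpL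
    have i1 := inter L hL L1 hL1 (by rintro rfl; exact n1 hpL) (S.filter (I · L1)) (Finset.filter_subset _ _)
      (fun y hy => (Finset.mem_filter.1 hy).2)
    have i2 := inter L hL L2 hL2 (by rintro rfl; exact n2 hpL) (S.filter (I · L2)) (Finset.filter_subset _ _)
      (fun y hy => (Finset.mem_filter.1 hy).2)
    have hle : ((S \ S2).filter (I · L)).card ≤ ((S.filter (I · L1)).filter (I · L)).card + ((S.filter (I · L2)).filter (I · L)).card := by
      refine le_trans (Finset.card_le_card ?_) (Finset.card_union_le _ _)
      intro y
      simp only [hS2, hS1, Finset.mem_filter, Finset.mem_union, Finset.mem_sdiff]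
      tauto
    have : (((S \ S2).filter (I · L)).card : ℤ) ≤ (((S.filter (I · L1)).filter (I · L)).card : ℤ) + ((S.filter (I · L2)).filter (I · L)).card := by
      exact_mod_cast hle
    linarith
  rcases S3.eq_empty_or_nonempty with h3 | ⟨p, hp⟩
  · have := cover_step S Ls I h2 _ p0 hp0 (hN p0 hp0) S2 (s2.trans s1) hp0S2 2 S2.card
      (r12 p0 hp01 hp02) (fun L _ _ => by
        have := Finset.card_le_card (Finset.filter_subset (I · L) S2)
        exact_mod_cast this)
    rw [h3, Finset.card_empty] at c3
    have hx : 3 * (S2.card : ℤ) ≤ S.card := by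
      have : 3 * S2.card ≤ S.card := by omega
      exact_mod_cast this
    have hx0 : (0 : ℤ) ≤ S2.card := by positivity
    nlinarith
  · have hp' := hp
    simp only [hS3, hS2, hS1, Finset.mem_filter] at hp'
    obtain ⟨L4, hL4, m4⟩ := Finset.exists_max_image Ls (fun L => (S3.filter (I · L)).card) hLs
    have k3 := (mm L4 s3).trans (m3 L4 hL4)
    have := cover_step S Ls I h2 _ p hp'.1.1.1 (hN p hp'.1.1.1) S3 (s3.trans (s2.trans s1)) hp 3 ((S3.filter (I · L4)).card : ℤ)
      (by
        intro L hL hpL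
        have i1 := r12 p hp'.1.1.2 hp'.1.2 L hL hpL
        have i2 := inter L hL L3 hL3 (by rintro rfl; exact hp'.2 hpL) (S.filter (I · L3)) (Finset.filter_subset _ _)
          (fun y hy => (Finset.mem_filter.1 hy).2)
        have hle : ((S \ S3).filter (I · L)).card ≤ ((S \ S2).filter (I · L)).card + ((S.filter (I · L3)).filter (I · L)).card := by
          refine le_trans (Finset.card_le_card ?_) (Finset.card_union_le _ _)
          intro y
          simp only [hS3, Finset.mem_filter, Finset.mem_union, Finset.mem_sdiff]
          tauto
        have : (((S \ S3).filter (I · L)).card : ℤ) ≤ (((S \ S2).filter (I · L)).card : ℤ) + ((S.filter (I · L3)).filter (I · L)).card := by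
          exact_mod_cast hle
        linarith)
      (fun L hL _ => by exact_mod_cast m4 L hL)
    have hx : (S3.card : ℤ) + 3 * ((S3.filter (I · L4)).card : ℤ) ≤ S.card := by
      have : S3.card + 3 * (S3.filter (I · L4)).card ≤ S.card := by omega
      exact_mod_cast this
    have hx0 : (0 : ℤ) ≤ (S3.filter (I · L4)).card := by positivity
    have hx1 : (0 : ℤ) ≤ S3.card := by positivity
    set x : ℤ := ((S3.filter (I · L4)).card : ℤ)
    set T3 : ℤ := (S3.card : ℤ)
    set T : ℤ := (S.card : ℤ)
    have b1 : q ^ 2 + q + 1 - T ≤ 9 * x + (5 + x) * (T - 3 * x - 1) := by nlinarith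
    have b2 : 12 * (x * T - 3 * x ^ 2) ≤ T ^ 2 := by nlinarith [sq_nonneg (T - 6 * x)]
    have b3 : q ^ 2 + q + 1 - T ≤ 5 * T + (x * T - 3 * x ^ 2) := by nlinarith
    have b4 : 12 * (q ^ 2 + q + 1) ≤ 72 * T + T ^ 2 := by nlinarith
    have b5 : 0 ≤ T := by linarith
    clear_value x T3 T
    have b6 : T ^ 2 ≤ (3 * q) ^ 2 := by
      apply pow_le_pow_left₀ b5
      linarith
    have b7 : 2048 * q ≤ q ^ 2 := by rw [sq]; exact mul_le_mul_of_nonneg_right hq (by linarith)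
    linarith

end Helpers

section Helpers
set_option linter.all false
set_option linter.unusedSectionVars false
set_option linter.style.haveILetI false
open scoped Classical
variable {F : Type*} [Field F] [Finite F] {V : Type*} [AddCommGroup V] [Module F V] [Finite V]

theorem nn_pos_mem {D : Finset (Submodule F V)} {P A : Submodule F V} (hP : P ∈ D) (h : P ≤ A) : 1 ≤ nn D A :=
  Finset.card_pos.2 ⟨P, Finset.mem_filter.2 ⟨hP, h⟩⟩

theorem nn_two {D : Finset (Submodule F V)} {P Q A : Submodule F V} (hP : P ∈ D) (h : P ≤ A)
    (hQ : Q ∈ D) (h' : Q ≤ A) (hne : P ≠ Q) : 2 ≤ nn D A :=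
  Finset.one_lt_card.2 ⟨P, Finset.mem_filter.2 ⟨hP, h⟩, Q, Finset.mem_filter.2 ⟨hQ, h'⟩, hne⟩

noncomputable def SS (D : Finset (Submodule F V)) (P W : Submodule F V) : Finset (Submodule F V) :=
  (up P W).filter (fun L => nn D L = 1)

theorem mem_SS {D : Finset (Submodule F V)} {P W L : Submodule F V} (hP : rk P = 1) :
    L ∈ SS D P W ↔ P ≤ L ∧ L ≤ W ∧ rk L = 2 ∧ nn D L = 1 := by
  simp only [SS, Finset.mem_filter, mem_up, hP]; tauto

theorem card_SS {D : Finset (Submodule F V)} (hD : Cap D) {P W : Submodule F V} (hP : P ∈ D) (hPW : P ≤ W) :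
    ((SS D P W).card : ℤ) = (up P W).card - (nn D W - 1) := by
  have h := sum_up D hD.pt hPW
  rw [nn_pt hD.pt hP] at h
  have h2 : ∀ L ∈ up P W, ((nn D L : ℤ) - (1 : ℕ)) = if nn D L = 1 then 0 else 1 := by
    intro L hL
    rw [mem_up, hD.pt P hP] at hL
    have a := hD.nn_le hL.2.2
    have b := nn_pos_mem hP hL.1
    split_ifs with h
    · rw [h]; simp
    · have : nn D L = 2 := by omega
      rw [this]; norm_num
  rw [Finset.sum_congr rfl h2] at h
  have h3 := Finset.card_filter_add_card_filter_not (s := up P W) (fun L => nn D L = 1)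
  have h4 : (∑ L ∈ up P W, if nn D L = 1 then (0:ℤ) else 1) = ((up P W).filter (fun L => ¬ nn D L = 1)).card := by
    rw [Finset.card_filter]; push_cast
    apply Finset.sum_congr rfl
    intro L _
    by_cases h : nn D L = 1 <;> simp [h]
  rw [h4] at h
  unfold SS
  have : (((up P W).filter (fun L => nn D L = 1)).card : ℤ) + ((up P W).filter (fun L => ¬ nn D L = 1)).card = (up P W).card := by exact_mod_cast h3
  push_cast at h
  linarith

theorem card_SS_plane {D : Finset (Submodule F V)} (hD : Cap D) {P p : Submodule F V} (hP : P ∈ D) (hPp : P ≤ p)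
    (hp : rk p = 3) : ((SS D P p).card : ℤ) = Nat.card F + 2 - nn D p := by
  rw [card_SS hD hP hPp, card_up2 hPp (by rw [hD.pt P hP, hp])]; ring

theorem arc_le {D : Finset (Submodule F V)} (hD : Cap D) {p : Submodule F V} (hp : rk p = 3) :
    (nn D p : ℤ) ≤ Nat.card F + 2 := by
  by_cases h : nn D p = 0
  · rw [h]; positivity
  · obtain ⟨P, hP⟩ := Finset.card_pos.1 (Nat.pos_of_ne_zero h)
    rw [Finset.mem_filter] at hP
    have := card_SS_plane hD hP.1 hP.2 hp
    have h2 : (0 : ℤ) ≤ (SS D P p).card := by positivity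
    linarith

theorem SS_filter {D : Finset (Submodule F V)} {P p W : Submodule F V} (hP : rk P = 1) (hpW : p ≤ W) :
    (SS D P W).filter (· ≤ p) = SS D P p := by
  ext L
  simp only [Finset.mem_filter, mem_SS hP]
  constructor
  · rintro ⟨h, h'⟩; exact ⟨h.1, h', h.2.2⟩
  · rintro h; exact ⟨⟨h.1, h.2.1.trans hpW, h.2.2⟩, h.2.1⟩

/-- weighted fibre count -/
theorem sum_off_w {A W : Submodule F V} (D : Finset (Submodule F V)) (hD : ∀ P ∈ D, rk P = 1) (h : A ≤ W)
    (f : Submodule F V → ℤ) :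
    ∑ P ∈ D.filter (fun P => P ≤ W ∧ ¬ P ≤ A), f (A ⊔ P) = ∑ L ∈ up A W, ((nn D L : ℤ) - nn D A) * f L := by
  have hmap : ∀ P ∈ D.filter (fun P => P ≤ W ∧ ¬ P ≤ A), A ⊔ P ∈ up A W := by
    intro P hP
    rw [Finset.mem_filter] at hP
    exact sup_mem_up (hD P hP.1) h hP.2.1 hP.2.2
  rw [← Finset.sum_fiberwise_of_maps_to hmap]
  apply Finset.sum_congr rfl
  intro L hL
  rw [mem_up] at hL
  have e : ((D.filter (fun P => P ≤ W ∧ ¬ P ≤ A)).filter (fun P => A ⊔ P = L)) = D.filter (fun P => P ≤ L ∧ ¬ P ≤ A) := by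
    ext P
    simp only [Finset.mem_filter]
    constructor
    · rintro ⟨⟨hPD, hPW, hPA⟩, rfl⟩
      exact ⟨hPD, le_sup_right, hPA⟩
    · rintro ⟨hPD, hPL, hPA⟩
      exact ⟨⟨hPD, hPL.trans hL.2.1, hPA⟩, (eq_sup_pt (hD P hPD) hL.1 hPL hPA hL.2.2).symm⟩
  rw [← card_off D hL.1, ← e, Finset.sum_congr rfl (g := fun _ => f L)]
  · simp
  · intro P hP; rw [(Finset.mem_filter.1 hP).2]

structure CC (C : Finset (Submodule F V)) (W : Submodule F V) : Prop where
  rkW : rk W = 4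
  cap : Cap C
  le : ∀ P ∈ C, P ≤ W
  compl : ∀ X, rk X = 1 → X ≤ W → X ∉ C → ∃ P ∈ C, ∃ Q ∈ C, P ≠ Q ∧ X ≤ P ⊔ Q

noncomputable def TT (C : Finset (Submodule F V)) : ℤ := (Nat.card F : ℤ)^2 + Nat.card F + 2 - C.card
noncomputable def tt (C : Finset (Submodule F V)) (p : Submodule F V) : ℤ := (Nat.card F : ℤ) + 2 - nn C p

theorem CC.nnW {C : Finset (Submodule F V)} {W : Submodule F V} (h : CC C W) : nn C W = C.card := by
  unfold nn
  rw [Finset.filter_true_of_mem h.le]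

theorem CC.a3 [CharP F 2] {C : Finset (Submodule F V)} {W : Submodule F V} (h : CC C W) {X : Submodule F V} (hX : rk X = 1)
    (hXW : X ≤ W) (hXC : X ∉ C) : ((tau C X).card : ℤ) ≤ TT C := by
  obtain ⟨B, hB, B', hB', hne, hle⟩ := h.compl X hX hXW hXC
  have hl : rk (B ⊔ B') = 2 := rk_line (h.cap.pt B hB) (h.cap.pt B' hB') hne
  have hlW : B ⊔ B' ≤ W := sup_le (h.le B hB) (h.le B' hB')
  have hsub : tau C X ⊆ C := Finset.filter_subset _ _
  have e1 := sum_off (tau C X) (fun P hP => h.cap.pt P (hsub hP)) hlW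
  have e2 : (tau C X).filter (fun P => P ≤ W ∧ ¬ P ≤ B ⊔ B') = tau C X := by
    apply Finset.filter_true_of_mem
    intro P hP
    refine ⟨h.le P (hsub hP), fun hPl => ?_⟩
    have : P ∈ C.filter (· ≤ B ⊔ B') := Finset.mem_filter.2 ⟨hsub hP, hPl⟩
    rw [h.cap.nn_line hB hB' hne] at this
    rw [mem_tau] at hP
    simp only [Finset.mem_insert, Finset.mem_singleton] at this
    rcases this with rfl | rfl
    · exact hP.2 B' hB' hne.symm hle
    · exact hP.2 B hB hne (by rw [sup_comm]; exact hle)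
  rw [e2] at e1
  have e3 := sum_up C h.cap.pt hlW
  rw [h.cap.nn_bis hB hB' hne, h.nnW] at e3
  have e4 := card_up2 hlW (by rw [h.rkW, hl])
  have e5 : ∀ L ∈ up (B ⊔ B') W, (((tau C X).filter (fun P => P ≤ L ∧ ¬ P ≤ B ⊔ B')).card : ℤ) ≤ Nat.card F - ((nn C L : ℤ) - (2 : ℕ)) := by
    intro L hL
    rw [mem_up, hl] at hL
    have := TL hL.2.2 (h.cap.filter (· ≤ L)) (fun P hP => (Finset.mem_filter.1 hP).2) hX (hle.trans hL.1)
      (Finset.mem_filter.2 ⟨hB, le_sup_left.trans hL.1⟩) (Finset.mem_filter.2 ⟨hB', le_sup_right.trans hL.1⟩) hne hle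
    have h2 : ((tau C X).filter (fun P => P ≤ L ∧ ¬ P ≤ B ⊔ B')).card ≤ (tau (C.filter (· ≤ L)) X).card := by
      apply Finset.card_le_card
      intro P hP
      rw [Finset.mem_filter, mem_tau] at hP
      rw [mem_tau, Finset.mem_filter]
      exact ⟨⟨hP.1.1, hP.2.1⟩, fun Q hQ => hP.1.2 Q (Finset.mem_filter.1 hQ).1⟩
    change _ + nn C L ≤ _ at this
    have : ((tau C X).filter (fun P => P ≤ L ∧ ¬ P ≤ B ⊔ B')).card + nn C L ≤ Nat.card F + 2 := by omega
    have : (((tau C X).filter (fun P => P ≤ L ∧ ¬ P ≤ B ⊔ B')).card : ℤ) + nn C L ≤ Nat.card F + 2 := by exact_mod_cast this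
    push_cast
    linarith
  have e6 := Finset.sum_le_sum e5
  rw [Finset.sum_sub_distrib, e3, Finset.sum_const, nsmul_eq_mul, e4] at e6
  have e7 : ((tau C X).card : ℤ) = ∑ L ∈ up (B ⊔ B') W, (((tau C X).filter (fun P => P ≤ L ∧ ¬ P ≤ B ⊔ B')).card : ℤ) := by
    rw [← e1]; push_cast; rfl
  rw [e7]
  unfold TT
  push_cast at e6
  nlinarith

theorem CC.sum_tt {C : Finset (Submodule F V)} {W : Submodule F V} (h : CC C W) {P m : Submodule F V} (hP : P ∈ C)
    (hm : m ∈ SS C P W) : ∑ γ ∈ up m W, tt C γ = TT C + Nat.card F := by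
  rw [mem_SS (h.cap.pt P hP)] at hm
  have e3 := sum_up C h.cap.pt hm.2.1
  have e4 := card_up2 hm.2.1 (by rw [h.rkW, hm.2.2.1])
  rw [hm.2.2.2, h.nnW] at e3
  have : ∀ γ ∈ up m W, tt C γ = (Nat.card F : ℤ) + 1 - ((nn C γ : ℤ) - (1 : ℕ)) := by
    intro γ _; unfold tt; push_cast; ring
  rw [Finset.sum_congr rfl this, Finset.sum_sub_distrib, e3, Finset.sum_const, nsmul_eq_mul, e4]
  unfold TT
  push_cast
  ring

theorem CC.b3' [CharP F 2] {C : Finset (Submodule F V)} {W : Submodule F V} (h : CC C W) {P m : Submodule F V} (hP : P ∈ C)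
    (hm : m ∈ SS C P W) : (Nat.card F : ℤ) + ∑ γ ∈ up m W, ((nn C γ : ℤ) - 1) * tt C γ ≤ Nat.card F * TT C := by
  have rP := h.cap.pt P hP
  rw [mem_SS rP] at hm
  obtain ⟨hPm, hmW, rm, nm⟩ := hm
  set Xs := (up ⊥ m).erase P with hXs
  have mX : ∀ X, X ∈ Xs ↔ X ≠ P ∧ X ≤ m ∧ rk X = 1 := by
    intro X
    simp [hXs, mem_up, rk_bot]
  have cX : (Xs.card : ℤ) = Nat.card F := by
    have : P ∈ up ⊥ m := by rw [mem_up, rk_bot]; exact ⟨bot_le, hPm, rP⟩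
    rw [hXs, Finset.card_erase_of_mem this, Nat.cast_sub (Finset.card_pos.2 ⟨P, this⟩), card_up2 bot_le (by rw [rk_bot, rm])]
    simp
  have honly : ∀ Q ∈ C, Q ≤ m → Q = P := by
    intro Q hQ hQm
    by_contra hne
    have := nn_two hQ hQm hP hPm hne
    omega
  have hXC : ∀ X ∈ Xs, X ∉ C := by
    intro X hX hXC
    rw [mX] at hX
    exact hX.1 (honly X hXC hX.2.1)
  have s1 : ∑ X ∈ Xs, ((tau C X).card : ℤ) ≤ Nat.card F * TT C := by
    rw [← cX, ← nsmul_eq_mul]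
    apply Finset.sum_le_card_nsmul
    intro X hX
    have := (mX X).1 hX
    exact h.a3 this.2.2 (this.2.1.trans hmW) (hXC X hX)
  have s2 : ∑ X ∈ Xs, (tau C X).card = ∑ R ∈ C, (Xs.filter (fun X => R ∈ tau C X)).card := by
    have := Finset.sum_card_bipartiteAbove_eq_sum_card_bipartiteBelow (s := Xs) (t := C) (fun X R => R ∈ tau C X)
    rw [← Finset.sum_congr rfl (fun X hX => ?_)]
    · exact this
    · congr 1
      ext R
      simp only [Finset.mem_bipartiteAbove, mem_tau]; tauto
  have s3 : (Xs.filter (fun X => P ∈ tau C X)) = Xs := by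
    apply Finset.filter_true_of_mem
    intro X hX
    rw [mem_tau]
    have hX' := (mX X).1 hX
    refine ⟨hP, fun Q hQ hQP hle => ?_⟩
    have e := exch rP (h.cap.pt Q hQ) hX'.2.2 hle hX'.1
    have : Q ≤ m := le_trans (le_sup_right.trans e.le) (sup_le hPm hX'.2.1)
    exact hQP (honly Q hQ this)
  have s4 : ∀ R ∈ C.filter (fun R => R ≤ W ∧ ¬ R ≤ m), tt C (m ⊔ R) ≤ ((Xs.filter (fun X => R ∈ tau C X)).card : ℤ) := by
    intro R hR
    rw [Finset.mem_filter] at hR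
    obtain ⟨hRC, hRW, hRm⟩ := hR
    have rR := h.cap.pt R hRC
    have rg : rk (m ⊔ R) = 3 := by rw [rk_sup_pt rR hRm, rm]
    unfold tt
    rw [← card_SS_plane h.cap hRC (le_sup_right : R ≤ m ⊔ R) rg]
    norm_cast
    have key : ∀ L ∈ SS C R (m ⊔ R), rk (L ⊓ m) = 1 ∧ L = R ⊔ (L ⊓ m) := by
      intro L hL
      rw [mem_SS rR] at hL
      have h1 : L ⊔ m = m ⊔ R := by
        apply le_antisymm (sup_le hL.2.1 le_sup_left) (sup_le le_sup_right (hL.1.trans le_sup_left))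
      have h2 := rk_sup_inf L m
      rw [h1, rg, hL.2.2.1, rm] at h2
      have h3 : rk (L ⊓ m) = 1 := by omega
      refine ⟨h3, eq_line rR h3 ?_ hL.1 inf_le_left hL.2.2.1⟩
      intro h4
      exact hRm (h4.le.trans inf_le_right)
    apply Finset.card_le_card_of_injOn (fun L => L ⊓ m)
    · intro L hL
      have hL : L ∈ SS C R (m ⊔ R) := hL
      obtain ⟨k1, k2⟩ := key L hL
      rw [mem_SS rR] at hL
      simp only [Finset.coe_filter, Set.mem_setOf_eq, mX]
      have hRP : R ≠ P := by rintro rfl; exact hRm hPm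
      refine ⟨⟨?_, inf_le_right, k1⟩, ?_⟩
      · intro e
        have : P ≤ L := e ▸ inf_le_left
        have := nn_two hP this hRC hL.1 hRP.symm
        omega
      · rw [mem_tau]
        refine ⟨hRC, fun Q hQ hQR hle => ?_⟩
        have e := exch rR (h.cap.pt Q hQ) k1 hle (fun h4 => hRm (h4.symm.le.trans inf_le_right))
        rw [← k2] at e
        have : Q ≤ L := le_sup_right.trans e.le
        have := nn_two hQ this hRC hL.1 hQR
        omega
    · intro L hL L' hL' e
      have e : L ⊓ m = L' ⊓ m := e
      have e2 := (key L hL).2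
      rw [e, ← (key L' hL').2] at e2
      exact e2
  have s5 := sum_off_w C h.cap.pt hmW (tt C)
  rw [nm] at s5
  have s6 : C = insert P (C.filter (fun R => R ≤ W ∧ ¬ R ≤ m)) := by
    ext R
    simp only [Finset.mem_insert, Finset.mem_filter]
    constructor
    · intro hR
      by_cases hRm : R ≤ m
      · left; exact honly R hR hRm
      · right; exact ⟨hR, h.le R hR, hRm⟩
    · rintro (rfl | h)
      · exact hP
      · exact h.1
  have s7 : (∑ X ∈ Xs, ((tau C X).card : ℤ)) = ∑ R ∈ C, ((Xs.filter (fun X => R ∈ tau C X)).card : ℤ) := by exact_mod_cast s2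
  have s8 : ∑ R ∈ C, ((Xs.filter (fun X => R ∈ tau C X)).card : ℤ) = ((Xs.filter (fun X => P ∈ tau C X)).card : ℤ) + ∑ R ∈ C.filter (fun R => R ≤ W ∧ ¬ R ≤ m), ((Xs.filter (fun X => R ∈ tau C X)).card : ℤ) := by
    have gen : ∀ f : Submodule F V → ℤ, ∑ R ∈ C, f R = f P + ∑ R ∈ C.filter (fun R => R ≤ W ∧ ¬ R ≤ m), f R := by
      intro f
      conv_lhs => rw [s6]
      exact Finset.sum_insert (by simp [hPm])
    exact gen _
  rw [s7, s8, s3, cX] at s1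
  have s9 := Finset.sum_le_sum s4
  rw [s5] at s9
  push_cast at s9
  linarith

theorem CC.b3 [CharP F 2] {C : Finset (Submodule F V)} {W : Submodule F V} (h : CC C W) {P m : Submodule F V} (hP : P ∈ C)
    (hm : m ∈ SS C P W) : (Nat.card F : ℤ)^2 + Nat.card F + 1 - TT C ≤ ∑ γ ∈ up m W, (tt C γ - 1)^2 := by
  have h1 := h.b3' hP hm
  have h2 := h.sum_tt hP hm
  rw [mem_SS (h.cap.pt P hP)] at hm
  have e4 := card_up2 hm.2.1 (by rw [h.rkW, hm.2.2.1])
  have : ∀ γ ∈ up m W, ((nn C γ : ℤ) - 1) * tt C γ = ((Nat.card F : ℤ) + 1) * tt C γ - 2 * tt C γ + 1 - (tt C γ - 1)^2 := by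
    intro γ _; unfold tt; ring
  rw [Finset.sum_congr rfl this, Finset.sum_sub_distrib, Finset.sum_add_distrib, Finset.sum_sub_distrib, ← Finset.mul_sum, ← Finset.mul_sum, h2, Finset.sum_const, nsmul_eq_mul, e4] at h1
  nlinarith

end Helpers

section Helpers
set_option linter.all false
set_option linter.unusedSectionVars false
set_option linter.style.haveILetI false
open scoped Classical
variable {F : Type*} [Field F] [Finite F] {V : Type*} [AddCommGroup V] [Module F V] [Finite V]

noncomputable def Pl (P W : Submodule F V) : Finset (Submodule F V) :=
  Finset.univ.filter (fun p => P ≤ p ∧ p ≤ W ∧ rk p = 3)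

theorem mem_Pl {P W p : Submodule F V} : p ∈ Pl P W ↔ P ≤ p ∧ p ≤ W ∧ rk p = 3 := by simp [Pl]

theorem meet2 {p p' W : Submodule F V} (hW : rk W = 4) (hp : rk p = 3) (hp' : rk p' = 3) (h : p ≤ W) (h' : p' ≤ W)
    (hne : p ≠ p') : rk (p ⊓ p') = 2 := by
  have e := rk_sup_inf p p'
  have e1 : rk (p ⊔ p') ≤ 4 := hW ▸ rk_mono (sup_le h h')
  have e2 : p < p ⊔ p' := by
    refine lt_of_le_of_ne le_sup_left fun e => ?_
    exact hne (eq_of_rk (e ▸ le_sup_right : p' ≤ p) (by omega)).symm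
  have := rk_lt e2
  omega

theorem line_meet {p p' W m : Submodule F V} (hW : rk W = 4) (hp : rk p = 3) (hp' : rk p' = 3) (h : p ≤ W) (h' : p' ≤ W)
    (hne : p ≠ p') (hm : rk m = 2) (h1 : m ≤ p) (h2 : m ≤ p') : m = p ⊓ p' :=
  eq_of_rk (le_inf h1 h2) (by rw [meet2 hW hp hp' h h' hne, hm])

theorem Pl_double {P W : Submodule F V} (hP : rk P = 1) (S : Finset (Submodule F V)) (hS : S ⊆ up P W)
    (f : Submodule F V → ℤ) :
    ∑ p ∈ Pl P W, ((S.filter (· ≤ p)).card : ℤ) * f p = ∑ m ∈ S, ∑ p ∈ up m W, f p := by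
  have : ∀ p ∈ Pl P W, ((S.filter (· ≤ p)).card : ℤ) * f p = ∑ m ∈ S.filter (· ≤ p), f p := by
    intro p _; rw [Finset.sum_const, nsmul_eq_mul]
  rw [Finset.sum_congr rfl this]
  apply Finset.sum_comm'
  intro p m
  rw [Finset.mem_filter, mem_Pl, mem_up]
  constructor
  · rintro ⟨h1, h2, h3⟩
    have := mem_up.1 (hS h2)
    exact ⟨⟨h3, h1.2.1, by omega⟩, h2⟩
  · rintro ⟨h1, h2⟩
    have := mem_up.1 (hS h2)
    exact ⟨⟨this.1.trans h1.1, h1.2.1, by omega⟩, h2, h1.1⟩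

theorem card_Pl {P W : Submodule F V} (hP : rk P = 1) (hW : rk W = 4) (hPW : P ≤ W) :
    ((Pl P W).card : ℤ) = (Nat.card F : ℤ)^2 + Nat.card F + 1 := by
  have h := Pl_double hP (up P W) (Finset.Subset.refl _) (fun _ => 1)
  have h1 : ∀ p ∈ Pl P W, (((up P W).filter (· ≤ p)).card : ℤ) * 1 = Nat.card F + 1 := by
    intro p hp
    rw [mem_Pl] at hp
    have : (up P W).filter (· ≤ p) = up P p := by
      ext L; simp only [Finset.mem_filter, mem_up]
      exact ⟨fun h => ⟨h.1.1, h.2, h.1.2.2⟩, fun h => ⟨⟨h.1, h.2.1.trans hp.2.1, h.2.2⟩, h.2.1⟩⟩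
    rw [this, card_up2 hp.1 (by omega), mul_one]
  have h2 : ∀ m ∈ up P W, ∑ p ∈ up m W, (1 : ℤ) = Nat.card F + 1 := by
    intro m hm
    rw [mem_up] at hm
    rw [Finset.sum_const, nsmul_eq_mul, mul_one, card_up2 hm.2.1 (by omega)]
  rw [Finset.sum_congr rfl h1, Finset.sum_congr rfl h2, Finset.sum_const, Finset.sum_const, nsmul_eq_mul, nsmul_eq_mul,
    card_up3 hPW (by omega)] at h
  have := one_lt_q (F := F)
  exact mul_right_cancel₀ (by linarith) h

section loc
variable {C : Finset (Submodule F V)} {W P : Submodule F V}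

theorem CC.cardS (h : CC C W) (hP : P ∈ C) : ((SS C P W).card : ℤ) = TT C := by
  have rP := h.cap.pt P hP
  rw [card_SS h.cap hP (h.le P hP), h.nnW, card_up3 (h.le P hP) (by rw [h.rkW, rP])]
  unfold TT; ring

theorem CC.tS (h : CC C W) (hP : P ∈ C) {p : Submodule F V} (hp : p ∈ Pl P W) :
    (((SS C P W).filter (· ≤ p)).card : ℤ) = tt C p := by
  rw [mem_Pl] at hp
  rw [SS_filter (h.cap.pt P hP) hp.2.1, card_SS_plane h.cap hP hp.1 hp.2.2, tt]

theorem CC.tt_le (h : CC C W) (hP : P ∈ C) {p : Submodule F V} (hp : p ∈ Pl P W) : tt C p ≤ Nat.card F + 1 := by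
  rw [mem_Pl] at hp
  have := nn_pos_mem hP hp.1
  have : (1 : ℤ) ≤ nn C p := by exact_mod_cast this
  unfold tt; linarith

theorem CC.tt_nonneg (h : CC C W) (hP : P ∈ C) {p : Submodule F V} (hp : p ∈ Pl P W) : 0 ≤ tt C p := by
  rw [← h.tS hP hp]; positivity

theorem CC.up_Pl (h : CC C W) (hP : P ∈ C) {m p : Submodule F V} (hm : m ∈ SS C P W) : p ∈ up m W ↔ p ∈ Pl P W ∧ m ≤ p := by
  rw [mem_SS (h.cap.pt P hP)] at hm
  rw [mem_up, mem_Pl, hm.2.2.1]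
  constructor
  · rintro ⟨a, b, c⟩; exact ⟨⟨hm.1.trans a, b, c⟩, a⟩
  · rintro ⟨⟨a, b, c⟩, d⟩; exact ⟨d, b, c⟩

theorem CC.sum1 (h : CC C W) (hP : P ∈ C) : ∑ p ∈ Pl P W, tt C p = TT C * (Nat.card F + 1) := by
  have := Pl_double (h.cap.pt P hP) (SS C P W) (Finset.filter_subset _ _) (fun _ => 1)
  rw [Finset.sum_congr rfl (g := tt C) (fun p hp => by rw [h.tS hP hp, mul_one])] at this
  rw [this, Finset.sum_congr rfl (g := fun _ => (Nat.card F : ℤ) + 1), Finset.sum_const, nsmul_eq_mul, h.cardS hP]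
  intro m hm
  rw [mem_SS (h.cap.pt P hP)] at hm
  rw [Finset.sum_const, nsmul_eq_mul, mul_one, card_up2 hm.2.1 (by rw [h.rkW, hm.2.2.1])]

theorem CC.sum2 (h : CC C W) (hP : P ∈ C) : ∑ p ∈ Pl P W, tt C p * tt C p = TT C * (TT C + Nat.card F) := by
  have := Pl_double (h.cap.pt P hP) (SS C P W) (Finset.filter_subset _ _) (tt C)
  rw [Finset.sum_congr rfl (g := fun p => tt C p * tt C p) (fun p hp => by rw [h.tS hP hp])] at this
  rw [this, Finset.sum_congr rfl (g := fun _ => TT C + Nat.card F), Finset.sum_const, nsmul_eq_mul, h.cardS hP]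
  intro m hm
  exact h.sum_tt hP hm

theorem CC.two_cover [CharP F 2] (h : CC C W) (hP : P ∈ C) (hq : (2048 : ℤ) ≤ Nat.card F) (hT : TT C < 3 * Nat.card F - 135) :
    ∃ w1 ∈ Pl P W, ∃ w2 ∈ Pl P W, ∀ m ∈ SS C P W, m ≤ w1 ∨ m ≤ w2 := by
  have rP := h.cap.pt P hP
  apply cover (SS C P W) (Pl P W) (fun m p => m ≤ p) ?_ ?_ (Nat.card F) hq (by rw [h.cardS hP]; exact hT)
  · intro m hm
    rw [h.cardS hP]
    have := h.b3 hP hm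
    have e : (Pl P W).filter (fun p => m ≤ p) = up m W := by
      ext p; rw [Finset.mem_filter, h.up_Pl hP hm]
    rw [e, Finset.sum_congr rfl (g := fun γ => (tt C γ - 1)^2)]
    · exact this
    · intro γ hγ
      rw [h.up_Pl hP hm] at hγ
      rw [h.tS hP hγ.1]
  · intro m hm m' hm' hne
    rw [mem_SS rP] at hm hm'
    have e1 := rk_sup_inf m m'
    have e2 : rk (m ⊓ m') < 2 := by
      rw [← hm.2.2.1]
      apply rk_lt
      refine lt_of_le_of_ne inf_le_left fun e => hne ?_
      exact eq_of_rk (e ▸ inf_le_right) (by omega)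
    have e3 : 1 ≤ rk (m ⊓ m') := rP ▸ rk_mono (le_inf hm.1 hm'.1)
    have e4 : rk (m ⊔ m') = 3 := by omega
    refine ⟨m ⊔ m', ?_, le_sup_left, le_sup_right, ?_⟩
    · rw [mem_Pl]; exact ⟨hm.1.trans le_sup_left, sup_le hm.2.1 hm'.2.1, e4⟩
    · intro L hL h1 h2
      rw [mem_Pl] at hL
      exact (eq_of_rk (sup_le h1 h2) (by omega)).symm
  · rw [← Finset.card_pos]
    have := card_Pl rP h.rkW (h.le P hP)
    have h2 : (0 : ℤ) < (Pl P W).card := by rw [this]; positivity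
    exact_mod_cast h2

theorem CC.two_le (h : CC C W) (hP : P ∈ C) {w1 w2 : Submodule F V} (h1 : w1 ∈ Pl P W) (h2 : w2 ∈ Pl P W)
    (hc : ∀ m ∈ SS C P W, m ≤ w1 ∨ m ≤ w2) {p : Submodule F V} (hp : p ∈ Pl P W) (n1 : p ≠ w1) (n2 : p ≠ w2) :
    tt C p ≤ 2 := by
  rw [← h.tS hP hp]
  rw [mem_Pl] at h1 h2 hp
  have : ((SS C P W).filter (· ≤ p)).card ≤ ({p ⊓ w1, p ⊓ w2} : Finset (Submodule F V)).card := by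
    apply Finset.card_le_card
    intro m hm
    rw [Finset.mem_filter] at hm
    have hm' := (mem_SS (h.cap.pt P hP)).1 hm.1
    simp only [Finset.mem_insert, Finset.mem_singleton]
    rcases hc m hm.1 with h' | h'
    · left; exact line_meet h.rkW hp.2.2 h1.2.2 hp.2.1 h1.2.1 n1 hm'.2.2.1 hm.2 h'
    · right; exact line_meet h.rkW hp.2.2 h2.2.2 hp.2.1 h2.2.1 n2 hm'.2.2.1 hm.2 h'
  have := this.trans Finset.card_le_two
  exact_mod_cast this

theorem CC.one_le (h : CC C W) (hP : P ∈ C) {p m : Submodule F V} (hp : p ∈ Pl P W) (hm : m ∈ SS C P W) (hmp : m ≤ p) :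
    1 ≤ tt C p := by
  rw [← h.tS hP hp]
  have : 0 < ((SS C P W).filter (· ≤ p)).card := Finset.card_pos.2 ⟨m, Finset.mem_filter.2 ⟨hm, hmp⟩⟩
  exact_mod_cast this

theorem CC.full (h : CC C W) (hP : P ∈ C) {p m : Submodule F V} (hp : p ∈ Pl P W) (ht : tt C p = Nat.card F + 1)
    (hPm : P ≤ m) (hm : rk m = 2) (hmp : m ≤ p) : m ∈ SS C P W := by
  have rP := h.cap.pt P hP
  have hp' := mem_Pl.1 hp
  have e : SS C P p = up P p := by
    apply Finset.eq_of_subset_of_card_le (Finset.filter_subset _ _)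
    have e1 := card_SS_plane h.cap hP hp'.1 hp'.2.2
    have e2 := card_up2 hp'.1 (by rw [hp'.2.2, rP])
    unfold tt at ht
    rw [← e1, ← e2] at ht
    exact_mod_cast ht.symm.le
  have : m ∈ SS C P p := by rw [e, mem_up, rP]; exact ⟨hPm, hmp, hm⟩
  rw [mem_SS rP] at this ⊢
  exact ⟨hPm, hmp.trans hp'.2.1, this.2.2⟩

theorem CC.ineq [CharP F 2] (h : CC C W) (hP : P ∈ C) {w m : Submodule F V} (hw : w ∈ Pl P W) (hm : m ∈ SS C P W) (hmw : m ≤ w)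
    (h2 : ∀ p ∈ Pl P W, m ≤ p → p ≠ w → tt C p ≤ 2) :
    (Nat.card F : ℤ)^2 + Nat.card F + 1 - TT C ≤ (tt C w - 1)^2 + TT C - tt C w := by
  have b := h.b3 hP hm
  have s := h.sum_tt hP hm
  have hwu : w ∈ up m W := (h.up_Pl hP hm).2 ⟨hw, hmw⟩
  have hm' := (mem_SS (h.cap.pt P hP)).1 hm
  have c := card_up2 hm'.2.1 (by rw [h.rkW, hm'.2.2.1])
  rw [← Finset.add_sum_erase _ _ hwu] at b s
  have e : ∀ γ ∈ (up m W).erase w, (tt C γ - 1)^2 = tt C γ - 1 := by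
    intro γ hγ
    rw [Finset.mem_erase, h.up_Pl hP hm] at hγ
    have a1 := h2 γ hγ.2.1 hγ.2.2 hγ.1
    have a2 := h.one_le hP hγ.2.1 hm hγ.2.2
    have : tt C γ = 1 ∨ tt C γ = 2 := by omega
    rcases this with h | h <;> rw [h] <;> norm_num
  rw [Finset.sum_congr rfl e, Finset.sum_sub_distrib, Finset.sum_const, nsmul_eq_mul, Finset.card_erase_of_mem hwu,
    Nat.cast_sub (Finset.card_pos.2 ⟨w, hwu⟩), c] at b
  push_cast at b
  linarith

theorem CC.loc1 [CharP F 2] (h : CC C W) (hP : P ∈ C) (hq : (2048 : ℤ) ≤ Nat.card F) {w : Submodule F V} (hw : w ∈ Pl P W)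
    (hc : ∀ m ∈ SS C P W, m ≤ w) : TT C = 0 ∨
    (TT C = Nat.card F + 1 ∧ tt C w = Nat.card F + 1 ∧ ∀ p ∈ Pl P W, p ≠ w → tt C p = 1) := by
  have hT : TT C = tt C w := by
    rw [← h.cardS hP, ← h.tS hP hw, Finset.filter_true_of_mem hc]
  rcases (SS C P W).eq_empty_or_nonempty with h0 | ⟨m, hm⟩
  · left; rw [← h.cardS hP, h0]; simp
  · right
    have hw' := mem_Pl.1 hw
    have one : ∀ p ∈ Pl P W, p ≠ w → tt C p ≤ 1 := by
      intro p hp hne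
      have hp' := mem_Pl.1 hp
      rw [← h.tS hP hp]
      norm_cast
      rw [Finset.card_le_one]
      intro a ha b hb
      rw [Finset.mem_filter] at ha hb
      have ha' := (mem_SS (h.cap.pt P hP)).1 ha.1
      have hb' := (mem_SS (h.cap.pt P hP)).1 hb.1
      rw [line_meet h.rkW hp'.2.2 hw'.2.2 hp'.2.1 hw'.2.1 hne ha'.2.2.1 ha.2 (hc a ha.1),
        line_meet h.rkW hp'.2.2 hw'.2.2 hp'.2.1 hw'.2.1 hne hb'.2.2.1 hb.2 (hc b hb.1)]
    have i := h.ineq hP hw hm (hc m hm) (fun p hp _ hne => (one p hp hne).trans (by norm_num))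
    have le := h.tt_le hP hw
    have ge := h.one_le hP hw hm (hc m hm)
    have ht : tt C w = Nat.card F + 1 := by
      rw [hT] at i
      nlinarith
    refine ⟨hT.trans ht, ht, fun p hp hne => le_antisymm (one p hp hne) ?_⟩
    have hp' := mem_Pl.1 hp
    have r2 := meet2 h.rkW hp'.2.2 hw'.2.2 hp'.2.1 hw'.2.1 hne
    exact h.one_le hP hp (h.full hP hw ht (le_inf hp'.1 hw'.1) r2 inf_le_right) inf_le_left

theorem CC.loc2 [CharP F 2] (h : CC C W) (hP : P ∈ C) (hq : (2048 : ℤ) ≤ Nat.card F) {w1 w2 : Submodule F V} (h1 : w1 ∈ Pl P W)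
    (h2 : w2 ∈ Pl P W) (hc : ∀ m ∈ SS C P W, m ≤ w1 ∨ m ≤ w2) {m1 m2 : Submodule F V} (hm1 : m1 ∈ SS C P W) (hm2 : m2 ∈ SS C P W)
    (n1 : ¬ m1 ≤ w2) (n2 : ¬ m2 ≤ w1) :
    (TT C = 2 * Nat.card F + 1 ∧ tt C w1 = Nat.card F + 1 ∧ tt C w2 = Nat.card F + 1) ∨
    (TT C = 2 * Nat.card F ∧ ((tt C w1 = Nat.card F + 1 ∧ tt C w2 = Nat.card F) ∨ (tt C w1 = Nat.card F ∧ tt C w2 = Nat.card F + 1))) ∨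
    (TT C = 2 * Nat.card F ∧ tt C w1 = Nat.card F ∧ tt C w2 = Nat.card F ∧ w1 ⊓ w2 ∉ SS C P W) := by
  have hne : w1 ≠ w2 := by
    rintro rfl
    rcases hc m1 hm1 with h | h <;> exact n1 h
  have l1 : m1 ≤ w1 := (hc m1 hm1).resolve_right n1
  have l2 : m2 ≤ w2 := (hc m2 hm2).resolve_left n2
  have i1 := h.ineq hP h1 hm1 l1 (fun p hp hmp hne => h.two_le hP h1 h2 hc hp hne (by rintro rfl; exact n1 hmp))
  have i2 := h.ineq hP h2 hm2 l2 (fun p hp hmp hne => h.two_le hP h1 h2 hc hp (by rintro rfl; exact n2 hmp) hne)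
  have a1 := h.tt_le hP h1
  have a2 := h.tt_le hP h2
  have b1 := h.one_le hP h1 hm1 l1
  have b2 := h.one_le hP h2 hm2 l2
  have h1' := mem_Pl.1 h1
  have h2' := mem_Pl.1 h2
  have rm := meet2 h.rkW h1'.2.2 h2'.2.2 h1'.2.1 h2'.2.1 hne
  have hTe : TT C = tt C w1 + tt C w2 - (if w1 ⊓ w2 ∈ SS C P W then 1 else 0) := by
    rw [← h.tS hP h1, ← h.tS hP h2, ← h.cardS hP]
    have e := Finset.card_union_add_card_inter ((SS C P W).filter (· ≤ w1)) ((SS C P W).filter (· ≤ w2))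
    have e1 : (SS C P W).filter (· ≤ w1) ∪ (SS C P W).filter (· ≤ w2) = SS C P W := by
      ext m; simp only [Finset.mem_union, Finset.mem_filter]
      constructor
      · rintro (h | h) <;> exact h.1
      · intro hm
        rcases hc m hm with h | h
        · left; exact ⟨hm, h⟩
        · right; exact ⟨hm, h⟩
    have e2 : (SS C P W).filter (· ≤ w1) ∩ (SS C P W).filter (· ≤ w2) = if w1 ⊓ w2 ∈ SS C P W then {w1 ⊓ w2} else ∅ := by
      have key : ∀ m ∈ SS C P W, m ≤ w1 → m ≤ w2 → m = w1 ⊓ w2 := by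
        intro m hm ha hb
        have hm' := (mem_SS (h.cap.pt P hP)).1 hm
        exact line_meet h.rkW h1'.2.2 h2'.2.2 h1'.2.1 h2'.2.1 hne hm'.2.2.1 ha hb
      split_ifs with hs
      · ext m; simp only [Finset.mem_inter, Finset.mem_filter, Finset.mem_singleton]
        constructor
        · rintro ⟨⟨x, y⟩, _, z⟩; exact key m x y z
        · rintro rfl; exact ⟨⟨hs, inf_le_left⟩, hs, inf_le_right⟩
      · ext m; simp only [Finset.mem_inter, Finset.mem_filter, Finset.notMem_empty, iff_false]
        rintro ⟨⟨x, y⟩, _, z⟩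
        have := key m x y z
        subst this; exact hs x
    rw [e1, e2] at e
    have e : ((SS C P W).card : ℤ) + (((if w1 ⊓ w2 ∈ SS C P W then {w1 ⊓ w2} else ∅ : Finset (Submodule F V)).card : ℕ) : ℤ) =
      ((SS C P W).filter (· ≤ w1)).card + ((SS C P W).filter (· ≤ w2)).card := by exact_mod_cast e
    split_ifs at e ⊢
    · rw [Finset.card_singleton] at e; push_cast at e; linarith
    · rw [Finset.card_empty] at e; push_cast at e; linarith
  have f1 : tt C w1 = Nat.card F + 1 → w1 ⊓ w2 ∈ SS C P W := fun e => h.full hP h1 e (le_inf h1'.1 h2'.1) rm inf_le_left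
  have f2 : tt C w2 = Nat.card F + 1 → w1 ⊓ w2 ∈ SS C P W := fun e => h.full hP h2 e (le_inf h1'.1 h2'.1) rm inf_le_right
  have hT : TT C ≤ 2 * Nat.card F + 2 := by
    rw [hTe]; split_ifs <;> linarith
  have c1 : Nat.card F ≤ tt C w1 := by
    by_contra hcon
    have : tt C w1 ≤ Nat.card F - 1 := by omega
    nlinarith
  have c2 : Nat.card F ≤ tt C w2 := by
    by_contra hcon
    have : tt C w2 ≤ Nat.card F - 1 := by omega
    nlinarith
  have d1 : tt C w1 = Nat.card F ∨ tt C w1 = Nat.card F + 1 := by omega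
  have d2 : tt C w2 = Nat.card F ∨ tt C w2 = Nat.card F + 1 := by omega
  by_cases hs : w1 ⊓ w2 ∈ SS C P W
  · rw [if_pos hs] at hTe
    rcases d1 with d1 | d1 <;> rcases d2 with d2 | d2
    · exfalso
      rw [d1, d2] at hTe
      rw [d1, hTe] at i1
      nlinarith
    · right; left; exact ⟨by rw [hTe, d1, d2]; ring, Or.inr ⟨d1, d2⟩⟩
    · right; left; exact ⟨by rw [hTe, d1, d2]; ring, Or.inl ⟨d1, d2⟩⟩
    · left; exact ⟨by rw [hTe, d1, d2]; ring, d1, d2⟩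
  · rw [if_neg hs] at hTe
    rcases d1 with d1 | d1
    · rcases d2 with d2 | d2
      · right; right; exact ⟨by rw [hTe, d1, d2]; ring, d1, d2, hs⟩
      · exact absurd (f2 d2) hs
    · exact absurd (f1 d1) hs

/-- counts of planes with `tt = 1`, resp. `tt = 0` -/
theorem CC.count (h : CC C W) (hP : P ∈ C) (hq : (2048 : ℤ) ≤ Nat.card F) {w1 w2 : Submodule F V} (h1 : w1 ∈ Pl P W)
    (h2 : w2 ∈ Pl P W) (hc : ∀ m ∈ SS C P W, m ≤ w1 ∨ m ≤ w2) (hne : w1 ≠ w2)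
    (g1 : Nat.card F ≤ tt C w1) (g2 : Nat.card F ≤ tt C w2) :
    (((Pl P W).filter (fun p => tt C p = 1)).card : ℤ) = tt C w1 * (tt C w1 - 2) + tt C w2 * (tt C w2 - 2) - TT C * (TT C - Nat.card F - 2) ∧
    2 * (((Pl P W).filter (fun p => tt C p = 0)).card : ℤ) = TT C * (TT C + Nat.card F) - 3 * (TT C * (Nat.card F + 1))
      + 2 * ((Nat.card F : ℤ)^2 + Nat.card F + 1) - (tt C w1 - 1) * (tt C w1 - 2) - (tt C w2 - 1) * (tt C w2 - 2) := by
  have s1 := h.sum1 hP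
  have s2 := h.sum2 hP
  have c := card_Pl (h.cap.pt P hP) h.rkW (h.le P hP)
  have sub : ({w1, w2} : Finset (Submodule F V)) ⊆ Pl P W := by
    intro x; simp only [Finset.mem_insert, Finset.mem_singleton]; rintro (rfl | rfl) <;> assumption
  have small : ∀ p ∈ Pl P W, p ∉ ({w1, w2} : Finset (Submodule F V)) → tt C p = 0 ∨ tt C p = 1 ∨ tt C p = 2 := by
    intro p hp hn
    simp only [Finset.mem_insert, Finset.mem_singleton, not_or] at hn
    have a := h.two_le hP h1 h2 hc hp hn.1 hn.2
    have b := h.tt_nonneg hP hp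
    omega
  have k1 : ∀ a : ℤ, (((Pl P W).filter (fun p => tt C p = a)).card : ℤ) = ∑ p ∈ Pl P W, if tt C p = a then 1 else 0 := by
    intro a; rw [Finset.card_filter]; push_cast; rfl
  constructor
  · have e := Finset.sum_subset (f := fun p => tt C p * tt C p - 2 * tt C p + if tt C p = 1 then 1 else 0) sub (by
      intro p hp hn
      rcases small p hp hn with h | h | h <;> simp [h])
    rw [Finset.sum_pair hne, Finset.sum_add_distrib, Finset.sum_sub_distrib, ← Finset.mul_sum, s1, s2, ← k1, if_neg (by linarith), if_neg (by linarith)] at e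
    linarith
  · have e := Finset.sum_subset (f := fun p => tt C p * tt C p - 3 * tt C p + 2 - 2 * if tt C p = 0 then 1 else 0) sub (by
      intro p hp hn
      rcases small p hp hn with h | h | h <;> simp [h])
    rw [Finset.sum_pair hne, Finset.sum_sub_distrib, Finset.sum_add_distrib, Finset.sum_sub_distrib, ← Finset.mul_sum, ← Finset.mul_sum, s1, s2, ← k1, if_neg (by linarith), if_neg (by linarith), Finset.sum_const, nsmul_eq_mul, c] at e
    linarith
end loc
end Helpers

section Helpers
set_option linter.all false
set_option linter.unusedSectionVars false
set_option linter.style.haveILetI false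
open scoped Classical
variable {F : Type*} [Field F] [Finite F] {V : Type*} [AddCommGroup V] [Module F V] [Finite V]
variable {C : Finset (Submodule F V)} {W P : Submodule F V}

theorem CC.dvd (h : CC C W) (a r : ℤ) (hr : ∀ P ∈ C, (((Pl P W).filter (fun p => tt C p = a)).card : ℤ) = r) :
    ((Nat.card F : ℤ) + 2 - a) ∣ C.card * r := by
  set Q := (Finset.univ : Finset (Submodule F V)).filter (fun p => p ≤ W ∧ rk p = 3 ∧ tt C p = a) with hQ
  have e := Finset.sum_card_bipartiteAbove_eq_sum_card_bipartiteBelow (s := C) (t := Q) (fun P p => P ≤ p)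
  have e1 : ∀ P ∈ C, ((Q.bipartiteAbove (fun P p => P ≤ p) P).card : ℤ) = r := by
    intro P hP
    rw [← hr P hP]
    congr 2
    ext p
    simp only [Finset.mem_bipartiteAbove, hQ, Finset.mem_filter, Finset.mem_univ, true_and, mem_Pl]
    tauto
  have e2 : ∀ p ∈ Q, ((C.bipartiteBelow (fun P p => P ≤ p) p).card : ℤ) = Nat.card F + 2 - a := by
    intro p hp
    simp only [hQ, Finset.mem_filter, Finset.mem_univ, true_and] at hp
    have : C.bipartiteBelow (fun P p => P ≤ p) p = C.filter (· ≤ p) := rfl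
    rw [this, ← hp.2.2, tt]
    simp [nn]
  have e3 : (∑ P ∈ C, ((Q.bipartiteAbove (fun P p => P ≤ p) P).card : ℤ)) = ∑ p ∈ Q, ((C.bipartiteBelow (fun P p => P ≤ p) p).card : ℤ) := by
    exact_mod_cast e
  rw [Finset.sum_congr rfl e1, Finset.sum_congr rfl e2, Finset.sum_const, Finset.sum_const, nsmul_eq_mul, nsmul_eq_mul] at e3
  rw [e3]
  exact dvd_mul_left _ _

theorem no_dvd {a b c x : ℤ} (h : a ∣ b) (hb : b = a * x + c) (hc : 0 < c) (ha : c < a) : False := by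
  have : a ∣ c := by
    have : c = b - a * x := by linarith
    rw [this]; exact dvd_sub h (dvd_mul_right _ _)
  have := Int.le_of_dvd hc this
  linarith

theorem no_dvd' {a b c x : ℤ} (h : a ∣ b) (hb : b = a * x - c) (hc : 0 < c) (ha : c < a) : False := by
  have : a ∣ c := by
    have : c = a * x - b := by linarith
    rw [this]; exact dvd_sub (dvd_mul_right _ _) h
  have := Int.le_of_dvd hc this
  linarith

/-- local trichotomy -/
theorem CC.loc [CharP F 2] (h : CC C W) (hP : P ∈ C) (hq : (2048 : ℤ) ≤ Nat.card F) (hT : TT C < 3 * Nat.card F - 135) :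
    TT C = 0 ∨
    (TT C = Nat.card F + 1 ∧ ∃ w ∈ Pl P W, tt C w = Nat.card F + 1 ∧ ∀ p ∈ Pl P W, p ≠ w → tt C p = 1) ∨
    (TT C = 2 * Nat.card F + 1 ∧ (((Pl P W).filter (fun p => tt C p = 1)).card : ℤ) = Nat.card F - 1) ∨
    (TT C = 2 * Nat.card F ∧ (((Pl P W).filter (fun p => tt C p = 1)).card : ℤ) = 2 * Nat.card F - 1 ∧
      (((Pl P W).filter (fun p => tt C p = 0)).card : ℤ) = 0) ∨
    (TT C = 2 * Nat.card F ∧ (((Pl P W).filter (fun p => tt C p = 0)).card : ℤ) = Nat.card F - 1 ∧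
      ∀ R ∈ C, ∃ p ∈ Pl R W, tt C p = 0) := by
  obtain ⟨w1, h1, w2, h2, hc⟩ := h.two_cover hP hq hT
  by_cases c1 : ∀ m ∈ SS C P W, m ≤ w1
  · rcases h.loc1 hP hq h1 c1 with h' | h'
    · left; exact h'
    · right; left; exact ⟨h'.1, w1, h1, h'.2⟩
  by_cases c2 : ∀ m ∈ SS C P W, m ≤ w2
  · rcases h.loc1 hP hq h2 c2 with h' | h'
    · left; exact h'
    · right; left; exact ⟨h'.1, w2, h2, h'.2⟩
  push Not at c1 c2
  obtain ⟨m2, hm2, n2⟩ := c1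
  obtain ⟨m1, hm1, n1⟩ := c2
  have hne : w1 ≠ w2 := by
    rintro rfl
    rcases hc m1 hm1 with h | h <;> exact n1 h
  right; right
  rcases h.loc2 hP hq h1 h2 hc hm1 hm2 n1 n2 with ⟨e, e1, e2⟩ | ⟨e, e12⟩ | ⟨e, e1, e2, hs⟩
  · left
    have := (h.count hP hq h1 h2 hc hne (by linarith) (by linarith)).1
    rw [e, e1, e2] at this
    exact ⟨e, this.trans (by ring)⟩
  · right; left
    refine ⟨e, ?_⟩
    rcases e12 with ⟨e1, e2⟩ | ⟨e1, e2⟩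
    · obtain ⟨a, b⟩ := h.count hP hq h1 h2 hc hne (by linarith) (by linarith)
      rw [e, e1, e2] at a b
      exact ⟨a.trans (by ring), by linarith⟩
    · obtain ⟨a, b⟩ := h.count hP hq h1 h2 hc hne (by linarith) (by linarith)
      rw [e, e1, e2] at a b
      exact ⟨a.trans (by ring), by linarith⟩
  · right; right
    refine ⟨e, ?_, ?_⟩
    · obtain ⟨a, b⟩ := h.count hP hq h1 h2 hc hne (by linarith) (by linarith)
      rw [e, e1, e2] at b
      linarith
    · have rP := h.cap.pt P hP
      have h1' := mem_Pl.1 h1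
      have h2' := mem_Pl.1 h2
      have rm := meet2 h.rkW h1'.2.2 h2'.2.2 h1'.2.1 h2'.2.1 hne
      have nm : nn C (w1 ⊓ w2) = 2 := by
        have a := h.cap.nn_le rm
        have b := nn_pos_mem hP (le_inf h1'.1 h2'.1)
        have c : nn C (w1 ⊓ w2) ≠ 1 := by
          intro h'
          apply hs
          rw [mem_SS rP]
          exact ⟨le_inf h1'.1 h2'.1, inf_le_left.trans h1'.2.1, rm, h'⟩
        omega
      have nw1 : nn C w1 = 2 := by
        unfold tt at e1
        have : (nn C w1 : ℤ) = 2 := by linarith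
        exact_mod_cast this
      have nw2 : nn C w2 = 2 := by
        unfold tt at e2
        have : (nn C w2 : ℤ) = 2 := by linarith
        exact_mod_cast this
      have key : ∀ R ∈ C, ¬ R ≤ w1 ⊓ w2 → (w1 ⊓ w2) ⊔ R ∈ Pl P W ∧ tt C ((w1 ⊓ w2) ⊔ R) = 0 := by
        intro R hR hRm
        have rR := h.cap.pt R hR
        have rp : rk ((w1 ⊓ w2) ⊔ R) = 3 := by rw [rk_sup_pt rR hRm, rm]
        have hp : (w1 ⊓ w2) ⊔ R ∈ Pl P W := by
          rw [mem_Pl]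
          exact ⟨(le_inf h1'.1 h2'.1).trans le_sup_left, sup_le (inf_le_left.trans h1'.2.1) (h.le R hR), rp⟩
        have big : 3 ≤ nn C ((w1 ⊓ w2) ⊔ R) := by
          have : (C.filter (· ≤ w1 ⊓ w2)) ⊂ C.filter (· ≤ (w1 ⊓ w2) ⊔ R) := by
            rw [Finset.ssubset_iff_of_subset]
            · refine ⟨R, ?_, ?_⟩
              · rw [Finset.mem_filter]; exact ⟨hR, le_sup_right⟩
              · rw [Finset.mem_filter]; exact fun x => hRm x.2
            · intro Q; simp only [Finset.mem_filter]; exact fun x => ⟨x.1, x.2.trans le_sup_left⟩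
          have := Finset.card_lt_card this
          change nn C _ < nn C _ at this
          omega
        refine ⟨hp, ?_⟩
        have d1 : (w1 ⊓ w2) ⊔ R ≠ w1 := by intro e; rw [e] at big; omega
        have d2 : (w1 ⊓ w2) ⊔ R ≠ w2 := by intro e; rw [e] at big; omega
        rw [← h.tS hP hp]
        norm_cast
        rw [Finset.card_eq_zero, Finset.filter_eq_empty_iff]
        intro m hm hle
        have hm' := (mem_SS rP).1 hm
        rw [mem_Pl] at hp
        have : m = w1 ⊓ w2 := by
          rcases hc m hm with h' | h'
          · have x1 := line_meet h.rkW hp.2.2 h1'.2.2 hp.2.1 h1'.2.1 d1 hm'.2.2.1 hle h'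
            have x2 := line_meet h.rkW hp.2.2 h1'.2.2 hp.2.1 h1'.2.1 d1 rm le_sup_left inf_le_left
            rw [x1, ← x2]
          · have x1 := line_meet h.rkW hp.2.2 h2'.2.2 hp.2.1 h2'.2.1 d2 hm'.2.2.1 hle h'
            have x2 := line_meet h.rkW hp.2.2 h2'.2.2 hp.2.1 h2'.2.1 d2 rm le_sup_left inf_le_right
            rw [x1, ← x2]
        rw [this] at hm
        exact hs hm
      intro R hR
      by_cases hRm : R ≤ w1 ⊓ w2
      · obtain ⟨R', hR', hn⟩ : ∃ R' ∈ C, ¬ R' ≤ w1 ⊓ w2 := by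
          by_contra! hall
          have : nn C (w1 ⊓ w2) = C.card := by unfold nn; rw [Finset.filter_true_of_mem hall]
          rw [nm] at this
          unfold TT at hT
          rw [← this] at hT
          push_cast at hT
          nlinarith
        obtain ⟨k1, k2⟩ := key R' hR' hn
        rw [mem_Pl] at k1
        exact ⟨_, mem_Pl.2 ⟨hRm.trans le_sup_left, k1.2⟩, k2⟩
      · obtain ⟨k1, k2⟩ := key R hR hRm
        rw [mem_Pl] at k1
        exact ⟨_, mem_Pl.2 ⟨le_sup_right, k1.2⟩, k2⟩

theorem CC.nonempty (h : CC C W) : C.Nonempty := by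
  have : 0 < (up ⊥ W).card := by
    have := card_up4 (F := F) (bot_le : (⊥ : Submodule F V) ≤ W) (by rw [rk_bot, h.rkW])
    have h2 : (0 : ℤ) < (up ⊥ W).card := by rw [this]; positivity
    exact_mod_cast h2
  obtain ⟨X, hX⟩ := Finset.card_pos.1 this
  rw [mem_up, rk_bot] at hX
  by_cases hXC : X ∈ C
  · exact ⟨X, hXC⟩
  · obtain ⟨P, hP, _⟩ := h.compl X hX.2.2 hX.2.1 hXC
    exact ⟨P, hP⟩

theorem CC.ovoid [CharP F 2] (h : CC C W) (hq : (2048 : ℤ) ≤ Nat.card F) (hT : TT C < 3 * Nat.card F - 135) :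
    TT C = Nat.card F + 1 ∧ ∀ P ∈ C, ∃ w ∈ Pl P W, tt C w = Nat.card F + 1 ∧ ∀ p ∈ Pl P W, p ≠ w → tt C p = 1 := by
  have hloc := fun P (hP : P ∈ C) => h.loc hP hq hT
  obtain ⟨P0, hP0⟩ := h.nonempty
  have hk : (C.card : ℤ) = (Nat.card F : ℤ)^2 + Nat.card F + 2 - TT C := by unfold TT; ring
  by_cases t0 : TT C = 0
  · exfalso
    have := h.dvd 0 ((Nat.card F : ℤ)^2 + Nat.card F + 1) (by
      intro P hP
      rw [← card_Pl (h.cap.pt P hP) h.rkW (h.le P hP), Finset.filter_true_of_mem]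
      intro p hp
      rw [← h.tS hP hp]
      have := h.cardS hP
      rw [t0] at this
      have : SS C P W = ∅ := by
        rw [← Finset.card_eq_zero]; exact_mod_cast this
      rw [this]; simp)
    rw [hk, t0] at this
    set q : ℤ := (Nat.card F : ℤ)
    exact no_dvd this (show _ = (q + 2 - 0) * (q^3+4*q-5) + 12 by ring) (by norm_num) (by linarith)
  by_cases t2 : TT C = 2 * Nat.card F + 1
  · exfalso
    have := h.dvd 1 ((Nat.card F : ℤ) - 1) (by
      intro P hP
      rcases hloc P hP with h | h | h | h | h
      · exact absurd h t0
      · linarith [h.1]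
      · exact h.2
      · linarith [h.1]
      · linarith [h.1])
    rw [hk, t2] at this
    set q : ℤ := (Nat.card F : ℤ)
    exact no_dvd' this (show _ = (q + 2 - 1) * (q^2-3*q+5) - 6 by ring) (by norm_num) (by linarith)
  by_cases t3 : TT C = 2 * Nat.card F
  · exfalso
    by_cases ex : ∃ P ∈ C, ∃ p ∈ Pl P W, tt C p = 0
    · have all : ∀ R ∈ C, ∃ p ∈ Pl R W, tt C p = 0 := by
        obtain ⟨P, hP, p, hp, hp0⟩ := ex
        rcases hloc P hP with h | h | h | h | h
        · exact absurd h t0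
        · linarith [h.1]
        · linarith [h.1]
        · exfalso
          have h0 : ((Pl P W).filter (fun p => tt C p = 0)).card = 0 := by exact_mod_cast h.2.2
          rw [Finset.card_eq_zero, Finset.filter_eq_empty_iff] at h0
          exact h0 hp hp0
        · exact h.2.2
      have := h.dvd 0 ((Nat.card F : ℤ) - 1) (by
        intro P hP
        rcases hloc P hP with h | h | h | h | h
        · exact absurd h t0
        · linarith [h.1]
        · linarith [h.1]
        · exfalso
          obtain ⟨p, hp, hp0⟩ := all P hP
          have h0 : ((Pl P W).filter (fun p => tt C p = 0)).card = 0 := by exact_mod_cast h.2.2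
          rw [Finset.card_eq_zero, Finset.filter_eq_empty_iff] at h0
          exact h0 hp hp0
        · exact h.2.1)
      rw [hk, t3] at this
      set q : ℤ := (Nat.card F : ℤ)
      exact no_dvd' this (show _ = (q + 2 - 0) * (q^2-4*q+11) - 24 by ring) (by norm_num) (by linarith)
    · have := h.dvd 1 (2 * (Nat.card F : ℤ) - 1) (by
        intro P hP
        rcases hloc P hP with h | h | h | h | h
        · exact absurd h t0
        · linarith [h.1]
        · linarith [h.1]
        · exact h.2.1
        · exact absurd ⟨P, hP, h.2.2 P hP⟩ ex)
      rw [hk, t3] at this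
      set q : ℤ := (Nat.card F : ℤ)
      exact no_dvd' this (show _ = (q + 2 - 1) * (2*q^2-5*q+10) - 12 by ring) (by norm_num) (by linarith)
  have fin : ∀ P ∈ C, TT C = Nat.card F + 1 ∧ ∃ w ∈ Pl P W, tt C w = Nat.card F + 1 ∧ ∀ p ∈ Pl P W, p ≠ w → tt C p = 1 := by
    intro P hP
    rcases hloc P hP with h | h | h | h | h
    · exact absurd h t0
    · exact h
    · exact absurd h.1 t2
    · exact absurd h.1 t3
    · exact absurd h.1 t3
  exact ⟨(fin P0 hP0).1, fun P hP => (fin P hP).2⟩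

end Helpers

section Helpers
set_option linter.all false
set_option linter.unusedSectionVars false
set_option linter.style.haveILetI false
open scoped Classical
variable {F : Type*} [Field F] [Finite F] {V : Type*} [AddCommGroup V] [Module F V] [Finite V]
variable {K : Finset (Submodule F V)}

theorem family_aux {α ι : Type*} (B : ι → Finset α) (J : Finset ι)
    (h2 : ∀ i ∈ J, ∀ j ∈ J, i ≠ j → (B i ∩ B j).card ≤ 2) :
    ∑ i ∈ J, (B i).card ≤ (J.biUnion B).card + J.card ^ 2 := by
  induction J using Finset.induction_on with
  | empty => simp
  | insert a J ha ih =>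
    have ih := ih (fun i hi j hj => h2 i (Finset.mem_insert_of_mem hi) j (Finset.mem_insert_of_mem hj))
    rw [Finset.sum_insert ha, Finset.biUnion_insert, Finset.card_insert_of_notMem ha]
    have e := Finset.card_union_add_card_inter (B a) (J.biUnion B)
    have e2 : (B a ∩ J.biUnion B).card ≤ 2 * J.card := by
      rw [Finset.inter_biUnion]
      refine Finset.card_biUnion_le.trans ?_
      rw [mul_comm, ← smul_eq_mul]
      apply Finset.sum_le_card_nsmul
      intro i hi
      exact h2 a (Finset.mem_insert_self _ _) i (Finset.mem_insert_of_mem hi) (by rintro rfl; exact ha hi)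
    nlinarith

theorem family {α ι : Type*} (B : ι → Finset α) (J : Finset ι) (M : Finset α) (q : ℕ)
    (hM : ∀ i ∈ J, B i ⊆ M) (hq : ∀ i ∈ J, q ≤ 2 * (B i).card)
    (h2 : ∀ i ∈ J, ∀ j ∈ J, i ≠ j → (B i ∩ B j).card ≤ 2) (hc : M.card < 2 * q) (hc2 : M.card + 136 < 2 * q) : J.card ≤ 4 := by
  by_contra hcon
  obtain ⟨J', hJ', hc'⟩ := Finset.exists_subset_card_eq (show 5 ≤ J.card by omega)
  have e := family_aux B J' (fun i hi j hj => h2 i (hJ' hi) j (hJ' hj))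
  have e1 : (J'.biUnion B).card ≤ M.card := Finset.card_le_card (by
    rw [Finset.biUnion_subset]; exact fun i hi => hM i (hJ' hi))
  have e2 : J'.card * q ≤ 2 * ∑ i ∈ J', (B i).card := by
    rw [Finset.mul_sum, ← smul_eq_mul]
    exact Finset.card_nsmul_le_sum _ _ _ (fun i hi => hq i (hJ' hi))
  rw [hc'] at e e2
  omega

/-- pairing lemma -/
theorem pair_lemma [CharP F 2] {A D : Finset (Submodule F V)} {p X : Submodule F V} (hA : Cap A) (hp : rk p = 3)
    (hAp : ∀ P ∈ A, P ≤ p) (hc : A.card = Nat.card F + 1) (hX : rk X = 1) (hXp : X ≤ p) (hXA : X ∉ A)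
    (hD : D ⊆ A) (hDX : ∀ P ∈ D, ∀ Q ∈ D, P ≠ Q → ¬ X ≤ P ⊔ Q) (hDc : Nat.card F + 2 < 2 * D.card) :
    ∀ P ∈ A, ∀ Q ∈ A, P ≠ Q → ¬ X ≤ P ⊔ Q := by
  intro P hP Q hQ hPQ hle
  have t := TL hp hA hAp hX hXp hP hQ hPQ hle
  have ex : ∀ P ∈ D \ tau A X, ∃ R, R ∈ A ∧ R ≠ P ∧ X ≤ P ⊔ R := by
    intro P hP
    rw [Finset.mem_sdiff, mem_tau] at hP
    by_contra! hcon
    exact hP.2 ⟨hD hP.1, fun Q hQ hne => hcon Q hQ hne⟩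
  choose! f hf using ex
  have c : (D \ tau A X).card ≤ (A \ D).card := by
    apply Finset.card_le_card_of_injOn f
    · intro P hP
      have h := hf P hP
      have hP : P ∈ D \ tau A X := hP
      rw [Finset.mem_sdiff] at hP
      simp only [Finset.coe_sdiff, Set.mem_diff, Finset.mem_coe]
      exact ⟨h.1, fun hfD => hDX P hP.1 (f P) hfD h.2.1.symm h.2.2⟩
    · intro P hP P' hP' e
      have h := hf P hP
      have h' := hf P' hP'
      have hP : P ∈ D \ tau A X := hP
      have hP' : P' ∈ D \ tau A X := hP'
      rw [Finset.mem_sdiff] at hP hP'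
      rw [← e] at h'
      by_contra hne
      have hXf : X ≠ f P := by rintro h2; exact hXA (h2 ▸ h.1)
      have e1 := exch (hA.pt _ h.1) (hA.pt _ (hD hP.1)) hX (by rw [sup_comm]; exact h.2.2) hXf
      have e2 := exch (hA.pt _ h.1) (hA.pt _ (hD hP'.1)) hX (by rw [sup_comm]; exact h'.2.2) hXf
      have : P' ≤ f P ⊔ P := by rw [e1, ← e2]; exact le_sup_right
      exact hA.cap (f P) h.1 P (hD hP.1) P' (hD hP'.1) h.2.1 h'.2.1 hne this
  have c2 := Finset.le_card_sdiff (tau A X) D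
  have c3 := Finset.card_sdiff_of_subset hD
  have c4 := Finset.card_le_card hD
  omega

theorem two_nuclei {A : Finset (Submodule F V)} {p X Y : Submodule F V} (hA : Cap A) (hp : rk p = 3)
    (hAp : ∀ P ∈ A, P ≤ p) (hc : A.card = Nat.card F + 1) (hX : rk X = 1) (hXp : X ≤ p) (hXA : X ∉ A)
    (hY : rk Y = 1) (hYp : Y ≤ p) (hYA : Y ∉ A) (hXY : X ≠ Y)
    (h1 : ∀ P ∈ A, ∀ Q ∈ A, P ≠ Q → ¬ X ≤ P ⊔ Q) (h2 : ∀ P ∈ A, ∀ Q ∈ A, P ≠ Q → ¬ Y ≤ P ⊔ Q) : False := by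
  have one : ∀ P ∈ A, (SS A P p).card = 1 := by
    intro P hP
    have := card_SS_plane hA hP (hAp P hP) hp
    have e : nn A p = Nat.card F + 1 := by unfold nn; rw [Finset.filter_true_of_mem hAp, hc]
    rw [e] at this
    push_cast at this
    have : ((SS A P p).card : ℤ) = 1 := by linarith
    exact_mod_cast this
  have tan : ∀ Z, rk Z = 1 → Z ≤ p → Z ∉ A → (∀ P ∈ A, ∀ Q ∈ A, P ≠ Q → ¬ Z ≤ P ⊔ Q) → ∀ P ∈ A, P ⊔ Z ∈ SS A P p := by
    intro Z hZ hZp hZA hb P hP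
    have rP := hA.pt P hP
    have hne : P ≠ Z := by rintro rfl; exact hZA hP
    rw [mem_SS rP]
    refine ⟨le_sup_left, sup_le (hAp P hP) hZp, rk_line rP hZ hne, ?_⟩
    apply le_antisymm
    · by_contra hcon
      obtain ⟨Q, hQ, hQP⟩ := Finset.exists_mem_ne (show 1 < (A.filter (· ≤ P ⊔ Z)).card by
        change 1 < nn A _; omega) P
      rw [Finset.mem_filter] at hQ
      have := exch rP hZ (hA.pt Q hQ.1) hQ.2 hQP
      exact hb P hP Q hQ.1 hQP.symm (this ▸ le_sup_right)
    · exact nn_pos_mem hP le_sup_left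
  have eqs : ∀ P ∈ A, P ≤ X ⊔ Y := by
    intro P hP
    have a := tan X hX hXp hXA h1 P hP
    have b := tan Y hY hYp hYA h2 P hP
    have e : P ⊔ X = P ⊔ Y := Finset.card_le_one.1 (one P hP).le _ a _ b
    have : Y ≤ P ⊔ X := e ▸ le_sup_right
    have hne : P ≠ X := by rintro rfl; exact hXA hP
    have := eq_line hX hY hXY (le_sup_right : X ≤ P ⊔ X) this (rk_line (hA.pt P hP) hX hne)
    rw [← this]; exact le_sup_left
  obtain ⟨P, hP, Q, hQ, hPQ⟩ := Finset.one_lt_card.1 (show 1 < A.card by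
    have : 1 < Nat.card F := Finite.one_lt_card
    omega)
  have := eq_line (hA.pt P hP) (hA.pt Q hQ) hPQ (eqs P hP) (eqs Q hQ) (rk_line hX hY hXY)
  exact h1 P hP Q hQ hPQ (this ▸ le_sup_left)

/-- the threshold -/
noncomputable def thr (F : Type*) : ℤ := (Nat.card F : ℤ)^2 - 2 * Nat.card F + 137

structure Ovo (K : Finset (Submodule F V)) (S : Submodule F V) (O : Finset (Submodule F V)) : Prop where
  cc : CC O S
  tq : TT O = Nat.card F + 1
  pl : ∀ P ∈ O, ∃ w ∈ Pl P S, tt O w = Nat.card F + 1 ∧ ∀ p ∈ Pl P S, p ≠ w → tt O p = 1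
  sub : ∀ P ∈ K, P ≤ S → P ∈ O
  big : thr F < nn K S

theorem exists_complete (hK : Cap K) {S : Submodule F V} (hS : rk S = 4) : ∃ O, CC O S ∧ ∀ P ∈ K, P ≤ S → P ∈ O := by
  set U := (Finset.univ : Finset (Finset (Submodule F V))).filter
    (fun O => Cap O ∧ (∀ P ∈ O, P ≤ S) ∧ ∀ P ∈ K, P ≤ S → P ∈ O) with hU
  have hne : U.Nonempty := ⟨K.filter (· ≤ S), by
    simp only [hU, Finset.mem_filter, Finset.mem_univ, true_and]
    refine ⟨hK.filter _, fun P hP => ?_, fun P h1 h2 => ?_⟩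
    · exact hP.2
    · exact ⟨h1, h2⟩⟩
  obtain ⟨O, hO, hmax⟩ := Finset.exists_max_image U Finset.card hne
  simp only [hU, Finset.mem_filter, Finset.mem_univ, true_and] at hO hmax
  refine ⟨O, ⟨hS, hO.1, hO.2.1, ?_⟩, hO.2.2⟩
  intro X hX hXS hXO
  by_contra! hcon
  have hcap : Cap (insert X O) := by
    constructor
    · intro P hP
      rcases Finset.mem_insert.1 hP with rfl | hP
      · exact hX
      · exact hO.1.pt P hP
    · have kk : ∀ P ∈ O, ∀ R ∈ O, P ≠ R → ¬ R ≤ P ⊔ X := by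
        intro P hP R hR hne hle
        have := exch (hO.1.pt P hP) hX (hO.1.pt R hR) hle hne.symm
        exact hcon P hP R hR hne (this ▸ le_sup_right)
      intro P hP Q hQ R hR n1 n2 n3 hle
      rcases Finset.mem_insert.1 hP with hP1 | hP1
      · rw [hP1] at n1 n2 hle
        have hQ1 := (Finset.mem_insert.1 hQ).resolve_left n1.symm
        have hR1 := (Finset.mem_insert.1 hR).resolve_left n2.symm
        exact kk Q hQ1 R hR1 n3 (by rw [sup_comm]; exact hle)
      · rcases Finset.mem_insert.1 hQ with hQ1 | hQ1
        · rw [hQ1] at n3 hle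
          have hR1 := (Finset.mem_insert.1 hR).resolve_left n3.symm
          exact kk P hP1 R hR1 n2 hle
        · rcases Finset.mem_insert.1 hR with hR1 | hR1
          · rw [hR1] at hle
            exact hcon P hP1 Q hQ1 n1 hle
          · exact hO.1.cap P hP1 Q hQ1 R hR1 n1 n2 n3 hle
  have := hmax (insert X O) ⟨hcap, fun P hP => by
    rcases Finset.mem_insert.1 hP with rfl | hP
    · exact hXS
    · exact hO.2.1 P hP, fun P h1 h2 => Finset.mem_insert_of_mem (hO.2.2 P h1 h2)⟩
  rw [Finset.card_insert_of_notMem hXO] at this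
  omega

theorem exists_ovo [CharP F 2] (hK : Cap K) (hq : (2048 : ℤ) ≤ Nat.card F) {S : Submodule F V} (hS : rk S = 4)
    (hb : thr F < nn K S) : ∃ O, Ovo K S O := by
  obtain ⟨O, h, hs⟩ := exists_complete hK hS
  have : nn K S ≤ O.card := by
    apply Finset.card_le_card
    intro P hP
    rw [Finset.mem_filter] at hP
    exact hs P hP.1 hP.2
  have : (nn K S : ℤ) ≤ O.card := by exact_mod_cast this
  have hT : TT O < 3 * Nat.card F - 135 := by
    unfold TT; unfold thr at hb; linarith
  obtain ⟨a, b⟩ := h.ovoid hq hT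
  exact ⟨O, h, a, b, hs, hb⟩

section ovo
variable {S : Submodule F V} {O : Finset (Submodule F V)}

theorem Ovo.card (h : Ovo K S O) : (O.card : ℤ) = (Nat.card F : ℤ)^2 + 1 := by
  have := h.tq
  unfold TT at this
  linarith

theorem Ovo.filt (h : Ovo K S O) {p : Submodule F V} (hp : p ≤ S) : K.filter (· ≤ p) ⊆ O.filter (· ≤ p) := by
  intro P
  simp only [Finset.mem_filter]
  exact fun x => ⟨h.sub P x.1 (x.2.trans hp), x.2⟩

theorem Ovo.nle (h : Ovo K S O) {p : Submodule F V} (hp : p ≤ S) : nn K p ≤ nn O p := Finset.card_le_card (h.filt hp)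

theorem Ovo.le (h : Ovo K S O) : (nn K S : ℤ) ≤ (Nat.card F : ℤ)^2 + 1 := by
  rw [← h.card, ← h.cc.nnW]
  exact_mod_cast h.nle le_rfl

theorem Ovo.miss (h : Ovo K S O) : (O \ K).card + 136 < 2 * Nat.card F := by
  have e : (O \ K).card + nn K S ≤ O.card := by
    unfold nn
    rw [← Finset.card_union_of_disjoint]
    · apply Finset.card_le_card
      intro P
      simp only [Finset.mem_union, Finset.mem_sdiff, Finset.mem_filter]
      rintro (h1 | h1)
      · exact h1.1
      · exact h.sub P h1.1 h1.2
    · rw [Finset.disjoint_left]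
      intro P
      simp only [Finset.mem_sdiff, Finset.mem_filter]
      exact fun a b => a.2 b.1
  have e' : ((O \ K).card : ℤ) + nn K S ≤ O.card := by exact_mod_cast e
  have b := h.big
  rw [h.card] at e'
  unfold thr at b
  have : ((O \ K).card : ℤ) + 136 < 2 * Nat.card F := by linarith
  exact_mod_cast this

theorem Ovo.plane (h : Ovo K S O) {p P Q : Submodule F V} (hp : rk p = 3) (hpS : p ≤ S) (hP : P ∈ O) (hQ : Q ∈ O)
    (hPp : P ≤ p) (hQp : Q ≤ p) (hne : P ≠ Q) : nn O p = Nat.card F + 1 := by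
  obtain ⟨w, hw, ht, hall⟩ := h.pl P hP
  have h2 := nn_two hP hPp hQ hQp hne
  have : tt O p = 1 := by
    apply hall p (mem_Pl.2 ⟨hPp, hpS, hp⟩)
    rintro rfl
    unfold tt at ht
    have : (2 : ℤ) ≤ nn O p := by exact_mod_cast h2
    linarith
  unfold tt at this
  have : (nn O p : ℤ) = Nat.card F + 1 := by linarith
  exact_mod_cast this

theorem Ovo.plane' (h : Ovo K S O) {p : Submodule F V} (hp : rk p = 3) (hpS : p ≤ S) (h2 : 2 ≤ nn K p) :
    nn O p = Nat.card F + 1 := by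
  obtain ⟨P, hP, Q, hQ, hne⟩ := Finset.one_lt_card.1 (show 1 < (K.filter (· ≤ p)).card from h2)
  have hP := Finset.mem_filter.1 (h.filt hpS hP)
  have hQ := Finset.mem_filter.1 (h.filt hpS hQ)
  exact h.plane hp hpS hP.1 hQ.1 hP.2 hQ.2 hne

theorem Ovo.fam (h : Ovo K S O) (J : Finset (Submodule F V)) (hJ : ∀ p ∈ J, p ≤ S ∧ rk p = 3 ∧ nn O p = Nat.card F + 1 ∧
    2 * nn K p ≤ Nat.card F + 2) : J.card ≤ 4 := by
  have hm := h.miss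
  apply family (fun p => O.filter (· ≤ p) \ K) J (O \ K) (Nat.card F) ?_ ?_ ?_ (by omega) (by omega)
  · intro p hp P
    simp only [Finset.mem_sdiff, Finset.mem_filter]
    exact fun x => ⟨x.1.1, x.2⟩
  · intro p hp
    obtain ⟨h1, h2, h3, h4⟩ := hJ p hp
    have : O.filter (· ≤ p) \ K = O.filter (· ≤ p) \ K.filter (· ≤ p) := by
      ext P; simp only [Finset.mem_sdiff, Finset.mem_filter]; tauto
    rw [this, Finset.card_sdiff_of_subset (h.filt h1)]
    change _ ≤ 2 * (nn O p - nn K p)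
    omega
  · intro p hp p' hp' hne
    obtain ⟨h1, h2, _, _⟩ := hJ p hp
    obtain ⟨h1', h2', _, _⟩ := hJ p' hp'
    have r := meet2 h.cc.rkW h2 h2' h1 h1' hne
    refine le_trans (Finset.card_le_card ?_) (h.cc.cap.nn_le r)
    intro P
    simp only [Finset.mem_inter, Finset.mem_sdiff, Finset.mem_filter]
    exact fun x => ⟨x.1.1.1, le_inf x.1.1.2 x.2.1.2⟩

theorem Ovo.tau_plane (h : Ovo K S O) {p X : Submodule F V} (hX : rk X = 1) (hXp : X ≤ p) (hXO : X ∉ O)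
    (hb : ∀ P ∈ O.filter (· ≤ p), ∀ Q ∈ O.filter (· ≤ p), P ≠ Q → ¬ X ≤ P ⊔ Q) : O.filter (· ≤ p) ⊆ tau O X := by
  intro P hP
  have hP' := Finset.mem_filter.1 hP
  rw [mem_tau]
  refine ⟨hP'.1, fun Q hQ hne hle => ?_⟩
  have := exch (h.cc.cap.pt P hP'.1) (h.cc.cap.pt Q hQ) hX hle (by rintro rfl; exact hXO hP'.1)
  have : Q ≤ p := le_sup_right.trans (this.le.trans (sup_le hP'.2 hXp))
  exact hb P hP Q (Finset.mem_filter.2 ⟨hQ, this⟩) hne.symm hle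

theorem Ovo.tau_two [CharP F 2] (h : Ovo K S O) {p p' X : Submodule F V} (hX : rk X = 1) (hXp : X ≤ p) (hXp' : X ≤ p') (hXO : X ∉ O)
    (hpS : p ≤ S) (hpS' : p' ≤ S) (rp : rk p = 3) (rp' : rk p' = 3) (hne : p ≠ p')
    (n1 : nn O p = Nat.card F + 1) (n2 : nn O p' = Nat.card F + 1)
    (hb : ∀ P ∈ O.filter (· ≤ p), ∀ Q ∈ O.filter (· ≤ p), P ≠ Q → ¬ X ≤ P ⊔ Q)
    (hb' : ∀ P ∈ O.filter (· ≤ p'), ∀ Q ∈ O.filter (· ≤ p'), P ≠ Q → ¬ X ≤ P ⊔ Q) (hq : (2048 : ℤ) ≤ Nat.card F) : False := by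
  have a := h.cc.a3 hX (hXp.trans hpS) hXO
  rw [h.tq] at a
  have b : ((O.filter (· ≤ p)) ∪ (O.filter (· ≤ p'))).card ≤ (tau O X).card :=
    Finset.card_le_card (Finset.union_subset (h.tau_plane hX hXp hXO hb) (h.tau_plane hX hXp' hXO hb'))
  have c := Finset.card_union_add_card_inter (O.filter (· ≤ p)) (O.filter (· ≤ p'))
  have d : ((O.filter (· ≤ p)) ∩ (O.filter (· ≤ p'))).card ≤ 2 := by
    have r := meet2 h.cc.rkW rp rp' hpS hpS' hne
    refine le_trans (Finset.card_le_card ?_) (h.cc.cap.nn_le r)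
    intro P
    simp only [Finset.mem_inter, Finset.mem_filter]
    exact fun x => ⟨x.1.1, le_inf x.1.2 x.2.2⟩
  have e1 : (O.filter (· ≤ p)).card = Nat.card F + 1 := n1
  have e2 : (O.filter (· ≤ p')).card = Nat.card F + 1 := n2
  have a' : (tau O X).card ≤ Nat.card F + 1 := by exact_mod_cast a
  have hq' : 2048 ≤ Nat.card F := by exact_mod_cast hq
  omega

end ovo
end Helpers

section Helpers
set_option linter.all false
set_option linter.unusedSectionVars false
set_option linter.style.haveILetI false
open scoped Classical
variable {F : Type*} [Field F] [Finite F] {V : Type*} [AddCommGroup V] [Module F V] [Finite V]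
variable {K : Finset (Submodule F V)}

structure Big (K : Finset (Submodule F V)) : Prop where
  top : rk (⊤ : Submodule F V) = 5
  cap : Cap K
  compl : ∀ X, rk X = 1 → X ∉ K → ∃ P ∈ K, ∃ Q ∈ K, P ≠ Q ∧ X ≤ P ⊔ Q
  card : ((Nat.card F : ℤ) - 3) * thr F + 3 * (Nat.card F : ℤ)^2 ≤ K.card
  hq : (2048 : ℤ) ≤ Nat.card F

/-- ovoidal solids on `A` -/
noncomputable def Ov (K : Finset (Submodule F V)) (A : Submodule F V) : Finset (Submodule F V) :=
  Finset.univ.filter (fun Z => A ≤ Z ∧ rk Z = 4 ∧ thr F < nn K Z)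

theorem mem_Ov {A Z : Submodule F V} : Z ∈ Ov K A ↔ A ≤ Z ∧ rk Z = 4 ∧ thr F < nn K Z := by simp [Ov]

theorem Big.nn_top (h : Big K) : nn K ⊤ = K.card := by
  unfold nn; rw [Finset.filter_true_of_mem (fun _ _ => le_top)]

theorem Big.bd [CharP F 2] (h : Big K) {A Z : Submodule F V} (hA : A ≤ Z) (hZ : rk Z = 4) :
    (nn K Z : ℤ) ≤ thr F + if Z ∈ Ov K A then 2 * (Nat.card F : ℤ) - 136 else 0 := by
  split_ifs with hJ
  · rw [mem_Ov] at hJ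
    obtain ⟨O, hO⟩ := exists_ovo h.cap h.hq hZ hJ.2.2
    have := hO.le
    unfold thr; linarith
  · rw [mem_Ov] at hJ
    by_contra hcon
    exact hJ ⟨hA, hZ, by linarith⟩

theorem Big.solids [CharP F 2] (h : Big K) {l : Submodule F V} (hl : rk l = 2) (h2 : nn K l = 2) :
    12 ≤ (Ov K l).card := by
  have hq := h.hq
  have hc := h.card
  have s1 := sum_up K h.cap.pt (le_top : l ≤ ⊤)
  have c1 := card_up3 (le_top : l ≤ ⊤) (by rw [hl, h.top])
  rw [h2, h.nn_top, Finset.sum_sub_distrib, Finset.sum_const, nsmul_eq_mul, c1] at s1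
  have s2 : ∀ p ∈ up l ⊤, ∑ Z ∈ up p ⊤, (nn K Z : ℤ) = K.card + Nat.card F * nn K p := by
    intro p hp
    rw [mem_up, hl] at hp
    have := sum_up K h.cap.pt (le_top : p ≤ ⊤)
    rw [h.nn_top, Finset.sum_sub_distrib, Finset.sum_const, nsmul_eq_mul,
      card_up2 le_top (by rw [hp.2.2, h.top])] at this
    linarith
  have s3 : ∑ p ∈ up l ⊤, ∑ Z ∈ up p ⊤, (nn K Z : ℤ) ≤
      ∑ p ∈ up l ⊤, ∑ Z ∈ up p ⊤, (thr F + if Z ∈ Ov K l then 2 * (Nat.card F : ℤ) - 136 else 0) := by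
    refine Finset.sum_le_sum fun p hp => Finset.sum_le_sum fun Z hZ => ?_
    rw [mem_up] at hp hZ
    exact h.bd (hp.1.trans hZ.1) (by omega)
  have s4 : ∑ p ∈ up l ⊤, ∑ Z ∈ up p ⊤, (if Z ∈ Ov K l then 2 * (Nat.card F : ℤ) - 136 else 0) =
      (Ov K l).card * ((Nat.card F + 1) * (2 * (Nat.card F : ℤ) - 136)) := by
    have e1 : ∀ p ∈ up l ⊤, ∑ Z ∈ up p ⊤, (if Z ∈ Ov K l then 2 * (Nat.card F : ℤ) - 136 else 0) =
      ∑ Z ∈ (up p ⊤).filter (· ∈ Ov K l), (2 * (Nat.card F : ℤ) - 136) := by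
      intro p hp; rw [Finset.sum_filter]
    rw [Finset.sum_congr rfl e1]
    have e2 : ∑ p ∈ up l ⊤, ∑ Z ∈ (up p ⊤).filter (· ∈ Ov K l), (2 * (Nat.card F : ℤ) - 136) =
        ∑ Z ∈ Ov K l, ∑ p ∈ up l Z, (2 * (Nat.card F : ℤ) - 136) := by
      apply Finset.sum_comm'
      intro p Z
      simp only [Finset.mem_filter, mem_up, mem_Ov]
      constructor
      · rintro ⟨a, b, c⟩
        exact ⟨⟨a.1, b.1, a.2.2⟩, c⟩
      · rintro ⟨a, c⟩
        exact ⟨⟨a.1, le_top, a.2.2⟩, ⟨a.2.1, le_top, by omega⟩, c⟩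
    rw [e2]
    have e3 : ∀ Z ∈ Ov K l, ∑ p ∈ up l Z, (2 * (Nat.card F : ℤ) - 136) = (Nat.card F + 1) * (2 * (Nat.card F : ℤ) - 136) := by
      intro Z hZ
      rw [mem_Ov] at hZ
      rw [Finset.sum_const, nsmul_eq_mul, card_up2 hZ.1 (by rw [hZ.2.1, hl])]
    rw [Finset.sum_congr rfl e3, Finset.sum_const, nsmul_eq_mul]
  have s5 : ∑ p ∈ up l ⊤, ∑ Z ∈ up p ⊤, thr F = ((Nat.card F : ℤ)^2 + Nat.card F + 1) * ((Nat.card F + 1) * thr F) := by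
    have : ∀ p ∈ up l ⊤, ∑ Z ∈ up p ⊤, thr F = (Nat.card F + 1) * thr F := by
      intro p hp
      rw [mem_up, hl] at hp
      rw [Finset.sum_const, nsmul_eq_mul, card_up2 le_top (by rw [hp.2.2, h.top])]
    rw [Finset.sum_congr rfl this, Finset.sum_const, nsmul_eq_mul, c1]
  simp_rw [Finset.sum_add_distrib] at s3
  rw [s4, s5, Finset.sum_congr rfl s2, Finset.sum_add_distrib, ← Finset.mul_sum, Finset.sum_const, nsmul_eq_mul, c1] at s3
  generalize hS : ∑ p ∈ up l ⊤, (nn K p : ℤ) = S at s1 s3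
  by_contra hcon
  have hcon : ((Ov K l).card : ℤ) ≤ 11 := by exact_mod_cast (by omega : (Ov K l).card ≤ 11)
  generalize ((Ov K l).card : ℤ) = j at *
  generalize (K.card : ℤ) = k at *
  unfold thr at *
  generalize (Nat.card F : ℤ) = q at *
  have hS : S = k - 2 + 2 * (q^2 + q + 1) := by push_cast at s1; linarith
  subst hS
  have f : (q+1) * ((q+1) * (k - 2) + 2 * (q^2+q+1)) ≤ (q+1) * ((q^2+q+1) * (q^2-2*q+137) + j * (2*q-136)) := by linarith
  have f := le_of_mul_le_mul_left f (by linarith)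
  have g : j * (2*q-136) ≤ 11 * (2*q-136) := mul_le_mul_of_nonneg_right hcon (by linarith)
  have g2 : (q+1) * ((q - 3) * (q ^ 2 - 2 * q + 137) + 3 * q ^ 2) ≤ (q+1) * k := mul_le_mul_of_nonneg_left hc (by linarith)
  nlinarith

theorem Big.plane_ov [CharP F 2] (h : Big K) {p : Submodule F V} (hp : rk p = 3) (hn : Nat.card F ≤ nn K p) :
    3 ≤ (Ov K p).card ∧ (nn K p = Nat.card F + 1 → 5 ≤ (Ov K p).card) := by
  have hq := h.hq
  have hc := h.card
  have s := sum_up K h.cap.pt (le_top : p ≤ ⊤)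
  have c1 := card_up2 (le_top : p ≤ ⊤) (by rw [hp, h.top])
  rw [h.nn_top, Finset.sum_sub_distrib, Finset.sum_const, nsmul_eq_mul, c1] at s
  have s3 : ∑ Z ∈ up p ⊤, (nn K Z : ℤ) ≤ ∑ Z ∈ up p ⊤, (thr F + if Z ∈ Ov K p then 2 * (Nat.card F : ℤ) - 136 else 0) := by
    refine Finset.sum_le_sum fun Z hZ => ?_
    rw [mem_up] at hZ
    exact h.bd hZ.1 (by omega)
  have e : (up p ⊤).filter (· ∈ Ov K p) = Ov K p := by
    ext Z
    simp only [Finset.mem_filter, mem_up, mem_Ov]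
    exact ⟨fun x => x.2, fun x => ⟨⟨x.1, le_top, by omega⟩, x⟩⟩
  rw [Finset.sum_add_distrib, ← Finset.sum_filter, e, Finset.sum_const, Finset.sum_const, nsmul_eq_mul, nsmul_eq_mul, c1] at s3
  have hn' : (Nat.card F : ℤ) ≤ nn K p := by exact_mod_cast hn
  constructor
  · by_contra hcon
    have hcon : ((Ov K p).card : ℤ) ≤ 2 := by exact_mod_cast (by omega : (Ov K p).card ≤ 2)
    generalize ((Ov K p).card : ℤ) = j at *
    unfold thr at *
    generalize (Nat.card F : ℤ) = q at *
    have g : j * (2*q-136) ≤ 2 * (2*q-136) := mul_le_mul_of_nonneg_right hcon (by linarith)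
    nlinarith
  · intro hn2
    by_contra hcon
    have hcon : ((Ov K p).card : ℤ) ≤ 4 := by exact_mod_cast (by omega : (Ov K p).card ≤ 4)
    have hn2 : (nn K p : ℤ) = Nat.card F + 1 := by exact_mod_cast hn2
    rw [hn2] at s
    generalize ((Ov K p).card : ℤ) = j at *
    unfold thr at *
    generalize (Nat.card F : ℤ) = q at *
    have g : j * (2*q-136) ≤ 4 * (2*q-136) := mul_le_mul_of_nonneg_right hcon (by linarith)
    nlinarith
end Helpers

section Helpers
set_option linter.all false
set_option linter.unusedSectionVars false
set_option linter.style.haveILetI false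
open scoped Classical
variable {F : Type*} [Field F] [Finite F] {V : Type*} [AddCommGroup V] [Module F V] [Finite V]
variable {K : Finset (Submodule F V)}

theorem meet3 (ht : rk (⊤ : Submodule F V) = 5) {Z S : Submodule F V} (hZ : rk Z = 4) (hS : rk S = 4)
    (hne : Z ≠ S) : rk (Z ⊓ S) = 3 := by
  have e := rk_sup_inf Z S
  have e1 : rk (Z ⊔ S) ≤ 5 := ht ▸ rk_mono le_top
  have e2 : Z < Z ⊔ S := by
    refine lt_of_le_of_ne le_sup_left fun e => ?_
    exact hne (eq_of_rk (e ▸ le_sup_right : S ≤ Z) (by omega)).symm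
  have := rk_lt e2
  omega

/-- a point of `O` not in `K` is on no bisecant of `K` in the solid -/
theorem Ovo.nbis {S : Submodule F V} {O : Finset (Submodule F V)} (h : Ovo K S O) {X B B' : Submodule F V}
    (hXO : X ∈ O) (hXK : X ∉ K) (hB : B ∈ K) (hB' : B' ∈ K) (hBB : B ≠ B') (hX : X ≤ B ⊔ B') (h1 : B ≤ S) (h2 : B' ≤ S) :
    False :=
  h.cc.cap.cap B (h.sub B hB h1) B' (h.sub B' hB' h2) X hXO hBB (by rintro rfl; exact hXK hB)
    (by rintro rfl; exact hXK hB') hX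

theorem join_meet (ht : rk (⊤ : Submodule F V) = 5) {l Z S : Submodule F V} (hl : l ≤ Z) (hlS : ¬ l ≤ S) (hZ : rk Z = 4)
    (hS : rk S = 4) : Z = l ⊔ (Z ⊓ S) := by
  have hne : Z ≠ S := by rintro rfl; exact hlS hl
  have r := meet3 ht hZ hS hne
  symm
  refine eq_of_rk (sup_le hl inf_le_left) ?_
  have : Z ⊓ S < l ⊔ (Z ⊓ S) := by
    refine lt_of_le_of_ne le_sup_right fun e => hlS ?_
    calc l ≤ l ⊔ (Z ⊓ S) := le_sup_left
      _ = Z ⊓ S := e.symm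
      _ ≤ S := inf_le_right
  have := rk_lt this
  omega

theorem Big.bad1 [CharP F 2] (h : Big K) {S l X : Submodule F V} {O : Finset (Submodule F V)} (hO : Ovo K S O)
    (hXO : X ∈ O) (hXl : X ≤ l) (hlS : ¬ l ≤ S) :
    ((Ov K l).filter (fun Z => 2 * nn K (Z ⊓ S) ≤ Nat.card F + 2)).card ≤ 5 := by
  obtain ⟨w, hw, ht, hall⟩ := hO.pl X hXO
  set J := (Ov K l).filter (fun Z => 2 * nn K (Z ⊓ S) ≤ Nat.card F + 2) with hJ
  have inj : Set.InjOn (fun Z => Z ⊓ S) (J : Set (Submodule F V)) := by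
    intro Z hZ Z' hZ' e
    simp only [hJ, Finset.mem_coe, Finset.mem_filter, mem_Ov] at hZ hZ'
    rw [join_meet h.top hZ.1.1 hlS hZ.1.2.1 hO.cc.rkW, join_meet h.top hZ'.1.1 hlS hZ'.1.2.1 hO.cc.rkW]
    exact congrArg (l ⊔ ·) e
  have c := Finset.card_image_of_injOn inj
  have f := hO.fam ((J.image (fun Z => Z ⊓ S)).erase w) (by
    intro p hp
    rw [Finset.mem_erase, Finset.mem_image] at hp
    obtain ⟨hpw, Z, hZ, rfl⟩ := hp
    simp only [hJ, Finset.mem_filter, mem_Ov] at hZ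
    have r := meet3 h.top hZ.1.2.1 hO.cc.rkW (by rintro rfl; exact hlS hZ.1.1)
    refine ⟨inf_le_right, r, ?_, hZ.2⟩
    have := hall (Z ⊓ S) (mem_Pl.2 ⟨le_inf (hXl.trans hZ.1.1) (hO.cc.le X hXO), inf_le_right, r⟩) hpw
    unfold tt at this
    have : (nn O (Z ⊓ S) : ℤ) = Nat.card F + 1 := by linarith
    exact_mod_cast this)
  have := Finset.pred_card_le_card_erase (s := J.image (fun Z => Z ⊓ S)) (a := w)
  omega

/-- the second part: pairing in a plane -/
theorem Big.nuc [CharP F 2] (h : Big K) {S Z p X : Submodule F V} {O O' : Finset (Submodule F V)} (hO : Ovo K S O)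
    (hO' : Ovo K Z O') (hpS : p ≤ S) (hpZ : p ≤ Z) (hp : rk p = 3) (hn : Nat.card F + 2 < 2 * nn K p)
    (hX : rk X = 1) (hXp : X ≤ p) (hXO : X ∈ O) (hXK : X ∉ K) (hXO' : X ∉ O') :
    ∀ P ∈ O'.filter (· ≤ p), ∀ Q ∈ O'.filter (· ≤ p), P ≠ Q → ¬ X ≤ P ⊔ Q := by
  have n2 := hO'.plane' hp hpZ (by omega)
  refine pair_lemma (D := K.filter (· ≤ p)) (hO'.cc.cap.filter _) hp ?_ n2 hX hXp ?_ (hO'.filt hpZ) ?_ hn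
  · intro P hP; exact (Finset.mem_filter.1 hP).2
  · intro hc; exact hXO' (Finset.mem_filter.1 hc).1
  · intro P hP Q hQ hPQ hle
    rw [Finset.mem_filter] at hP hQ
    exact hO.nbis hXO hXK hP.1 hQ.1 hPQ hle (hP.2.trans hpS) (hQ.2.trans hpS)

theorem Big.prin [CharP F 2] (h : Big K) {S S' X : Submodule F V} {O O' : Finset (Submodule F V)} (hO : Ovo K S O)
    (hO' : Ovo K S' O') (hne : S ≠ S') (hX : rk X = 1) (hXK : X ∉ K) (hXO : X ∈ O) (hXO' : X ∈ O') : False := by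
  obtain ⟨B, hB, B', hB', hBB, hXB⟩ := h.compl X hX hXK
  set l := B ⊔ B' with hl
  have rl : rk l = 2 := rk_line (h.cap.pt B hB) (h.cap.pt B' hB') hBB
  have nl := h.cap.nn_bis hB hB' hBB
  have key : ∀ {T : Submodule F V} {M : Finset (Submodule F V)}, Ovo K T M → X ∈ M → ¬ l ≤ T := by
    intro T M hM hXM hle
    exact hM.nbis hXM hXK hB hB' hBB hXB (le_sup_left.trans hle) (le_sup_right.trans hle)
  have hlS := key hO hXO
  have hlS' := key hO' hXO'
  have c := h.solids rl nl
  have c1 := h.bad1 hO hXO hXB hlS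
  have c2 := h.bad1 hO' hXO' hXB hlS'
  have c3 : ((Ov K l).filter (fun Z => Z ⊓ S = Z ⊓ S')).card ≤ 1 := by
    have : ∀ Z ∈ (Ov K l).filter (fun Z => Z ⊓ S = Z ⊓ S'), Z = l ⊔ (S ⊓ S') := by
      intro Z hZ
      rw [Finset.mem_filter, mem_Ov] at hZ
      have r := meet3 h.top hZ.1.2.1 hO.cc.rkW (by rintro rfl; exact hlS hZ.1.1)
      have r' := meet3 h.top hO.cc.rkW hO'.cc.rkW hne
      have e : Z ⊓ S = S ⊓ S' := eq_of_rk (le_inf inf_le_right (hZ.2 ▸ inf_le_right)) (by omega)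
      rw [← e]
      exact join_meet h.top hZ.1.1 hlS hZ.1.2.1 hO.cc.rkW
    rw [Finset.card_le_one]
    intro a ha b hb
    rw [this a ha, this b hb]
  have ex : ∃ Z ∈ Ov K l, Nat.card F + 2 < 2 * nn K (Z ⊓ S) ∧ Nat.card F + 2 < 2 * nn K (Z ⊓ S') ∧ Z ⊓ S ≠ Z ⊓ S' := by
    by_contra! hcon
    have sub : Ov K l ⊆ ((Ov K l).filter (fun Z => 2 * nn K (Z ⊓ S) ≤ Nat.card F + 2) ∪
        (Ov K l).filter (fun Z => 2 * nn K (Z ⊓ S') ≤ Nat.card F + 2)) ∪ (Ov K l).filter (fun Z => Z ⊓ S = Z ⊓ S') := by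
      intro Z hZ
      simp only [Finset.mem_union, Finset.mem_filter, hZ, true_and]
      by_contra! h3
      exact h3.2 (hcon Z hZ h3.1.1 h3.1.2)
    have := Finset.card_le_card sub
    have := Finset.card_union_le ((Ov K l).filter (fun Z => 2 * nn K (Z ⊓ S) ≤ Nat.card F + 2) ∪
        (Ov K l).filter (fun Z => 2 * nn K (Z ⊓ S') ≤ Nat.card F + 2)) ((Ov K l).filter (fun Z => Z ⊓ S = Z ⊓ S'))
    have := Finset.card_union_le ((Ov K l).filter (fun Z => 2 * nn K (Z ⊓ S) ≤ Nat.card F + 2))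
        ((Ov K l).filter (fun Z => 2 * nn K (Z ⊓ S') ≤ Nat.card F + 2))
    omega
  obtain ⟨Z, hZ, n1, n2, hpp⟩ := ex
  rw [mem_Ov] at hZ
  obtain ⟨M, hM⟩ := exists_ovo h.cap h.hq hZ.2.1 hZ.2.2
  have hXM : X ∉ M := fun hc => key hM hc hZ.1
  have r := meet3 h.top hZ.2.1 hO.cc.rkW (by rintro rfl; exact hlS hZ.1)
  have r' := meet3 h.top hZ.2.1 hO'.cc.rkW (by rintro rfl; exact hlS' hZ.1)
  have hXp : X ≤ Z ⊓ S := le_inf (hXB.trans hZ.1) (hO.cc.le X hXO)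
  have hXp' : X ≤ Z ⊓ S' := le_inf (hXB.trans hZ.1) (hO'.cc.le X hXO')
  exact hM.tau_two hX hXp hXp' hXM inf_le_left inf_le_left r r' hpp
    (hM.plane' r inf_le_left (by omega)) (hM.plane' r' inf_le_left (by omega))
    (h.nuc hO hM inf_le_right inf_le_left r n1 hX hXp hXO hXK hXM)
    (h.nuc hO' hM inf_le_right inf_le_left r' n2 hX hXp' hXO' hXK hXM) h.hq
end Helpers

section Helpers
set_option linter.all false
set_option linter.unusedSectionVars false
set_option linter.style.haveILetI false
open scoped Classical
variable {F : Type*} [Field F] [Finite F] {V : Type*} [AddCommGroup V] [Module F V] [Finite V]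
variable {K : Finset (Submodule F V)}

theorem meet_line (ht : rk (⊤ : Submodule F V) = 5) {p p' S : Submodule F V} (hS : rk S = 4) (hp' : rk p' = 3)
    (hpS : p ≤ S) (hs : rk (p ⊔ p') = 5) : rk (S ⊓ p') = 2 := by
  have e := rk_sup_inf S p'
  have e1 : rk (p ⊔ p') ≤ rk (S ⊔ p') := rk_mono (sup_le_sup_right hpS _)
  have e2 : rk (S ⊔ p') ≤ 5 := ht ▸ rk_mono le_top
  omega

theorem Ovo.fill {S p : Submodule F V} {O : Finset (Submodule F V)} (h : Ovo K S O) (hp : p ≤ S) (hn : nn O p ≤ nn K p) :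
    K.filter (· ≤ p) = O.filter (· ≤ p) := Finset.eq_of_subset_of_card_le (h.filt hp) hn

theorem Ovo.miss_pt {S p : Submodule F V} {O : Finset (Submodule F V)} (h : Ovo K S O) (hn : nn K p < nn O p) :
    ∃ X ∈ O, X ≤ p ∧ X ∉ K := by
  obtain ⟨X, h1, h2⟩ := Finset.exists_mem_notMem_of_card_lt_card hn
  rw [Finset.mem_filter] at h1 h2
  exact ⟨X, h1.1, h1.2, fun hk => h2 ⟨hk, h1.2⟩⟩

/-- two distinct missing points from solids different from `Z` are impossible -/
theorem Big.two_miss [CharP F 2] (h : Big K) {S S' Z p X Y : Submodule F V} {O O' M : Finset (Submodule F V)}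
    (hO : Ovo K S O) (hO' : Ovo K S' O') (hM : Ovo K Z M) (hSZ : S ≠ Z) (hSZ' : S' ≠ Z) (hpS : p ≤ S) (hpS' : p ≤ S')
    (hpZ : p ≤ Z) (hp : rk p = 3) (hn : Nat.card F + 2 < 2 * nn K p) (hX : X ∈ O) (hXp : X ≤ p) (hXK : X ∉ K)
    (hY : Y ∈ O') (hYp : Y ≤ p) (hYK : Y ∉ K) (hXY : X ≠ Y) : False := by
  have rX := hO.cc.cap.pt X hX
  have rY := hO'.cc.cap.pt Y hY
  have hXM : X ∉ M := fun hc => h.prin hO hM hSZ rX hXK hX hc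
  have hYM : Y ∉ M := fun hc => h.prin hO' hM hSZ' rY hYK hY hc
  exact two_nuclei (hM.cc.cap.filter (· ≤ p)) hp (fun P hP => (Finset.mem_filter.1 hP).2)
    (hM.plane' hp hpZ (by omega)) rX hXp (fun hc => hXM (Finset.mem_filter.1 hc).1) rY hYp
    (fun hc => hYM (Finset.mem_filter.1 hc).1) hXY
    (h.nuc hO hM hpS hpZ hp hn rX hXp hX hXK hXM) (h.nuc hO' hM hpS' hpZ hp hn rY hYp hY hYK hYM)

theorem Cap.tau_line (hK : Cap K) {N R t p : Submodule F V} (hN : rk N = 1) (hNK : N ∉ K) (hR : R ∈ K) (hRt : R ≤ t)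
    (hNt : N ≤ t) (ht : rk t = 2) (hn : nn K t = 1) (hRp : R ≤ p) : R ∈ tau (K.filter (· ≤ p)) N := by
  rw [mem_tau]
  refine ⟨Finset.mem_filter.2 ⟨hR, hRp⟩, fun Q hQ hne hle => ?_⟩
  rw [Finset.mem_filter] at hQ
  have hNR : N ≠ R := by rintro rfl; exact hNK hR
  have e := exch (hK.pt R hR) (hK.pt Q hQ.1) hN hle hNR
  have e2 := eq_line (hK.pt R hR) hN hNR.symm hRt hNt ht
  have := nn_two hR hRt hQ.1 (show Q ≤ t by rw [e2, ← e]; exact le_sup_right) hne.symm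
  omega

theorem Big.core [CharP F 2] (h : Big K) {N p1 p2 : Submodule F V} (hN : rk N = 1) (hNK : N ∉ K) (r1 : rk p1 = 3)
    (r2 : rk p2 = 3) (hmeet : p1 ⊓ p2 = N) (n1 : nn K p1 = Nat.card F + 1) (n2 : nn K p2 = Nat.card F + 1)
    (l1 : ∀ m ≤ p1, N ≤ m → rk m = 2 → nn K m = 1) (l2 : ∀ m ≤ p2, N ≤ m → rk m = 2 → nn K m = 1) : False := by
  have hq : 2048 ≤ Nat.card F := by exact_mod_cast h.hq
  have N1 : N ≤ p1 := hmeet ▸ inf_le_left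
  have N2 : N ≤ p2 := hmeet ▸ inf_le_right
  have rs : rk (p1 ⊔ p2) = 5 := by
    have := rk_sup_inf p1 p2
    rw [hmeet] at this; omega
  have rs' : rk (p2 ⊔ p1) = 5 := by rw [sup_comm]; exact rs
  obtain ⟨S1, hS1⟩ := Finset.card_pos.1 (show 0 < (Ov K p1).card by have := (h.plane_ov r1 (by omega)).2 n1; omega)
  rw [mem_Ov] at hS1
  obtain ⟨O1, hO1⟩ := exists_ovo h.cap h.hq hS1.2.1 hS1.2.2
  have nle : ∀ {T : Submodule F V}, rk T = 4 → p1 ≤ T → ¬ p2 ≤ T := by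
    intro T hT a b
    have := rk_mono (sup_le a b)
    omega
  have t2 := meet_line h.top hS1.2.1 r2 hS1.1 rs
  have m2 := l2 (S1 ⊓ p2) inf_le_right (le_inf (N1.trans hS1.1) N2) t2
  obtain ⟨R2, hR2⟩ := Finset.card_pos.1 (show 0 < (K.filter (· ≤ S1 ⊓ p2)).card by change 0 < nn K _; omega)
  rw [Finset.mem_filter] at hR2
  have info : ∀ Z ∈ Ov K p2, rk (Z ⊓ S1) = 3 ∧ rk (Z ⊓ p1) = 2 ∧ ∃ R1 ∈ K, R1 ≤ Z ⊓ p1 ∧ R1 ≠ R2 := by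
    intro Z hZ
    rw [mem_Ov] at hZ
    have t1 := meet_line h.top hZ.2.1 r1 hZ.1 rs'
    refine ⟨meet3 h.top hZ.2.1 hS1.2.1 ?_, t1, ?_⟩
    · rintro rfl; exact nle hZ.2.1 hS1.1 hZ.1
    · have m1 := l1 (Z ⊓ p1) inf_le_right (le_inf (N2.trans hZ.1) N1) t1
      obtain ⟨R1, hR1⟩ := Finset.card_pos.1 (show 0 < (K.filter (· ≤ Z ⊓ p1)).card by change 0 < nn K _; omega)
      rw [Finset.mem_filter] at hR1
      refine ⟨R1, hR1.1, hR1.2, ?_⟩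
      rintro rfl
      have : R1 ≤ N := hmeet ▸ le_inf (hR1.2.trans inf_le_right) (hR2.2.trans inf_le_right)
      have := pt_le_pt (h.cap.pt R1 hR1.1) hN this
      exact hNK (this ▸ hR1.1)
  have ex : ∃ Z ∈ Ov K p2, Nat.card F + 2 < 2 * nn K (Z ⊓ S1) := by
    by_contra! hcon
    have hc := (h.plane_ov r2 (by omega)).2 n2
    have inj : Set.InjOn (fun Z => Z ⊓ S1) (Ov K p2 : Set (Submodule F V)) := by
      intro Z hZ Z' hZ' e
      simp only [Finset.mem_coe, mem_Ov] at hZ hZ'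
      rw [join_meet h.top hZ.1 (nle hS1.2.1 hS1.1) hZ.2.1 hS1.2.1, join_meet h.top hZ'.1 (nle hS1.2.1 hS1.1) hZ'.2.1 hS1.2.1]
      exact congrArg (p2 ⊔ ·) e
    have c := Finset.card_image_of_injOn inj
    have := hO1.fam ((Ov K p2).image (fun Z => Z ⊓ S1)) (by
      intro p hp
      obtain ⟨Z, hZ, rfl⟩ := Finset.mem_image.1 hp
      obtain ⟨a, b, R1, hR1, hRl, hRR⟩ := info Z hZ
      have hZ' := mem_Ov.1 hZ
      refine ⟨inf_le_right, a, hO1.plane' a inf_le_right ?_, hcon Z hZ⟩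
      exact nn_two hR1 (le_inf (hRl.trans inf_le_left) ((hRl.trans inf_le_right).trans hS1.1)) hR2.1
        (le_inf ((hR2.2.trans inf_le_right).trans hZ'.1) (hR2.2.trans inf_le_left)) hRR)
    omega
  obtain ⟨S2, hS2, hbig⟩ := ex
  obtain ⟨ra, rt1, R1, hR1, hRl, hRR⟩ := info S2 hS2
  rw [mem_Ov] at hS2
  obtain ⟨O2, hO2⟩ := exists_ovo h.cap h.hq hS2.2.1 hS2.2.2
  have hS12 : S1 ≠ S2 := by rintro rfl; exact nle hS2.2.1 hS1.1 hS2.1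
  set a := S2 ⊓ S1 with ha
  have a1 : a ≤ S1 := inf_le_right
  have a2 : a ≤ S2 := inf_le_left
  have o1 := hO1.plane' ra a1 (by omega)
  have hle := hO1.nle a1
  have hge : Nat.card F ≤ nn K a := by
    by_contra hcon
    have : 1 < (O1.filter (· ≤ a) \ K.filter (· ≤ a)).card := by
      rw [Finset.card_sdiff_of_subset (hO1.filt a1)]
      change 1 < nn O1 a - nn K a
      omega
    obtain ⟨X, hX, Y, hY, hXY⟩ := Finset.one_lt_card.1 this
    simp only [Finset.mem_sdiff, Finset.mem_filter] at hX hY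
    exact h.two_miss hO1 hO1 hO2 hS12 hS12 a1 a1 a2 ra hbig hX.1.1 hX.1.2 (fun hk => hX.2 ⟨hk, hX.1.2⟩)
      hY.1.1 hY.1.2 (fun hk => hY.2 ⟨hk, hY.1.2⟩) hXY
  by_cases hcase : nn K a = Nat.card F + 1
  · have ea := hO1.fill a1 (by omega)
    have op := hO1.plane' r1 hS1.1 (by omega)
    have ep := hO1.fill hS1.1 (by omega)
    have Na : N ≤ a := le_inf (N2.trans hS2.1) (N1.trans hS1.1)
    have hNO : N ∉ O1 := by
      intro hc
      have : N ∈ K.filter (· ≤ p1) := ep ▸ Finset.mem_filter.2 ⟨hc, N1⟩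
      exact hNK (Finset.mem_filter.1 this).1
    refine hO1.tau_two hN Na N1 hNO a1 hS1.1 ra r1 ?_ o1 op ?_ ?_ h.hq
    · intro e
      exact nle hS2.2.1 (e ▸ a2) hS2.1
    · rw [← ea]
      intro P hP Q hQ hPQ hle
      have t := TL ra (h.cap.filter (· ≤ a)) (fun P hP => (Finset.mem_filter.1 hP).2) hN Na hP hQ hPQ hle
      have c : (K.filter (· ≤ a)).card = Nat.card F + 1 := hcase
      have x1 := h.cap.tau_line (p := a) hN hNK hR1 hRl (le_inf (N2.trans hS2.1) N1) rt1
        (l1 _ inf_le_right (le_inf (N2.trans hS2.1) N1) rt1)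
        (le_inf (hRl.trans inf_le_left) ((hRl.trans inf_le_right).trans hS1.1))
      have x2 := h.cap.tau_line (p := a) hN hNK hR2.1 hR2.2 (le_inf (N1.trans hS1.1) N2) t2 m2
        (le_inf ((hR2.2.trans inf_le_right).trans hS2.1) (hR2.2.trans inf_le_left))
      have := Finset.one_lt_card.2 ⟨R1, x1, R2, x2, hRR⟩
      omega
    · rw [← ep]
      intro P hP Q hQ hPQ hle
      rw [Finset.mem_filter] at hP hQ
      have := l1 (P ⊔ Q) (sup_le hP.2 hQ.2) hle (rk_line (h.cap.pt P hP.1) (h.cap.pt Q hQ.1) hPQ)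
      rw [h.cap.nn_bis hP.1 hQ.1 hPQ] at this
      omega
  · have c3 := (h.plane_ov ra hge).1
    have : ∃ S3 ∈ Ov K a, S3 ∉ ({S1, S2} : Finset (Submodule F V)) := by
      apply Finset.exists_mem_notMem_of_card_lt_card
      have := Finset.card_le_two (a := S1) (b := S2)
      omega
    obtain ⟨S3, hS3, hne⟩ := this
    simp only [Finset.mem_insert, Finset.mem_singleton, not_or] at hne
    rw [mem_Ov] at hS3
    obtain ⟨O3, hO3⟩ := exists_ovo h.cap h.hq hS3.2.1 hS3.2.2
    have o3 := hO3.plane' ra hS3.1 (by omega)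
    obtain ⟨X, hX, hXa, hXK⟩ := hO1.miss_pt (p := a) (by omega)
    obtain ⟨Y, hY, hYa, hYK⟩ := hO3.miss_pt (p := a) (by omega)
    refine h.two_miss hO1 hO3 hO2 hS12 hne.2 a1 hS3.1 a2 ra hbig hX hXa hXK hY hYa hYK ?_
    rintro rfl
    exact h.prin hO1 hO3 (fun e => hne.1 e.symm) (hO1.cc.cap.pt _ hX) hXK hX hY

theorem Big.lines (h : Big K) {N p : Submodule F V} (hN : rk N = 1) (hNK : N ∉ K) (hp : rk p = 3) (hNp : N ≤ p)
    (hn : nn K p = Nat.card F + 1) (hnuc : ∀ m, rk m = 2 → m ≤ p → nn K m = 1 → N ≤ m) :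
    ∀ m ≤ p, N ≤ m → rk m = 2 → nn K m = 1 := by
  have one : ∀ P ∈ K, P ≤ p → nn K (P ⊔ N) = 1 := by
    intro P hP hPp
    have c := card_SS_plane h.cap hP hPp hp
    rw [hn] at c
    push_cast at c
    have c : 0 < (SS K P p).card := by
      have : (0 : ℤ) < (SS K P p).card := by linarith
      exact_mod_cast this
    obtain ⟨m, hm⟩ := Finset.card_pos.1 c
    have rP := h.cap.pt P hP
    rw [mem_SS rP] at hm
    have := hnuc m hm.2.2.1 hm.2.1 hm.2.2.2
    rw [← eq_line rP hN (by rintro rfl; exact hNK hP) hm.1 this hm.2.2.1]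
    exact hm.2.2.2
  have le1 : ∀ m ∈ up N p, (nn K m : ℤ) ≤ 1 := by
    intro m hm
    rw [mem_up, hN] at hm
    by_contra hcon
    have : 0 < (K.filter (· ≤ m)).card := by change 0 < nn K m; omega
    obtain ⟨P, hP⟩ := Finset.card_pos.1 this
    rw [Finset.mem_filter] at hP
    have e := eq_line (h.cap.pt P hP.1) hN (by rintro rfl; exact hNK hP.1) hP.2 hm.1 hm.2.2
    have := one P hP.1 (hP.2.trans hm.2.1)
    rw [← e] at this
    omega
  have s := sum_up K h.cap.pt hNp
  rw [nn_pt0 h.cap.pt hN hNK, hn] at s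
  have c := card_up2 hNp (by rw [hN, hp])
  intro m hm hNm rm
  have hmu : m ∈ up N p := mem_up.2 ⟨hNm, hm, by omega⟩
  by_contra hne
  have : ∑ L ∈ up N p, ((nn K L : ℤ) - (0 : ℕ)) < ∑ L ∈ up N p, (1 : ℤ) := by
    apply Finset.sum_lt_sum
    · intro L hL; have := le1 L hL; push_cast; linarith
    · refine ⟨m, hmu, ?_⟩
      have := le1 m hmu
      push_cast
      omega
  rw [s, Finset.sum_const, nsmul_eq_mul, c] at this
  push_cast at this
  linarith
end Helpers

section Final
set_option linter.all false
open scoped Classical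

theorem sub_inj {F : Type*} [Field F] {n : ℕ} : Function.Injective (fun P : PGPoint F n => P.submodule) :=
  Projectivization.submodule_injective

theorem sub_rk {F : Type*} [Field F] {n : ℕ} (P : PGPoint F n) : rk P.submodule = 1 :=
  Projectivization.finrank_submodule P

theorem sub_surj {F : Type*} [Field F] [Finite F] {n : ℕ} {W : Submodule F (Fin (n + 1) → F)} (hW : rk W = 1) :
    ∃ P : PGPoint F n, P.submodule = W := by
  obtain ⟨v, hv, rfl⟩ := pt_eq_span hW
  exact ⟨Projectivization.mk F v hv, Projectivization.submodule_mk v hv⟩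

noncomputable def KK {F : Type*} [Field F] [Finite F] {n : ℕ} (K : Set (PGPoint F n)) :
    Finset (Submodule F (Fin (n + 1) → F)) :=
  Finset.univ.filter (fun W => ∃ P ∈ K, P.submodule = W)

theorem mem_KK {F : Type*} [Field F] [Finite F] {n : ℕ} {K : Set (PGPoint F n)} {W : Submodule F (Fin (n + 1) → F)} :
    W ∈ KK K ↔ ∃ P ∈ K, P.submodule = W := by simp [KK]

theorem sub_mem_KK {F : Type*} [Field F] [Finite F] {n : ℕ} {K : Set (PGPoint F n)} {P : PGPoint F n} :
    P.submodule ∈ KK K ↔ P ∈ K := by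
  rw [mem_KK]
  exact ⟨fun ⟨Q, hQ, e⟩ => sub_inj e ▸ hQ, fun h => ⟨P, h, rfl⟩⟩

theorem nn_KK {F : Type*} [Field F] [Finite F] {n : ℕ} (K : Set (PGPoint F n)) (W : Submodule F (Fin (n + 1) → F)) :
    nn (KK K) W = (ptsIn W ∩ K).ncard := by
  rw [← Set.ncard_image_of_injective _ sub_inj]
  unfold nn
  rw [← Set.ncard_coe_finset]
  congr 1
  ext L
  simp only [Finset.coe_filter, Set.mem_setOf_eq, mem_KK, Set.mem_image, Set.mem_inter_iff, ptsIn]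
  constructor
  · rintro ⟨⟨P, hP, rfl⟩, h2⟩; exact ⟨P, ⟨h2, hP⟩, rfl⟩
  · rintro ⟨P, ⟨h2, hP⟩, rfl⟩; exact ⟨⟨P, hP, rfl⟩, h2⟩

theorem coll_iff {F : Type*} [Field F] [Finite F] {n : ℕ} {P Q R : PGPoint F n} (h : P ≠ Q) :
    Coll3 P Q R ↔ R.submodule ≤ P.submodule ⊔ Q.submodule := by
  have hne : P.submodule ≠ Q.submodule := fun e => h (sub_inj e)
  have r := rk_line (sub_rk P) (sub_rk Q) hne
  unfold Coll3
  change rk (P.submodule ⊔ Q.submodule ⊔ R.submodule) ≤ 2 ↔ _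
  constructor
  · intro h2
    by_contra hc
    have := rk_sup_pt (sub_rk R) hc
    omega
  · intro h2
    rw [sup_eq_left.2 h2, r]

theorem cap_KK {F : Type*} [Field F] [Finite F] {n : ℕ} {K : Set (PGPoint F n)} (hK : IsCap K) : Cap (KK K) := by
  constructor
  · intro W hW
    obtain ⟨P, _, rfl⟩ := mem_KK.1 hW
    exact sub_rk P
  · intro P' hP Q' hQ R' hR h1 h2 h3
    obtain ⟨P, hP1, rfl⟩ := mem_KK.1 hP
    obtain ⟨Q, hQ1, rfl⟩ := mem_KK.1 hQ
    obtain ⟨R, hR1, rfl⟩ := mem_KK.1 hR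
    have h1 : P ≠ Q := by rintro rfl; exact h1 rfl
    rw [← coll_iff h1]
    exact hK P hP1 Q hQ1 R hR1 h1 (by rintro rfl; exact h2 rfl) (by rintro rfl; exact h3 rfl)

theorem compl_KK {F : Type*} [Field F] [Finite F] {n : ℕ} {K : Set (PGPoint F n)} (hK : IsCompleteCap K) :
    ∀ X, rk X = 1 → X ∉ KK K → ∃ P ∈ KK K, ∃ Q ∈ KK K, P ≠ Q ∧ X ≤ P ⊔ Q := by
  intro X' hX hXK
  obtain ⟨X, rfl⟩ := sub_surj hX
  rw [sub_mem_KK] at hXK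
  by_contra! hcon
  have hb : ∀ P ∈ K, ∀ Q ∈ K, P ≠ Q → ¬ X.submodule ≤ P.submodule ⊔ Q.submodule := fun P hP Q hQ hne =>
    hcon _ (sub_mem_KK.2 hP) _ (sub_mem_KK.2 hQ) (fun e => hne (sub_inj e))
  have kk : ∀ P ∈ K, ∀ R ∈ K, P ≠ R → ¬ R.submodule ≤ P.submodule ⊔ X.submodule := by
    intro P hP R hR hne hle
    have := exch (sub_rk P) (sub_rk X) (sub_rk R) hle (fun e => hne (sub_inj e).symm)
    exact hb P hP R hR hne (this ▸ le_sup_right)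
  apply hK.2 X hXK
  intro P hP Q hQ R hR n1 n2 n3
  rw [coll_iff n1]
  intro hle
  rcases Set.mem_insert_iff.1 hP with hP1 | hP1
  · subst hP1
    have hQ1 := (Set.mem_insert_iff.1 hQ).resolve_left n1.symm
    have hR1 := (Set.mem_insert_iff.1 hR).resolve_left n2.symm
    exact kk Q hQ1 R hR1 n3 (by rw [sup_comm]; exact hle)
  · rcases Set.mem_insert_iff.1 hQ with hQ1 | hQ1
    · subst hQ1
      have hR1 := (Set.mem_insert_iff.1 hR).resolve_left n3.symm
      exact kk P hP1 R hR1 n2 hle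
    · rcases Set.mem_insert_iff.1 hR with hR1 | hR1
      · subst hR1
        exact hb P hP1 Q hQ1 n1 hle
      · exact hK.1 P hP1 Q hQ1 R hR1 n1 n2 n3 ((coll_iff n1).2 hle)

theorem card_KK {F : Type*} [Field F] [Finite F] {n : ℕ} (K : Set (PGPoint F n)) : (KK K).card = K.ncard := by
  have := nn_KK K ⊤
  unfold nn at this
  rw [Finset.filter_true_of_mem (fun _ _ => le_top)] at this
  rw [this]
  congr 1
  ext P
  simp [ptsIn]

theorem char_two {F : Type*} [Field F] [Fintype F] (h : Even (Fintype.card F)) : CharP F 2 := by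
  obtain ⟨p, hp⟩ := CharP.exists F
  obtain ⟨n, hpr, hc⟩ := FiniteField.card F p
  rw [hc] at h
  have h2 : 2 ∣ p := Nat.prime_two.dvd_of_dvd_pow h.two_dvd
  rw [(Nat.prime_dvd_prime_iff_eq Nat.prime_two hpr).1 h2]
  exact hp

theorem real_bound {q k : ℕ} (hq : 2048 ≤ q)
    (hk : (q : ℝ) ^ 3 - 2 * (q : ℝ) ^ 2 + 3 * (q : ℝ) * Real.sqrt q + 8 * (q : ℝ) - 9 * Real.sqrt q - 6 ≤ (k : ℝ)) :
    ((q : ℤ) - 3) * ((q : ℤ)^2 - 2 * q + 137) + 3 * (q : ℤ)^2 ≤ k := by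
  have hq' : (2048 : ℝ) ≤ q := by exact_mod_cast hq
  have s : (45 : ℝ) ≤ Real.sqrt q := by
    apply Real.le_sqrt_of_sq_le; linarith
  have : ((q : ℝ) - 3) * ((q : ℝ)^2 - 2 * q + 137) + 3 * (q : ℝ)^2 ≤ k := by
    have := mul_nonneg (show (0 : ℝ) ≤ q - 3 by linarith) (sub_nonneg.2 s)
    nlinarith
  exact_mod_cast this

end Final

theorem stmt4 (F : Type*) [Field F] [Fintype F] (q : ℕ) (hcard : Fintype.card F = q)
    (hqeven : Even q) (hq : 2048 ≤ q)
    (K : Set (PGPoint F 4)) (hK : IsCompleteCap K)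
    (hk : (q : ℝ) ^ 3 - 2 * (q : ℝ) ^ 2 + 3 * (q : ℝ) * Real.sqrt q + 8 * (q : ℝ) - 9 * Real.sqrt q - 6 ≤ (K.ncard : ℝ)) :
    ¬ ∃ (N : PGPoint F 4) (π₁ π₂ : Submodule F (Fin 5 → F)),
      N ∉ K ∧ Module.finrank F π₁ = 3 ∧ Module.finrank F π₂ = 3 ∧
      ptsIn π₁ ∩ ptsIn π₂ = {N} ∧
      IsCap (ptsIn π₁ ∩ K) ∧ (ptsIn π₁ ∩ K).ncard = q + 1 ∧ IsNucleus π₁ (ptsIn π₁ ∩ K) N ∧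
      IsCap (ptsIn π₂ ∩ K) ∧ (ptsIn π₂ ∩ K).ncard = q + 1 ∧ IsNucleus π₂ (ptsIn π₂ ∩ K) N := by
  subst hcard
  haveI := char_two hqeven
  have hc : Nat.card F = Fintype.card F := Nat.card_eq_fintype_card
  have hB : Big (KK K) := by
    refine ⟨?_, cap_KK hK.1, compl_KK hK, ?_, ?_⟩
    · change finrank F (⊤ : Submodule F (Fin 5 → F)) = 5
      rw [finrank_top, Module.finrank_fin_fun]
    · rw [card_KK, hc]
      unfold thr
      rw [hc]
      exact real_bound hq hk
    · rw [hc]; exact_mod_cast hq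
  rintro ⟨N, p1, p2, hN, r1, r2, hmeet, -, c1, u1, -, c2, u2⟩
  have hNK : N.submodule ∉ KK K := fun h => hN (sub_mem_KK.1 h)
  have hNm : N ∈ ptsIn p1 ∩ ptsIn p2 := by rw [hmeet]; rfl
  have hinf : p1 ⊓ p2 = N.submodule := by
    symm
    apply eq_of_rk (le_inf hNm.1 hNm.2)
    rw [sub_rk]
    by_contra hcon
    have hlt : N.submodule < p1 ⊓ p2 := by
      refine lt_of_le_of_ne (le_inf hNm.1 hNm.2) fun e => ?_
      rw [← e, sub_rk] at hcon
      exact hcon le_rfl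
    obtain ⟨v, hv, hvN⟩ := SetLike.exists_of_lt hlt
    have hv0 : v ≠ 0 := by rintro rfl; exact hvN (zero_mem _)
    have hP : Projectivization.mk F v hv0 ∈ ptsIn p1 ∩ ptsIn p2 := by
      constructor
      · change (Projectivization.mk F v hv0).submodule ≤ p1
        rw [Projectivization.submodule_mk, Submodule.span_singleton_le_iff_mem]
        exact hv.1
      · change (Projectivization.mk F v hv0).submodule ≤ p2
        rw [Projectivization.submodule_mk, Submodule.span_singleton_le_iff_mem]
        exact hv.2
    rw [hmeet, Set.mem_singleton_iff] at hP
    apply hvN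
    rw [← hP, Projectivization.submodule_mk]
    exact Submodule.mem_span_singleton_self v
  have inter : ∀ {l p : Submodule F (Fin 5 → F)}, l ≤ p → ptsIn l ∩ (ptsIn p ∩ K) = ptsIn (n := 4) l ∩ K := by
    intro l p hl
    ext P
    constructor
    · exact fun x => ⟨x.1, x.2.2⟩
    · exact fun x => ⟨x.1, le_trans (show P.submodule ≤ l from x.1) hl, x.2⟩
  have n1 : nn (KK K) p1 = Nat.card F + 1 := by rw [nn_KK, hc]; exact c1
  have n2 : nn (KK K) p2 = Nat.card F + 1 := by rw [nn_KK, hc]; exact c2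
  refine hB.core (sub_rk N) hNK r1 r2 hinf n1 n2
    (hB.lines (sub_rk N) hNK r1 hNm.1 n1 ?_) (hB.lines (sub_rk N) hNK r2 hNm.2 n2 ?_)
  · intro m hm hmp h1
    rw [nn_KK] at h1
    exact u1 m hm hmp (by rw [inter hmp]; exact h1)
  · intro m hm hmp h1
    rw [nn_KK] at h1
    exact u2 m hm hmp (by rw [inter hmp]; exact h1)
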